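/- arXiv:1808.05433 — 8 statements merged into one kernel-verified Lean document; each statement's English description precedes it below -/
import Mathlib

section
/- For every positive integer k, the symmetric punctured interval tile k(1)k tiles ℤ^3. -/
/-- The one-dimensional tile `k(m)ℓ`: an interval of length `k`, a gap of
length `m`, and an interval of length `ℓ`. -/
def punctTile (k m l : ℕ) : Set ℤ :=
  {x : ℤ | (0 ≤ x ∧ x < (k : ℤ)) ∨ ((k : ℤ) + m ≤ x ∧ x < (k : ℤ) + m + l)}

/-- `P` is a copy of the one-dimensional tile `T` in `ℤ^d`: the image of `T`
under `x ↦ v + x • e i` or `x ↦ v - x • e i` for some axis `i` and `v ∈ ℤ^d`. -/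
def IsCopy (d : ℕ) (T : Set ℤ) (P : Set (Fin d → ℤ)) : Prop :=
  ∃ (v : Fin d → ℤ) (i : Fin d) (ε : ℤ), (ε = 1 ∨ ε = -1) ∧
    P = (fun x : ℤ => fun j : Fin d => v j + if j = i then ε * x else 0) '' T

/-- The one-dimensional tile `T` tiles the subset `S ⊆ ℤ^d`. -/
def Tiles (d : ℕ) (T : Set ℤ) (S : Set (Fin d → ℤ)) : Prop :=
  ∃ F : Set (Set (Fin d → ℤ)),
    (∀ P ∈ F, IsCopy d T P) ∧ F.Pairwise Disjoint ∧ ⋃₀ F = S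

/-- The one-dimensional tile `T` tiles `ℤ^d`. -/
def TilesZd (d : ℕ) (T : Set ℤ) : Prop := Tiles d T Set.univ

/-- A tiling from sets of starting points such that every point is covered exactly once. -/
theorem tiling_of_starts (T : Set ℤ) (S : Fin 3 → Set (Fin 3 → ℤ))
    (h : ∀ p : Fin 3 → ℤ, ∃ (i : Fin 3) (t : ℤ),
      (t ∈ T ∧ (fun j => p j - if j = i then t else 0) ∈ S i) ∧
      ∀ (i' : Fin 3) (t' : ℤ), t' ∈ T → (fun j => p j - if j = i' then t' else 0) ∈ S i' →
        i' = i ∧ t' = t) : TilesZd 3 T := by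
  refine ⟨{P | ∃ (i : Fin 3) (v : Fin 3 → ℤ), v ∈ S i ∧
    P = (fun x : ℤ => fun j : Fin 3 => v j + if j = i then (1 : ℤ) * x else 0) '' T}, ?_, ?_, ?_⟩
  · rintro P ⟨i, v, hv, rfl⟩
    exact ⟨v, i, 1, Or.inl rfl, rfl⟩
  · rintro P ⟨i, v, hv, rfl⟩ P' ⟨i', v', hv', rfl⟩ hne
    rw [Set.disjoint_left]
    rintro p ⟨t, ht, htp⟩ ⟨t', ht', htp'⟩
    apply hne
    obtain ⟨i₀, t₀, -, huniq⟩ := h p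
    have e : (fun j => p j - if j = i then t else 0) = v := by
      funext j; rw [← htp]; by_cases hj : j = i <;> simp [hj]
    have e' : (fun j => p j - if j = i' then t' else 0) = v' := by
      funext j; rw [← htp']; by_cases hj : j = i' <;> simp [hj]
    obtain ⟨h1, h2⟩ := huniq i t ht (by rw [e]; exact hv)
    obtain ⟨h3, h4⟩ := huniq i' t' ht' (by rw [e']; exact hv')
    subst h1 h2 h3 h4
    rw [← e, ← e']
  · rw [Set.eq_univ_iff_forall]
    intro p
    obtain ⟨i, t, ⟨ht, hs⟩, -⟩ := h p
    refine ⟨_, ⟨i, _, hs, rfl⟩, t, ht, ?_⟩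
    funext j
    by_cases hj : j = i <;> simp [hj]

/-- The unused class in layer `z`. -/
def freeClass (k z : ℤ) : ℤ := if z % k = 0 then (z / k - 1) % 3 else (z / k + 1) % 3

theorem mul_small {M a b : ℤ} (hM : 0 < M) (h : M * a = b) (c d : ℤ)
    (h1 : M * (c - 1) < b) (h2 : b < M * (d + 1)) : c ≤ a ∧ a ≤ d := by
  subst h
  have := lt_of_mul_lt_mul_left h1 hM.le
  have := lt_of_mul_lt_mul_left h2 hM.le
  omega

/-- Vertical direction: the translates of `T` by multiples of `k` cover everything twice. -/
theorem vertical_cover (k : ℕ) (hk : 0 < k) (z c : ℤ) (hc : 0 ≤ c ∧ c < 3) :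
    (c ≠ freeClass k z → ∃ t, (t ∈ punctTile k 1 k ∧ ∃ q, z - t = k * q ∧ q % 3 = c) ∧
      ∀ t', t' ∈ punctTile k 1 k → (∃ q, z - t' = k * q ∧ q % 3 = c) → t' = t) ∧
    (c = freeClass k z → ∀ t, t ∈ punctTile k 1 k → ¬ ∃ q, z - t = k * q ∧ q % 3 = c) := by
  have hk' : (0 : ℤ) < k := by exact_mod_cast hk
  have hz := Int.mul_ediv_add_emod z k
  have hr0 := Int.emod_nonneg z hk'.ne'
  have hr1 := Int.emod_lt_of_pos z hk'
  unfold freeClass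
  generalize z / (k : ℤ) = Q at *
  generalize z % (k : ℤ) = r at *
  have key : ∀ t, t ∈ punctTile k 1 k → ∀ q, z - t = k * q →
      (q = Q ∧ t = r) ∨ (q = Q - 1 ∧ t = k + r ∧ 0 < r) ∨ (q = Q - 2 ∧ t = 2 * k + r ∧ r = 0) := by
    intro t ht q hq
    simp only [punctTile, Set.mem_ofPred_eq, Nat.cast_one] at ht
    have h1 : (k : ℤ) * (Q - q) = t - r := by rw [mul_sub]; omega
    obtain ⟨h2, h3⟩ := mul_small hk' h1 0 2 (by omega) (by omega)
    obtain ⟨e, he⟩ : ∃ e, e = Q - q := ⟨_, rfl⟩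
    rw [← he] at h1 h2 h3
    interval_cases e <;> omega
  have s0 : z - r = k * Q := by omega
  have s1 : z - (k + r) = k * (Q - 1) := by rw [mul_sub]; omega
  have s2 : z - (2 * k + r) = k * (Q - 2) := by rw [mul_sub]; omega
  constructor
  · intro hne
    obtain ⟨t, q, ht, hq, hqc⟩ : ∃ t q, t ∈ punctTile k 1 k ∧ z - t = k * q ∧ q % 3 = c := by
      by_cases hr : r = 0
      · rw [if_pos hr] at hne
        rcases (by omega : Q % 3 = c ∨ (Q - 2) % 3 = c) with h | h
        · exact ⟨r, Q, by simp only [punctTile, Set.mem_ofPred_eq, Nat.cast_one]; omega, s0, h⟩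
        · exact ⟨_, Q - 2, by simp only [punctTile, Set.mem_ofPred_eq, Nat.cast_one]; omega, s2, h⟩
      · rw [if_neg hr] at hne
        rcases (by omega : Q % 3 = c ∨ (Q - 1) % 3 = c) with h | h
        · exact ⟨r, Q, by simp only [punctTile, Set.mem_ofPred_eq, Nat.cast_one]; omega, s0, h⟩
        · exact ⟨_, Q - 1, by simp only [punctTile, Set.mem_ofPred_eq, Nat.cast_one]; omega, s1, h⟩
    refine ⟨t, ⟨ht, q, hq, hqc⟩, ?_⟩
    rintro t' ht' ⟨q', hq', hqc'⟩
    have k1 := key t ht q hq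
    have k2 := key t' ht' q' hq'
    omega
  · rintro hce t ht ⟨q, hq, hqc⟩
    have k1 := key t ht q hq
    split_ifs at hce <;> omega

/-- Steps of size one: pairs of consecutive blocks of length `k`. -/
theorem block_cover (k : ℕ) (P : ℤ → Prop) (hP : ∀ j, P j → ¬ P (j - 1)) (w : ℤ) :
    ((w % (k + 1) < k ∧ (P (w / (k + 1)) ∨ P (w / (k + 1) - 1))) →
      ∃ t, (t ∈ punctTile k 1 k ∧ ∃ j, w - t = (k + 1) * j ∧ P j) ∧
        ∀ t', t' ∈ punctTile k 1 k → (∃ j, w - t' = (k + 1) * j ∧ P j) → t' = t) ∧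
    (¬ (w % (k + 1) < k ∧ (P (w / (k + 1)) ∨ P (w / (k + 1) - 1))) →
      ∀ t, t ∈ punctTile k 1 k → ¬ ∃ j, w - t = (k + 1) * j ∧ P j) := by
  have hk' : (0 : ℤ) < k + 1 := by omega
  have hz := Int.mul_ediv_add_emod w (k + 1)
  have hr0 := Int.emod_nonneg w hk'.ne'
  have hr1 := Int.emod_lt_of_pos w hk'
  generalize w / ((k : ℤ) + 1) = Q at *
  generalize w % ((k : ℤ) + 1) = r at *
  have key : ∀ t, t ∈ punctTile k 1 k → ∀ q, w - t = (k + 1) * q →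
      (q = Q ∧ t = r ∧ r < k) ∨ (q = Q - 1 ∧ t = k + 1 + r ∧ r < k) := by
    intro t ht q hq
    simp only [punctTile, Set.mem_ofPred_eq, Nat.cast_one] at ht
    have h1 : ((k : ℤ) + 1) * (Q - q) = t - r := by rw [mul_sub]; omega
    obtain ⟨h2, h3⟩ := mul_small hk' h1 0 1 (by omega) (by omega)
    obtain ⟨e, he⟩ : ∃ e, e = Q - q := ⟨_, rfl⟩
    rw [← he] at h1 h2 h3
    interval_cases e <;> omega
  have s0 : w - r = (k + 1) * Q := by omega
  have s1 : w - (k + 1 + r) = (k + 1) * (Q - 1) := by rw [mul_sub]; omega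
  constructor
  · rintro ⟨hr, hPQ⟩
    rcases hPQ with h | h
    · refine ⟨r, ⟨by simp only [punctTile, Set.mem_ofPred_eq, Nat.cast_one]; omega, Q, s0, h⟩, ?_⟩
      rintro t' ht' ⟨q, hq, hqP⟩
      rcases key t' ht' q hq with ⟨-, h2, -⟩ | ⟨h1, -, -⟩
      · exact h2
      · rw [h1] at hqP; exact absurd hqP (hP _ h)
    · refine ⟨_, ⟨by simp only [punctTile, Set.mem_ofPred_eq, Nat.cast_one]; omega, Q - 1, s1, h⟩, ?_⟩
      rintro t' ht' ⟨q, hq, hqP⟩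
      rcases key t' ht' q hq with ⟨h1, -, -⟩ | ⟨-, h2, -⟩
      · rw [h1] at hqP; exact absurd h (hP _ hqP)
      · exact h2
  · rintro hn t ht ⟨q, hq, hqP⟩
    rcases key t ht q hq with ⟨h1, -, hr⟩ | ⟨h1, -, hr⟩
    · exact hn ⟨hr, Or.inl (h1 ▸ hqP)⟩
    · exact hn ⟨hr, Or.inr (h1 ▸ hqP)⟩

/-- Steps of size `k`: strings. -/
theorem string_cover (k : ℕ) (hk : 0 < k) (w : ℤ) :
    (¬ ((k : ℤ) + 1 ∣ w / k) →
      ∃ t, (t ∈ punctTile k 1 k ∧ ∃ n : ℤ, (w - k * t) / k = 2 * (k + 1) * n + 1) ∧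
        ∀ t', t' ∈ punctTile k 1 k → (∃ n : ℤ, (w - k * t') / k = 2 * (k + 1) * n + 1) → t' = t) ∧
    (((k : ℤ) + 1 ∣ w / k) →
      ∀ t, t ∈ punctTile k 1 k → ¬ ∃ n : ℤ, (w - k * t) / k = 2 * (k + 1) * n + 1) := by
  have hk' : (0 : ℤ) < k := by exact_mod_cast hk
  have hd : ∀ t : ℤ, (w - k * t) / k = w / k - t := by
    intro t
    rw [sub_eq_add_neg, ← mul_neg, Int.add_mul_ediv_left _ _ hk'.ne', ← sub_eq_add_neg]
  simp only [hd]
  generalize w / (k : ℤ) = i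
  have hM : (0 : ℤ) < 2 * (k + 1) := by omega
  have hz := Int.mul_ediv_add_emod i (2 * (k + 1))
  have hr0 := Int.emod_nonneg i hM.ne'
  have hr1 := Int.emod_lt_of_pos i hM
  generalize i / (2 * ((k : ℤ) + 1)) = Q at *
  generalize i % (2 * ((k : ℤ) + 1)) = r at *
  have key : ∀ t, t ∈ punctTile k 1 k → ∀ q, i - t = 2 * (k + 1) * q + 1 → t = r - 1 := by
    intro t ht q hq
    simp only [punctTile, Set.mem_ofPred_eq, Nat.cast_one] at ht
    have h1 : (2 * ((k : ℤ) + 1)) * (Q - q) = t - r + 1 := by rw [mul_sub]; linarith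
    obtain ⟨h2, h3⟩ := mul_small hM h1 0 0 (by omega) (by omega)
    have : Q - q = 0 := by omega
    rw [this] at h1
    omega
  have hdv : ((k : ℤ) + 1 ∣ i) ↔ r = 0 ∨ r = k + 1 := by
    have h0 : ((k : ℤ) + 1 ∣ i) ↔ ((k : ℤ) + 1 ∣ r) := by
      rw [← hz, mul_assoc, mul_left_comm, Int.dvd_add_right (Dvd.intro _ rfl)]
    rw [h0]
    constructor
    · rintro ⟨e, he⟩
      obtain ⟨h2, h3⟩ := mul_small (by omega : (0 : ℤ) < k + 1) he.symm 0 1 (by omega) (by omega)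
      interval_cases e <;> omega
    · rintro (h | h) <;> rw [h]
      exact dvd_zero _
  rw [hdv]
  constructor
  · intro h
    refine ⟨r - 1, ⟨by simp only [punctTile, Set.mem_ofPred_eq, Nat.cast_one]; omega, Q, by linarith⟩, ?_⟩
    rintro t' ht' ⟨q, hq⟩
    exact key t' ht' q hq
  · rintro h t ht ⟨q, hq⟩
    have := key t ht q hq
    simp only [punctTile, Set.mem_ofPred_eq, Nat.cast_one] at ht
    omega

/-- `w` lies in the first `k` points of an interval of length `k(k+1)`. -/
theorem string_block (k : ℕ) (hk : 0 < k) (w : ℤ) :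
    ((k : ℤ) + 1 ∣ w / k) ↔ (w % (k + 1) < k ∧ (k : ℤ) ∣ w / (k + 1)) := by
  have hk' : (0 : ℤ) < k := by exact_mod_cast hk
  have hk1 : (0 : ℤ) < k + 1 := by omega
  constructor
  · rintro ⟨n, hn⟩
    have hz := Int.mul_ediv_add_emod w k
    have hr0 := Int.emod_nonneg w hk'.ne'
    have hr1 := Int.emod_lt_of_pos w hk'
    generalize w % (k : ℤ) = r at *
    rw [hn] at hz
    have hw : w = r + (k + 1) * (k * n) := by linarith
    have h1 : w / ((k : ℤ) + 1) = k * n := by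
      rw [hw, Int.add_mul_ediv_left _ _ hk1.ne', Int.ediv_eq_zero_of_lt hr0 (by omega), zero_add]
    have h2 : w % ((k : ℤ) + 1) = r := by
      rw [hw, Int.add_mul_emod_self_left, Int.emod_eq_of_lt hr0 (by omega)]
    rw [h1, h2]
    exact ⟨hr1, Dvd.intro _ rfl⟩
  · rintro ⟨hr1, n, hn⟩
    have hz := Int.mul_ediv_add_emod w (k + 1)
    have hr0 := Int.emod_nonneg w hk1.ne'
    generalize w % ((k : ℤ) + 1) = r at *
    rw [hn] at hz
    have hw : w = r + k * ((k + 1) * n) := by linarith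
    have h1 : w / (k : ℤ) = (k + 1) * n := by
      rw [hw, Int.add_mul_ediv_left _ _ hk'.ne', Int.ediv_eq_zero_of_lt hr0 hr1, zero_add]
    rw [h1]
    exact Dvd.intro _ rfl

/-- The set of block indices covered by the pairs starting in `P`. -/
def Pr (P : ℤ → Prop) (j : ℤ) : Prop := P j ∨ P (j - 1)

theorem pred_mod (M j : ℤ) (hM : 0 < M) :
    (j % M = 0 ∧ (j - 1) % M = M - 1) ∨ (0 < j % M ∧ (j - 1) % M = j % M - 1) := by
  have hz := Int.mul_ediv_add_emod j M
  have hr0 := Int.emod_nonneg j hM.ne'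
  have hr1 := Int.emod_lt_of_pos j hM
  generalize j % M = r at *
  generalize j / M = Q at *
  rcases hr0.eq_or_lt with h | h
  · left
    refine ⟨h.symm, ?_⟩
    have : j - 1 = (M - 1) + M * (Q - 1) := by rw [← hz, ← h]; ring
    rw [this, Int.add_mul_emod_self_left, Int.emod_eq_of_lt (by omega) (by omega)]
  · right
    refine ⟨h, ?_⟩
    have : j - 1 = (r - 1) + M * Q := by rw [← hz]; ring
    rw [this, Int.add_mul_emod_self_left, Int.emod_eq_of_lt (by omega) (by omega)]

/-- The choice of the pairs of blocks. -/
theorem exists_pairs (k : ℕ) (hk : 0 < k) : ∃ P R : ℤ → Prop,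
    (∀ j, P j → ¬ P (j - 1)) ∧ (∀ j, R j → ¬ R (j - 1)) ∧
    ∀ j, (k : ℤ) ∣ j ↔ ¬ (Pr P j ↔ Pr R j) := by
  have hk' : (0 : ℤ) < k := by exact_mod_cast hk
  unfold Pr
  rcases Nat.even_or_odd' k with ⟨m, hm | hm⟩
  · refine ⟨fun j => j % (2 * k) < k ∧ j % (2 * k) % 2 = 0,
      fun j => j % (2 * k) ≤ k ∧ j % (2 * k) % 2 = 1, ?_, ?_, ?_⟩
    · intro j
      beta_reduce
      have := pred_mod (2 * k) j (by omega)
      have hr1 := Int.emod_lt_of_pos j (by omega : (0 : ℤ) < 2 * k)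
      generalize j % (2 * (k : ℤ)) = r at *
      generalize (j - 1) % (2 * (k : ℤ)) = r' at *
      omega
    · intro j
      beta_reduce
      have := pred_mod (2 * k) j (by omega)
      have hr1 := Int.emod_lt_of_pos j (by omega : (0 : ℤ) < 2 * k)
      generalize j % (2 * (k : ℤ)) = r at *
      generalize (j - 1) % (2 * (k : ℤ)) = r' at *
      omega
    · intro j
      beta_reduce
      have := pred_mod (2 * k) j (by omega)
      have hr0 := Int.emod_nonneg j (by omega : (2 * k : ℤ) ≠ 0)
      have hr1 := Int.emod_lt_of_pos j (by omega : (0 : ℤ) < 2 * k)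
      have hz := Int.mul_ediv_add_emod j (2 * k)
      have hdv : ((k : ℤ) ∣ j) ↔ j % (2 * k) = 0 ∨ j % (2 * k) = k := by
        generalize j % (2 * (k : ℤ)) = r at *
        have h0 : ((k : ℤ) ∣ j) ↔ ((k : ℤ) ∣ r) := by
          rw [← hz, mul_assoc, mul_left_comm, Int.dvd_add_right (Dvd.intro _ rfl)]
        rw [h0]
        constructor
        · rintro ⟨e, he⟩
          obtain ⟨h2, h3⟩ := mul_small hk' he.symm 0 1 (by omega) (by omega)
          interval_cases e <;> omega
        · rintro (h | h) <;> rw [h]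
          exact dvd_zero _
      rw [hdv]
      clear hz hdv
      generalize j % (2 * (k : ℤ)) = r at *
      generalize (j - 1) % (2 * (k : ℤ)) = r' at *
      omega
  · refine ⟨fun j => j % 2 = 0, fun j => j % k % 2 = 1, ?_, ?_, ?_⟩
    · intro j
      beta_reduce
      omega
    · intro j
      beta_reduce
      have := pred_mod k j hk'
      have hr1 := Int.emod_lt_of_pos j hk'
      generalize j % (k : ℤ) = r at *
      generalize (j - 1) % (k : ℤ) = r' at *
      omega
    · intro j
      beta_reduce
      rw [Int.dvd_iff_emod_eq_zero]
      have := pred_mod k j hk'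
      have hr0 := Int.emod_nonneg j hk'.ne'
      have hr1 := Int.emod_lt_of_pos j hk'
      generalize j % (k : ℤ) = r at *
      generalize (j - 1) % (k : ℤ) = r' at *
      omega

/-- The class of a point, from membership in the two block unions. -/
def Cls (a b : Prop) (c : ℤ) : Prop :=
  (c = 0 ∧ ¬ a ∧ ¬ b) ∨ (c = 1 ∧ b ∧ ¬ a) ∨ (c = 2 ∧ a ∧ ¬ b)

/-- The three sets of starting points. -/
def starts (k : ℕ) (P R : ℤ → Prop) : Fin 3 → Set (Fin 3 → ℤ) := fun i => {p |
  (i = 0 ∧ freeClass k (p 2) = 0 ∧ ∃ n : ℤ, (p 1 + k * p 0) / k = 2 * (k + 1) * n + 1) ∨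
  (i = 1 ∧ ((freeClass k (p 2) = 1 ∧ ∃ j, p 1 + k * p 0 = (k + 1) * j ∧ R j) ∨
    (freeClass k (p 2) = 2 ∧ ∃ j, p 1 + k * p 0 = (k + 1) * j ∧ P j))) ∨
  (i = 2 ∧ ∃ q, p 2 = k * q ∧
    Cls ((p 1 + k * p 0) % (k + 1) < k ∧ Pr P ((p 1 + k * p 0) / (k + 1)))
      ((p 1 + k * p 0) % (k + 1) < k ∧ Pr R ((p 1 + k * p 0) / (k + 1))) (q % 3))}

theorem starts_zero (k : ℕ) (P R : ℤ → Prop) (p : Fin 3 → ℤ) (t : ℤ) :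
    (fun j => p j - if j = 0 then t else 0) ∈ starts k P R 0 ↔
      (freeClass k (p 2) = 0 ∧ ∃ n : ℤ, (p 1 + k * p 0 - k * t) / k = 2 * (k + 1) * n + 1) := by
  have : p 1 + (k : ℤ) * (p 0 - t) = p 1 + k * p 0 - k * t := by ring
  simp [starts, this]

theorem starts_one (k : ℕ) (P R : ℤ → Prop) (p : Fin 3 → ℤ) (t : ℤ) :
    (fun j => p j - if j = 1 then t else 0) ∈ starts k P R 1 ↔
      ((freeClass k (p 2) = 1 ∧ ∃ j, p 1 + k * p 0 - t = (k + 1) * j ∧ R j) ∨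
    (freeClass k (p 2) = 2 ∧ ∃ j, p 1 + k * p 0 - t = (k + 1) * j ∧ P j)) := by
  have : p 1 - t + (k : ℤ) * p 0 = p 1 + k * p 0 - t := by ring
  simp [starts, this]

theorem starts_two (k : ℕ) (P R : ℤ → Prop) (p : Fin 3 → ℤ) (t : ℤ) :
    (fun j => p j - if j = 2 then t else 0) ∈ starts k P R 2 ↔
      ∃ q, p 2 - t = k * q ∧
    Cls ((p 1 + k * p 0) % (k + 1) < k ∧ Pr P ((p 1 + k * p 0) / (k + 1)))
      ((p 1 + k * p 0) % (k + 1) < k ∧ Pr R ((p 1 + k * p 0) / (k + 1))) (q % 3) := by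
  simp [starts]

theorem freeClass_cases (k z : ℤ) :
    freeClass k z = 0 ∨ freeClass k z = 1 ∨ freeClass k z = 2 := by
  unfold freeClass
  split_ifs <;> omega

theorem prop_aux {s a b : Prop} : (s ∧ ¬ (a ↔ b)) ↔ ¬ ((s ∧ a) ↔ (s ∧ b)) := by tauto

set_option maxHeartbeats 1000000 in
theorem starts_cover (k : ℕ) (hk : 0 < k) (P R : ℤ → Prop)
    (hP : ∀ j, P j → ¬ P (j - 1)) (hR : ∀ j, R j → ¬ R (j - 1))
    (hPR : ∀ j, (k : ℤ) ∣ j ↔ ¬ (Pr P j ↔ Pr R j)) (p : Fin 3 → ℤ) :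
    ∃ (i : Fin 3) (t : ℤ),
      (t ∈ punctTile k 1 k ∧ (fun j => p j - if j = i then t else 0) ∈ starts k P R i) ∧
      ∀ (i' : Fin 3) (t' : ℤ), t' ∈ punctTile k 1 k →
        (fun j => p j - if j = i' then t' else 0) ∈ starts k P R i' → i' = i ∧ t' = t := by
  have HP := block_cover k P hP (p 1 + k * p 0)
  have HR := block_cover k R hR (p 1 + k * p 0)
  have HS := string_cover k hk (p 1 + k * p 0)
  rw [string_block k hk, hPR] at HS
  have H2 := starts_two k P R p
  have H1 := starts_one k P R p
  have H0 := starts_zero k P R p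
  have HV := vertical_cover k hk (p 2)
  have hf := freeClass_cases k (p 2)
  change (_ ∧ Pr P _ → _) ∧ (¬ (_ ∧ Pr P _) → _) at HP
  change (_ ∧ Pr R _ → _) ∧ (¬ (_ ∧ Pr R _) → _) at HR
  have hc : (((p 1 + (k : ℤ) * p 0) % (k + 1) < k ∧ ¬ (Pr P ((p 1 + k * p 0) / (k + 1)) ↔
      Pr R ((p 1 + k * p 0) / (k + 1))))) ↔
      ¬ (((p 1 + (k : ℤ) * p 0) % (k + 1) < k ∧ Pr P ((p 1 + k * p 0) / (k + 1))) ↔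
      ((p 1 + (k : ℤ) * p 0) % (k + 1) < k ∧ Pr R ((p 1 + k * p 0) / (k + 1)))) := prop_aux
  rw [hc] at HS
  generalize ((p 1 + (k : ℤ) * p 0) % (k + 1) < k ∧ Pr P ((p 1 + k * p 0) / (k + 1))) = a at *
  generalize ((p 1 + (k : ℤ) * p 0) % (k + 1) < k ∧ Pr R ((p 1 + k * p 0) / (k + 1))) = b at *
  clear hc hPR
  generalize freeClass k (p 2) = m at *
  by_cases hcl : ∃ c, (0 ≤ c ∧ c < 3) ∧ c ≠ m ∧ Cls a b c
  · obtain ⟨c, hc3, hcm, hcc⟩ := hcl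
    have hcl' : ∀ q : ℤ, Cls a b (q % 3) ↔ q % 3 = c := by
      intro q
      refine ⟨fun h => ?_, fun h => h ▸ hcc⟩
      unfold Cls at h hcc
      rcases h with h | h | h <;> rcases hcc with h' | h' | h' <;>
        first | exact h.1.trans h'.1.symm | (exfalso; tauto)
    simp only [hcl'] at H2
    obtain ⟨t, ⟨ht, hts⟩, hu⟩ := (HV c hc3).1 hcm
    refine ⟨2, t, ⟨ht, (H2 t).2 hts⟩, ?_⟩
    intro i' t' ht' hs'
    unfold Cls at hcc
    fin_cases i'
    · exfalso
      have hs := (H0 t').1 hs'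
      refine HS.2 ?_ t' ht' hs.2
      rcases hcc with h | h | h
      · exact absurd (h.1.trans hs.1.symm) hcm
      · tauto
      · tauto
    · exfalso
      rcases (H1 t').1 hs' with hs | hs
      · refine HR.2 ?_ t' ht' hs.2
        rcases hcc with h | h | h
        · tauto
        · exact absurd (h.1.trans hs.1.symm) hcm
        · tauto
      · refine HP.2 ?_ t' ht' hs.2
        rcases hcc with h | h | h
        · tauto
        · tauto
        · exact absurd (h.1.trans hs.1.symm) hcm
    · exact ⟨rfl, hu t' ht' ((H2 t').1 hs')⟩
  · have hno : ∀ t, t ∈ punctTile k 1 k →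
        ¬ (fun j => p j - if j = 2 then t else 0) ∈ starts k P R 2 := by
      intro t ht hs
      obtain ⟨q, hq, hq'⟩ := (H2 t).1 hs
      by_cases hqm : q % 3 = m
      · exact (HV (q % 3) (by omega)).2 hqm t ht ⟨q, hq, rfl⟩
      · exact hcl ⟨q % 3, by omega, hqm, hq'⟩
    have c0 : 0 ≠ m → ¬ (¬ a ∧ ¬ b) := fun h h' =>
      hcl ⟨0, by omega, h, Or.inl ⟨rfl, h'⟩⟩
    have c1 : 1 ≠ m → ¬ (b ∧ ¬ a) := fun h h' =>
      hcl ⟨1, by omega, h, Or.inr (Or.inl ⟨rfl, h'⟩)⟩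
    have c2 : 2 ≠ m → ¬ (a ∧ ¬ b) := fun h h' =>
      hcl ⟨2, by omega, h, Or.inr (Or.inr ⟨rfl, h'⟩)⟩
    rcases hf with hm | hm | hm
    · have d1 := c1 (by omega)
      have d2 := c2 (by omega)
      obtain ⟨t, ⟨ht, hts⟩, hu⟩ := HS.1 (by clear HS HP HR H0 H1 H2 HV hno hcl c0 c1 c2 hP hR; tauto)
      refine ⟨0, t, ⟨ht, (H0 t).2 ⟨hm, hts⟩⟩, ?_⟩
      intro i' t' ht' hs'
      fin_cases i'
      · exact ⟨rfl, hu t' ht' ((H0 t').1 hs').2⟩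
      · exfalso
        rcases (H1 t').1 hs' with hs | hs <;> omega
      · exact absurd hs' (hno t' ht')
    · have d0 := c0 (by omega)
      have d2 := c2 (by omega)
      obtain ⟨t, ⟨ht, hts⟩, hu⟩ := HR.1 (by clear HS HP HR H0 H1 H2 HV hno hcl c0 c1 c2 hP hR; tauto)
      refine ⟨1, t, ⟨ht, (H1 t).2 (Or.inl ⟨hm, hts⟩)⟩, ?_⟩
      intro i' t' ht' hs'
      fin_cases i'
      · have hs := (H0 t').1 hs'
        omega
      · rcases (H1 t').1 hs' with hs | hs
        · exact ⟨rfl, hu t' ht' hs.2⟩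
        · omega
      · exact absurd hs' (hno t' ht')
    · have d0 := c0 (by omega)
      have d1 := c1 (by omega)
      obtain ⟨t, ⟨ht, hts⟩, hu⟩ := HP.1 (by clear HS HP HR H0 H1 H2 HV hno hcl c0 c1 c2 hP hR; tauto)
      refine ⟨1, t, ⟨ht, (H1 t).2 (Or.inr ⟨hm, hts⟩)⟩, ?_⟩
      intro i' t' ht' hs'
      fin_cases i'
      · have hs := (H0 t').1 hs'
        omega
      · rcases (H1 t').1 hs' with hs | hs
        · omega
        · exact ⟨rfl, hu t' ht' hs.2⟩
      · exact absurd hs' (hno t' ht')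

/-- Every symmetric punctured interval `k(1)k` tiles `ℤ^3`. -/
theorem symmetric_punctured_interval_tiles_Z3 (k : ℕ) (hk : 0 < k) :
    TilesZd 3 (punctTile k 1 k) := by
  obtain ⟨P, R, hP, hR, hPR⟩ := exists_pairs k hk
  exact tiling_of_starts _ (starts k P R) (starts_cover k hk P R hP hR hPR)
end

section
/- For every integer k ≥ 3, the symmetric punctured interval tile k(1)k does not tile ℤ^2. -/
/-- Abstract tiling data: `H x y` (resp. `V x y`) says that a horizontal (resp. vertical) tile
with hole at `(x, y)` is used. -/
structure Cfg (k : ℤ) (H V : ℤ → ℤ → Prop) : Prop where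
  hk : 3 ≤ k
  hh : ∀ {x y x' y'}, H x y → H x' y' → y ≠ y' ∨ x = x' ∨ x + 2 * k < x' ∨ x' + 2 * k < x
  vv : ∀ {x y x' y'}, V x y → V x' y' → x ≠ x' ∨ y = y' ∨ y + 2 * k < y' ∨ y' + 2 * k < y
  hv : ∀ {x y a b}, H x y → V a b →
    a < x - k ∨ x + k < a ∨ b < y - k ∨ y + k < b ∨ (x = a ∧ y ≠ b) ∨ (x ≠ a ∧ y = b)
  cov : ∀ x y, (∃ s, H s y ∧ s ≠ x ∧ x - k ≤ s ∧ s ≤ x + k) ∨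
    (∃ s, V x s ∧ s ≠ y ∧ y - k ≤ s ∧ s ≤ y + k)

theorem cg {H : ℤ → ℤ → Prop} {x y x' y' : ℤ} (h : H x y) (hx : x = x') (hy : y = y') :
    H x' y' := by subst hx hy; exact h

namespace Cfg

variable {k : ℤ} {H V : ℤ → ℤ → Prop}

theorem tr (T : Cfg k H V) : Cfg k (fun x y => V y x) (fun x y => H y x) where
  hk := T.hk
  hh := fun h1 h2 => T.vv h1 h2
  vv := fun h1 h2 => T.hh h1 h2
  hv := fun {x y a b} h1 h2 => by have := T.hv h2 h1; omega
  cov := fun x y => (T.cov y x).symm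

theorem flipX (T : Cfg k H V) : Cfg k (fun x y => H (-x) y) (fun x y => V (-x) y) where
  hk := T.hk
  hh := fun h1 h2 => by have := T.hh h1 h2; omega
  vv := fun h1 h2 => by have := T.vv h1 h2; omega
  hv := fun h1 h2 => by have := T.hv h1 h2; omega
  cov := fun x y => by
    rcases T.cov (-x) y with ⟨s, h, h1, h2, h3⟩ | ⟨s, h, h1, h2, h3⟩
    · exact Or.inl ⟨-s, cg (H := H) h (by omega) rfl, by omega, by omega, by omega⟩
    · exact Or.inr ⟨s, h, h1, h2, h3⟩

theorem flipY (T : Cfg k H V) : Cfg k (fun x y => H x (-y)) (fun x y => V x (-y)) :=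
  T.tr.flipX.tr

theorem shift (T : Cfg k H V) (p q : ℤ) :
    Cfg k (fun x y => H (x + p) (y + q)) (fun x y => V (x + p) (y + q)) where
  hk := T.hk
  hh := fun h1 h2 => by have := T.hh h1 h2; omega
  vv := fun h1 h2 => by have := T.vv h1 h2; omega
  hv := fun h1 h2 => by have := T.hv h1 h2; omega
  cov := fun x y => by
    rcases T.cov (x + p) (y + q) with ⟨s, h, h1, h2, h3⟩ | ⟨s, h, h1, h2, h3⟩
    · exact Or.inl ⟨s - p, cg (H := H) h (by omega) rfl, by omega, by omega, by omega⟩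
    · exact Or.inr ⟨s - q, cg (H := V) h rfl (by omega), by omega, by omega, by omega⟩

/-- The hole of a horizontal tile is filled by a vertical tile. -/
theorem cH (T : Cfg k H V) {x y : ℤ} (h : H x y) :
    ∃ s, V x s ∧ s ≠ y ∧ y - k ≤ s ∧ s ≤ y + k := by
  have hk := T.hk
  rcases T.cov x y with ⟨s, h', h1, h2, h3⟩ | h'
  · have := T.hh h h'; omega
  · exact h'

theorem cV (T : Cfg k H V) {x y : ℤ} (h : V x y) :
    ∃ s, H s y ∧ s ≠ x ∧ x - k ≤ s ∧ s ≤ x + k := T.tr.cH h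

theorem stepH (T : Cfg k H V) {x y a b : ℤ} (hA : H x y) (hB : V x b) (hC : H a b)
    (h1 : 2 ≤ b - y) (h2 : b - y ≤ k) (h3 : 2 ≤ a - x) (h4 : a - x ≤ k) : V a (b + k) := by
  have hk := T.hk
  obtain ⟨d, hD, d1, d2, d3⟩ := T.cH hC
  by_cases hd : d = b + k
  · subst hd; exact hD
  exfalso
  have e1 := T.hv hA hD
  rcases T.cov (x + 1) (b - 1) with ⟨s, h, s1, s2, s3⟩ | ⟨s, h, s1, s2, s3⟩
  · have e2 := T.hv h hB
    have e3 := T.hv h hD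
    have : s = x ∨ s = x + k + 1 := by omega
    omega
  · have e2 := T.hv hA h
    have e3 := T.hv hC h
    omega

theorem stepV (T : Cfg k H V) {x y a b : ℤ} (hA : V x y) (hB : H a y) (hC : V a b)
    (h1 : 2 ≤ a - x) (h2 : a - x ≤ k) (h3 : 2 ≤ b - y) (h4 : b - y ≤ k) : H (a + k) b :=
  T.tr.stepH hA hB hC h1 h2 h3 h4

theorem stairCol (T : Cfg k H V) {p q x : ℤ} (h0 : H p q) (h1 : V p (q + k))
    (h2 : H (p + k) (q + k)) (h3 : V (p + k) (q + 2 * k)) (hx : p + 1 ≤ x) (hx' : x ≤ p + k - 1) :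
    V x (q + 2 * k + 1) := by
  have hk := T.hk
  rcases T.cov x (q + k + 1) with ⟨s, h, s1, s2, s3⟩ | ⟨s, h, s1, s2, s3⟩
  · have e1 := T.hv h h1
    have e2 := T.hv h h3
    omega
  · have e1 := T.hv h2 h
    have e2 := T.hv h0 h
    exact cg h rfl (by omega)

theorem L1pos (T : Cfg k H V) {x y a b : ℤ} (hA : H x y) (hB : V x b) (hC : H a b)
    (h1 : 2 ≤ b - y) (h2 : b - y ≤ k) (h3 : 2 ≤ a - x) (h4 : a - x ≤ k) : False := by
  have hk := T.hk
  have D0 := T.stepH hA hB hC h1 h2 h3 h4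
  have E0 := T.stepV hB hC D0 h3 h4 (by omega) (by omega)
  have D1 := T.stepH hC D0 E0 (by omega) (by omega) (by omega) (by omega)
  have E1 := T.stepV D0 E0 D1 (by omega) (by omega) (by omega) (by omega)
  have D2 := T.stepH E0 D1 E1 (by omega) (by omega) (by omega) (by omega)
  have E2 := T.stepV D1 E1 D2 (by omega) (by omega) (by omega) (by omega)
  have D3 := T.stepH E1 D2 E2 (by omega) (by omega) (by omega) (by omega)
  have c0 := T.stairCol (x := a + 1) hC D0 E0 (cg D1 rfl (by omega)) (by omega) (by omega)
  have c1 := T.stairCol (x := a + 2 * k - 1) E0 D1 E1 (cg D2 rfl (by omega))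
    (by omega) (by omega)
  have c2 := T.stairCol (x := a + 2 * k + 1) E1 D2 E2 (cg D3 rfl (by omega))
    (by omega) (by omega)
  obtain ⟨r, hr, r1, r2, r3⟩ := T.cV c1
  have e1 := T.hv hr D2
  have e2 := T.hv hr c2
  have e3 := T.hv hr c0
  have : r = a + k - 1 := by omega
  omega

/-- Two consecutive offsets cannot both be at least two. -/
theorem L1 (T : Cfg k H V) {x y a b : ℤ} (hA : H x y) (hB : V x b) (hC : H a b)
    (h1 : 2 ≤ b - y ∨ 2 ≤ y - b) (h2 : b - y ≤ k) (h2' : y - b ≤ k)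
    (h3 : 2 ≤ a - x ∨ 2 ≤ x - a) (h4 : a - x ≤ k) (h4' : x - a ≤ k) : False := by
  have key : ∀ {H V : ℤ → ℤ → Prop}, Cfg k H V → ∀ {x y a b : ℤ}, H x y → V x b → H a b →
      (2 ≤ b - y) → (b - y ≤ k) → (2 ≤ a - x ∨ 2 ≤ x - a) → a - x ≤ k → x - a ≤ k → False := by
    intro H V T x y a b hA hB hC h1 h2 h3 h4 h4'
    rcases h3 with h3 | h3
    · exact T.L1pos hA hB hC h1 h2 h3 h4
    · exact T.flipX.L1pos (x := -x) (y := y) (a := -a) (b := b) (cg (H := H) hA (by omega) rfl)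
        (cg (H := V) hB (by omega) rfl) (cg (H := H) hC (by omega) rfl) h1 h2 (by omega) (by omega)
  rcases h1 with h1 | h1
  · exact key T hA hB hC h1 h2 h3 h4 h4'
  · exact key T.flipY (x := x) (y := -y) (a := a) (b := -b) (cg (H := H) hA rfl (by omega))
        (cg (H := V) hB rfl (by omega)) (cg (H := H) hC rfl (by omega)) (by omega) (by omega)
        h3 h4 h4'

theorem L1' (T : Cfg k H V) {x y a b : ℤ} (hA : V x y) (hB : H a y) (hC : V a b)
    (h1 : 2 ≤ a - x ∨ 2 ≤ x - a) (h2 : a - x ≤ k) (h2' : x - a ≤ k)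
    (h3 : 2 ≤ b - y ∨ 2 ≤ y - b) (h4 : b - y ≤ k) (h4' : y - b ≤ k) : False :=
  T.tr.L1 hA hB hC h1 h2 h2' h3 h4 h4'

theorem L2a (T : Cfg k H V) {x y a b : ℤ} (hA : H x y) (hB : V x b) (hC : H a b)
    (h1 : b - y = 1 ∨ y - b = 1) (h3 : 2 ≤ a - x ∨ 2 ≤ x - a) (h4 : a - x ≤ k)
    (h4' : x - a ≤ k) : V a y := by
  have hk := T.hk
  obtain ⟨d, hD, d1, d2, d3⟩ := T.cH hC
  have e := T.hv hA hD
  by_cases hd : d = y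
  · subst hd; exact hD
  · exact (T.L1' hB hC hD h3 h4 h4' (by omega) (by omega) (by omega)).elim

theorem L2a' (T : Cfg k H V) {x y a b : ℤ} (hA : V x y) (hB : H a y) (hC : V a b)
    (h1 : a - x = 1 ∨ x - a = 1) (h3 : 2 ≤ b - y ∨ 2 ≤ y - b) (h4 : b - y ≤ k)
    (h4' : y - b ≤ k) : H x b := T.tr.L2a hA hB hC h1 h3 h4 h4'

/-- After an offset of at least two comes an offset of one. -/
theorem N1 (T : Cfg k H V) {x y b : ℤ} (hA : H x y) (hB : V x b)
    (h1 : 2 ≤ b - y ∨ 2 ≤ y - b) (h2 : b - y ≤ k) (h2' : y - b ≤ k) :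
    ∃ a, H a b ∧ (a = x + 1 ∨ a = x - 1) := by
  obtain ⟨a, hC, a1, a2, a3⟩ := T.cV hB
  refine ⟨a, hC, ?_⟩
  by_contra hn
  exact T.L1 hA hB hC h1 h2 h2' (by omega) (by omega) (by omega)

theorem N1' (T : Cfg k H V) {x y a : ℤ} (hA : V x y) (hB : H a y)
    (h1 : 2 ≤ a - x ∨ 2 ≤ x - a) (h2 : a - x ≤ k) (h2' : x - a ≤ k) :
    ∃ b, V a b ∧ (b = y + 1 ∨ b = y - 1) := T.tr.N1 hA hB h1 h2 h2'

theorem cW (T : Cfg k H V) {c x : ℤ} (hc' : c ≤ k) (hA : H 0 0) (hB : V 0 1)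
    (hC : H c 1) (hD : V c 0) (hx : 1 ≤ x) (hx' : x ≤ c - 1) : V x (k + 2) := by
  have hk := T.hk
  rcases T.cov x 2 with ⟨s, h, s1, s2, s3⟩ | ⟨s, h, s1, s2, s3⟩
  · have e1 := T.hv h hB
    have e2 := T.hv h hD
    omega
  · have e1 := T.hv hC h
    have e2 := T.hv hA h
    exact cg h rfl (by omega)

theorem cTop (T : Cfg k H V) {c : ℤ} (hc : 2 ≤ c) (hc' : c ≤ k) (hA : H 0 0) (hB : V 0 1)
    (hC : H c 1) (hD : V c 0) : H (c + k) (k + 1) ∨ V c (2 * k + 1) := by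
  have hk := T.hk
  have hW := T.cW (x := c - 1) hc' hA hB hC hD (by omega) (by omega)
  rcases T.cov c (k + 1) with ⟨s, h, s1, s2, s3⟩ | ⟨s, h, s1, s2, s3⟩
  · left
    have e1 := T.hv h hW
    by_cases hs : s = c - 1
    · exfalso
      by_cases h3 : 3 ≤ c
      · have hW' := T.cW (x := c - 2) hc' hA hB hC hD (by omega) (by omega)
        have e2 := T.hv h hW'
        omega
      · have e2 := T.hv h hB
        omega
    · exact cg h (by omega) rfl
  · right
    have e1 := T.vv h hD
    exact cg h rfl (by omega)

theorem cR (T : Cfg k H V) {c : ℤ} (hc : 3 ≤ c) (hc' : c ≤ k) (hA : H 0 0) (hB : V 0 1)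
    (hC : H c 1) (hD : V c 0) : ∃ r, H r (k + 2) ∧ r ≤ -1 ∧ c - 1 - k ≤ r := by
  have hk := T.hk
  have W : ∀ x, 1 ≤ x → x ≤ c - 1 → V x (k + 2) := fun x h1 h2 => T.cW hc' hA hB hC hD h1 h2
  have W1 := W (c - 1) (by omega) (by omega)
  have W2 := W (c - 2) (by omega) (by omega)
  obtain ⟨r, hr, r1, r2, r3⟩ := T.cV W1
  refine ⟨r, hr, ?_, by omega⟩
  by_contra hn
  have hr0 : r = 0 ∨ c ≤ r := by
    by_contra h'
    have := T.hv hr (W r (by omega) (by omega))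
    omega
  obtain ⟨s, hQ, s1, s2, s3⟩ := T.cH hr
  rcases hr0 with h0 | h0
  · subst h0
    have e1 := T.vv hQ hB
    have := T.L2a' (W 1 (by omega) (by omega)) hr hQ (by omega) (by omega) (by omega) (by omega)
    have e2 := T.hv this (W 2 (by omega) (by omega))
    omega
  · rcases T.cTop (by omega) hc' hA hB hC hD with hE | hM
    · have e1 := T.hv hE hQ
      have e2 := T.hv hC hQ
      have e3 := T.vv hQ hD
      have hs : s = 2 * k + 2 := by
        by_cases hrc : r = c
        · omega
        · omega
      by_cases hrc : r = c
      · have := T.L2a' W1 hr hQ (by omega) (by omega) (by omega) (by omega)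
        have e4 := T.hv this W2
        omega
      · exact T.L1' W1 hr hQ (by omega) (by omega) (by omega) (by omega) (by omega) (by omega)
    · have e1 := T.hv hr hM
      have hrc : r = c := by omega
      subst hrc
      have := T.L2a' W1 hr hM (by omega) (by omega) (by omega) (by omega)
      have e4 := T.hv this W2
      omega

theorem cS (T : Cfg k H V) {c : ℤ} (hc : 3 ≤ c) (hc' : c ≤ k) (hA : H 0 0) (hB : V 0 1)
    (hC : H c 1) (hD : V c 0) : ∃ r e a, H r (k + 2) ∧ r ≤ -1 ∧ c - 1 - k ≤ r ∧
      (e = k + 3 ∨ e = k + 1) ∧ V r e ∧ H a e ∧ V a (k + 2) ∧ r - k ≤ a ∧ a ≤ -k := by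
  have hk := T.hk
  have W : ∀ x, 1 ≤ x → x ≤ c - 1 → V x (k + 2) := fun x h1 h2 => T.cW hc' hA hB hC hD h1 h2
  have W1 := W 1 (by omega) (by omega)
  have W2 := W 2 (by omega) (by omega)
  obtain ⟨r, hr, r1, r2⟩ := T.cR hc hc' hA hB hC hD
  obtain ⟨e, hQ, he⟩ := T.N1' W1 hr (by omega) (by omega) (by omega)
  obtain ⟨a, hS, a1, a2, a3⟩ := T.cV hQ
  have e1 := T.hv hS W1
  have e2 := T.hv hS W2
  have ha : a ≤ -k := by omega
  have hP := T.L2a hr hQ hS (by omega) (by omega) (by omega) (by omega)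
  exact ⟨r, e, a, hr, r1, r2, by omega, hQ, hS, hP, by omega, ha⟩

/-- A cycle of length `k` forces another one, diagonally displaced. -/
theorem K1 (T : Cfg k H V) (hA : H 0 0) (hB : V 0 1) (hC : H k 1) (hD : V k 0) :
    H (-k - 1) (k + 1) ∧ V (-k - 1) (k + 2) ∧ H (-1) (k + 2) ∧ V (-1) (k + 1) := by
  have hk := T.hk
  obtain ⟨r, e, a, hr, r1, r2, he, hQ, hS, hP, a1, a2⟩ := T.cS hk le_rfl hA hB hC hD
  have hr1 : r = -1 := by omega
  subst hr1
  rcases he with he | he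
  · exfalso
    subst he
    rcases T.cov (-1) 2 with ⟨s, h, s1, s2, s3⟩ | ⟨s, h, s1, s2, s3⟩
    · have e1 := T.hv h hB
      have e2 := T.hv h hD
      have hs : s = -1 - k := by omega
      have e3 := T.hv h hP
      have ha : a = -1 - k := by omega
      subst hs ha
      exact T.L1 h hP hr (by omega) (by omega) (by omega) (by omega) (by omega) (by omega)
    · have e1 := T.vv h hQ
      have e2 := T.hv hA h
      omega
  · subst he
    have e1 := T.hv hS hB
    have ha : a = -k - 1 := by omega
    subst ha
    exact ⟨hS, hP, hr, hQ⟩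

theorem K1at (T : Cfg k H V) {p q : ℤ} (hA : H p q) (hB : V p (q + 1)) (hC : H (p + k) (q + 1))
    (hD : V (p + k) q) : H (p - k - 1) (q + k + 1) ∧ V (p - k - 1) (q + k + 2) ∧
      H (p - 1) (q + k + 2) ∧ V (p - 1) (q + k + 1) := by
  obtain ⟨h1, h2, h3, h4⟩ := (T.shift p q).K1 (cg (H := H) hA (by omega) (by omega))
    (cg (H := V) hB (by omega) (by omega)) (cg (H := H) hC (by omega) (by omega))
    (cg (H := V) hD (by omega) (by omega))
  exact ⟨cg (H := H) h1 (by omega) (by omega), cg (H := V) h2 (by omega) (by omega),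
    cg (H := H) h3 (by omega) (by omega), cg (H := V) h4 (by omega) (by omega)⟩

theorem noCycK (T : Cfg k H V) (hA : H 0 0) (hB : V 0 1) (hC : H k 1) (hD : V k 0) : False := by
  have hk := T.hk
  have W : ∀ x, 1 ≤ x → x ≤ k - 1 → V x (k + 2) := fun x h1 h2 => T.cW le_rfl hA hB hC hD h1 h2
  -- the displaced cycle on the other side, by rotation through 180 degrees
  obtain ⟨g1, g2, g3, g4⟩ := T.flipX.flipY.K1at (p := -k) (q := -1)
    (cg (H := H) hC (by omega) (by omega)) (cg (H := V) hD (by omega) (by omega))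
    (cg (H := H) hA (by omega) (by omega)) (cg (H := V) hB (by omega) (by omega))
  have hD2 : V (2 * k + 1) (-k - 1) := cg (H := V) g2 (by omega) (by omega)
  have hB2 : V (k + 1) (-k) := cg (H := V) g4 (by omega) (by omega)
  have rowH : ∀ s y, H s y → 2 ≤ y → y ≤ k → k + 1 - k ≤ s → s ≤ k + 1 + k → s = 2 * k + 1 := by
    intro s y h y1 y2 s1 s2
    have e1 := T.hv h hD
    have e2 := T.hv h hB
    omega
  rcases T.cTop (by omega) le_rfl hA hB hC hD with hE | hM
  · have rows : ∀ y, 2 ≤ y → y ≤ k → H (2 * k + 1) y := by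
      intro y y1 y2
      rcases T.cov (k + 1) y with ⟨s, h, s1, s2, s3⟩ | ⟨s, h, s1, s2, s3⟩
      · exact cg h (rowH s y h y1 y2 s2 s3) rfl
      · have e1 := T.hv hC h
        have e2 := T.hv hE h
        omega
    obtain ⟨t, hT, t1, t2, t3⟩ := T.cH (rows 2 (by omega) (by omega))
    have e1 := T.vv hT hD2
    have e2 := T.hv (rows k (by omega) (by omega)) hT
    have e3 := T.hv hE hT
    have ht : t = k + 1 := by omega
    subst ht
    obtain ⟨u, hU, u1, u2, u3⟩ := T.cH hE
    have e4 := T.hv (rows k (by omega) (by omega)) hU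
    have e5 := T.hv (rows (k - 1) (by omega) (by omega)) hU
    have hu : u = 2 * k + 1 := by omega
    subst hu
    have hX := T.L2a' hT hE hU (by omega) (by omega) (by omega) (by omega)
    obtain ⟨f1, f2, f3, f4⟩ := T.tr.flipY.K1at (p := k + 1) (q := -(2 * k + 1))
      (cg (H := V) hT (by omega) (by omega)) (cg (H := H) hE (by omega) (by omega))
      (cg (H := V) hU (by omega) (by omega)) (cg (H := H) hX (by omega) (by omega))
    have e6 := T.hh hA (cg (H := H) f2 rfl rfl)
    omega
  · obtain ⟨g, hG, g1, g2, g3⟩ := T.cV hM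
    have W1 := W (k - 1) (by omega) (by omega)
    have W2 := W (k - 2) (by omega) (by omega)
    have e1 := T.hv hG W1
    have e2 := T.hv hG W2
    have hg : g = 2 * k := by omega
    subst hg
    have rows : ∀ y, 2 ≤ y → y ≤ k → H (2 * k + 1) y := by
      intro y y1 y2
      rcases T.cov (k + 1) y with ⟨s, h, s1, s2, s3⟩ | ⟨s, h, s1, s2, s3⟩
      · exact cg h (rowH s y h y1 y2 s2 s3) rfl
      · have e1 := T.hv hC h
        have e2 := T.hv hG h
        have e3 := T.vv h hB2
        omega
    obtain ⟨t, hT, t1, t2, t3⟩ := T.cH (rows 2 (by omega) (by omega))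
    have e1 := T.vv hT hD2
    have e2 := T.hv (rows k (by omega) (by omega)) hT
    have e3 := T.hv hG hT
    omega

/-- An offset of one always closes up to a cycle (positive case). -/
theorem L2pos (T : Cfg k H V) {x y : ℤ} (hA : H x y) (hB : V x (y + 1)) (hC : H (x + 1) (y + 1)) :
    V (x + 1) y := by
  have hk := T.hk
  obtain ⟨d, hD, d1, d2, d3⟩ := T.cH hC
  have e := T.hv hA hD
  by_cases hd : d = y
  · subst hd; exact hD
  have hd' : d = y + 1 + k := by omega
  subst hd'
  have hE := T.L2a' hB hC hD (by omega) (by omega) (by omega) (by omega)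
  exact ((T.tr.shift (y + 1) x).noCycK (cg (H := V) hB (by omega) (by omega))
    (cg (H := H) hC (by omega) (by omega)) (cg (H := V) hD (by omega) (by omega))
    (cg (H := H) hE (by omega) (by omega))).elim

theorem L2 (T : Cfg k H V) {x y a b : ℤ} (hA : H x y) (hB : V x b) (hC : H a b)
    (h1 : b - y = 1 ∨ y - b = 1) (h3 : a ≠ x) (h4 : a - x ≤ k) (h4' : x - a ≤ k) : V a y := by
  by_cases h : 2 ≤ a - x ∨ 2 ≤ x - a
  · exact T.L2a hA hB hC h1 h h4 h4'
  have key : ∀ {H V : ℤ → ℤ → Prop}, Cfg k H V → ∀ {x y a b : ℤ}, H x y → V x b → H a b →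
      b - y = 1 → (a = x + 1 ∨ a = x - 1) → V a y := by
    intro H V T x y a b hA hB hC h1 h3
    rcases h3 with h3 | h3
    · exact cg (T.L2pos hA (cg hB rfl (by omega)) (cg hC (by omega) (by omega))) (by omega) rfl
    · have := T.flipX.L2pos (x := -x) (y := y) (cg (H := H) hA (by omega) rfl)
        (cg (H := V) hB (by omega) (by omega)) (cg (H := H) hC (by omega) (by omega))
      exact cg (H := V) this (by omega) rfl
  rcases h1 with h1 | h1
  · exact key T hA hB hC h1 (by omega)
  · have := key T.flipY (x := x) (y := -y) (a := a) (b := -b) (cg (H := H) hA rfl (by omega))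
        (cg (H := V) hB rfl (by omega)) (cg (H := H) hC rfl (by omega)) (by omega) (by omega)
    exact cg (H := V) this rfl (by omega)

theorem L2' (T : Cfg k H V) {x y a b : ℤ} (hA : V x y) (hB : H a y) (hC : V a b)
    (h1 : a - x = 1 ∨ x - a = 1) (h3 : b ≠ y) (h4 : b - y ≤ k) (h4' : y - b ≤ k) : H x b :=
  T.tr.L2 hA hB hC h1 h3 h4 h4'


theorem noCyc3 (T : Cfg k H V) {c : ℤ} (hc : 3 ≤ c) (hc' : c ≤ k) (hA : H 0 0) (hB : V 0 1)
    (hC : H c 1) (hD : V c 0) : False := by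
  have hk := T.hk
  by_cases hck : c = k
  · subst hck; exact T.noCycK hA hB hC hD
  obtain ⟨r, e, a, hr, r1, r2, he, hQ, hS, hP, a1, a2⟩ := T.cS hc hc' hA hB hC hD
  have fin : ∀ m, H m 2 → m ≤ -1 - k → -1 - 2 * k + 1 ≤ m → c - k - k ≤ m → False := by
    intro m hm m1 m2 m3
    have e3 := T.hv hm hP
    have : a = m := by omega
    subst this
    exact T.L1 hm hP hr (by omega) (by omega) (by omega) (by omega) (by omega) (by omega)
  by_cases hrc : r = c - 1 - k
  · rcases T.cov (c - k) 2 with ⟨m, h, s1, s2, s3⟩ | ⟨s, h, s1, s2, s3⟩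
    · have e1 := T.hv h hB
      have e2 := T.hv h hD
      exact fin m h (by omega) (by omega) (by omega)
    · have e1 := T.hv hC h
      have e2 := T.hv hA h
      have hs : s = k + 2 := by omega
      subst hs
      have h5 := T.L2' h hr hQ (by omega) (by omega) (by omega) (by omega)
      have := T.hh h5 hS
      omega
  · have e0 := T.hv hC hQ
    rcases T.cov r 2 with ⟨m, h, s1, s2, s3⟩ | ⟨s, h, s1, s2, s3⟩
    · have e1 := T.hv h hB
      have e2 := T.hv h hD
      exact fin m h (by omega) (by omega) (by omega)
    · have e1 := T.hv hC h
      have e2 := T.vv hQ h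
      omega

/-- Transfer of a statement about a cycle in normal position to general position. -/
theorem cycNorm {k : ℤ} {P : ℤ → Prop}
    (key : ∀ {H V : ℤ → ℤ → Prop}, Cfg k H V → ∀ c, 1 ≤ c → c ≤ k → H 0 0 → V 0 1 → H c 1 →
      V c 0 → P c) {H V : ℤ → ℤ → Prop} (T : Cfg k H V) {x y a b : ℤ} (hA : H x y) (hB : V x b)
    (hC : H a b) (hD : V a y) (h1 : b - y = 1 ∨ y - b = 1) (h3 : a ≠ x) (h4 : a - x ≤ k)
    (h4' : x - a ≤ k) : P |a - x| := by
  have k1 : ∀ {H V : ℤ → ℤ → Prop}, Cfg k H V → ∀ {x y a b : ℤ}, H x y → V x b → H a b → V a y →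
      b - y = 1 → 1 ≤ a - x → a - x ≤ k → P (a - x) := by
    intro H V T x y a b hA hB hC hD h1 h2 h3
    exact key (T.shift x y) (a - x) h2 h3 (cg (H := H) hA (by omega) (by omega))
      (cg (H := V) hB (by omega) (by omega)) (cg (H := H) hC (by omega) (by omega))
      (cg (H := V) hD (by omega) (by omega))
  have k2 : ∀ {H V : ℤ → ℤ → Prop}, Cfg k H V → ∀ {x y a b : ℤ}, H x y → V x b → H a b → V a y →
      b - y = 1 → a ≠ x → a - x ≤ k → x - a ≤ k → P |a - x| := by
    intro H V T x y a b hA hB hC hD h1 h2 h3 h4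
    rcases lt_or_gt_of_ne h2 with h | h
    · have := k1 T.flipX (x := -x) (a := -a) (y := y) (b := b) (cg (H := H) hA (by omega) rfl)
        (cg (H := V) hB (by omega) rfl) (cg (H := H) hC (by omega) rfl)
        (cg (H := V) hD (by omega) rfl) h1 (by omega) (by omega)
      rw [abs_of_neg (by omega)]
      exact (show -(a - x) = -a - -x by ring) ▸ this
    · rw [abs_of_pos (by omega)]
      exact k1 T hA hB hC hD h1 (by omega) h3
  rcases h1 with h1 | h1
  · exact k2 T hA hB hC hD h1 h3 h4 h4'
  · exact k2 T.flipY (y := -y) (b := -b) (cg (H := H) hA rfl (by omega))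
        (cg (H := V) hB rfl (by omega)) (cg (H := H) hC rfl (by omega))
        (cg (H := V) hD rfl (by omega)) (by omega) h3 h4 h4'

theorem L3 (T : Cfg k H V) {x y a b : ℤ} (hA : H x y) (hB : V x b) (hC : H a b)
    (h1 : b - y = 1 ∨ y - b = 1) (h3 : a ≠ x) (h4 : a - x ≤ k) (h4' : x - a ≤ k) :
    V a y ∧ a - x ≤ 2 ∧ x - a ≤ 2 := by
  have hD := T.L2 hA hB hC h1 h3 h4 h4'
  have := cycNorm (P := fun c => c ≤ 2) (fun T c h1 h2 hA hB hC hD => by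
    by_contra h; exact T.noCyc3 (by omega) h2 hA hB hC hD) T hA hB hC hD h1 h3 h4 h4'
  have h5 := le_abs_self (a - x)
  have h6 := neg_abs_le (a - x)
  exact ⟨hD, by omega, by omega⟩

theorem L3' (T : Cfg k H V) {x y a b : ℤ} (hA : V x y) (hB : H a y) (hC : V a b)
    (h1 : a - x = 1 ∨ x - a = 1) (h3 : b ≠ y) (h4 : b - y ≤ k) (h4' : y - b ≤ k) :
    H x b ∧ b - y ≤ 2 ∧ y - b ≤ 2 :=
  T.tr.L3 hA hB hC h1 h3 h4 h4'

theorem cyc2I (T : Cfg k H V) (hA : H 0 0) (hB : V 0 1) (hC : H 2 1) (hD : V 2 0)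
    (hE : H (k + 2) (k + 1)) : False := by
  have hk := T.hk
  have rows : ∀ y, 2 ≤ y → y ≤ k → H (k + 3) y := by
    intro y y1 y2
    rcases T.cov 3 y with ⟨s, h, s1, s2, s3⟩ | ⟨s, h, s1, s2, s3⟩
    · have e1 := T.hv h hB
      have e2 := T.hv h hD
      exact cg h (by omega) rfl
    · have e1 := T.hv hC h
      have e2 := T.hv hE h
      omega
  have R1 := rows k (by omega) le_rfl
  have R2 := rows (k - 1) (by omega) (by omega)
  have R3 := rows 2 (by omega) (by omega)
  obtain ⟨t, hT, t1, t2, t3⟩ := T.cH R1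
  have e1 := T.hv hE hT
  have e2 := T.hv R2 hT
  have e3 := T.hv R3 hT
  have ht : t = k + 1 ∨ t = 0 := by
    by_contra hcon
    have R4 := rows t (by omega) (by omega)
    have := T.hv R4 hT
    omega
  rcases ht with rfl | rfl
  · obtain ⟨u, hU, u1, u2, u3⟩ := T.cH hE
    have e4 := T.hv R1 hU
    have e5 := T.hv R2 hU
    have := T.L3' hT hE hU (by omega) (by omega) (by omega) (by omega)
    omega
  · obtain ⟨a, ha, a1⟩ := T.N1 R1 hT (by omega) (by omega) (by omega)
    have e4 := T.hh hA ha
    have hk3 : k = 3 := by omega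
    subst hk3
    have ha7 : a = 7 := by omega
    subst ha7
    obtain ⟨s, hs, s1, s2, s3⟩ := T.cH ha
    obtain ⟨h6, b1, b2⟩ := T.L3' hT ha hs (by omega) (by omega) (by omega) (by omega)
    have e5 := T.hh h6 hC
    have e6 := T.hv R1 hs
    have e7 := T.hv R3 hs
    have hs2 : s = -2 := by omega
    subst hs2
    rcases T.cov 3 (-1) with ⟨s, h, s1, s2, s3⟩ | ⟨s, h, s1, s2, s3⟩
    · have e1 := T.hv h hB
      have e2 := T.hv h hD
      have e2 := T.hv h hs
      omega
    · have e1 := T.hv hC h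
      have e2 := T.hv hA h
      have e2 := T.hv h6 h
      omega

theorem cyc2II (T : Cfg k H V) (hA : H 0 0) (hB : V 0 1) (hC : H 2 1) (hD : V 2 0) :
    k = 3 ∧ V 1 5 ∧ H 2 5 ∧ V 2 7 ∧ H 1 7 := by
  have hk := T.hk
  have hW := T.cW (x := 1) (by omega) hA hB hC hD (by omega) (by omega)
  rcases T.cTop (by omega) (by omega) hA hB hC hD with hE | hM
  · exact (T.cyc2I hA hB hC hD (cg hE (by omega) rfl)).elim
  obtain ⟨r, hr, r1, r2, r3⟩ := T.cV hW
  have e1 := T.hv hr hM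
  have hr' : r = 2 ∨ r = 1 - k := by omega
  rcases hr' with rfl | hr'
  · obtain ⟨h1, h2, h3⟩ := T.L3' hW hr hM (by omega) (by omega) (by omega) (by omega)
    have hk3 : k = 3 := by omega
    subst hk3
    exact ⟨rfl, hW, hr, hM, h1⟩
  · exfalso
    obtain ⟨e, hQ, he⟩ := T.N1' hW hr (by omega) (by omega) (by omega)
    obtain ⟨a, hS, a1, a2, a3⟩ := T.cV hQ
    obtain ⟨hP, b1, b2⟩ := T.L3 hr hQ hS (by omega) (by omega) (by omega) (by omega)
    have e2 := T.hv hS hW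
    rcases T.cov (2 - k) 2 with ⟨m, h, s1, s2, s3⟩ | ⟨s, h, s1, s2, s3⟩
    · have e1 := T.hv h hB
      have e2 := T.hv h hD
      have e3 := T.hv h hP
      have : a = m := by omega
      subst this
      exact T.L1 h hP hr (by omega) (by omega) (by omega) (by omega) (by omega) (by omega)
    · have e1 := T.hv hC h
      have e2 := T.hv hA h
      have hs : s = k + 2 := by omega
      subst hs
      have h5 := T.L2' h hr hQ (by omega) (by omega) (by omega) (by omega)
      have := T.hh h5 hS
      omega

theorem noCyc2 (T : Cfg k H V) (hA : H 0 0) (hB : V 0 1) (hC : H 2 1) (hD : V 2 0) : False := by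
  obtain ⟨rfl, hW, hR, hM, hN⟩ := T.cyc2II hA hB hC hD
  obtain ⟨-, h1, h2, h3, h4⟩ := (T.tr.shift 5 1).cyc2II (cg (H := V) hW (by omega) (by omega))
    (cg (H := H) hR (by omega) (by omega)) (cg (H := V) hM (by omega) (by omega))
    (cg (H := H) hN (by omega) (by omega))
  have g1 : H 6 6 := cg (H := H) h1 (by omega) (by omega)
  have g4 : V 8 6 := cg (H := V) h4 (by omega) (by omega)
  rcases T.cov 3 4 with ⟨m, h, s1, s2, s3⟩ | ⟨s, h, s1, s2, s3⟩
  · have e1 := T.hv h hB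
    have e2 := T.hv h g4
    have e3 := T.hv h hM
    omega
  · have e1 := T.hv hR h
    have e2 := T.hv hA h
    have e3 := T.hv g1 h
    omega

theorem L4 (T : Cfg k H V) {x y a b : ℤ} (hA : H x y) (hB : V x b) (hC : H a b)
    (h1 : b - y = 1 ∨ y - b = 1) (h3 : a ≠ x) (h4 : a - x ≤ k) (h4' : x - a ≤ k) :
    V a y ∧ a - x ≤ 1 ∧ x - a ≤ 1 := by
  have hD := T.L2 hA hB hC h1 h3 h4 h4'
  have := cycNorm (P := fun c => c ≤ 1) (fun T c h1 h2 hA hB hC hD => by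
    by_contra h
    by_cases h2 : c = 2
    · subst h2; exact T.noCyc2 hA hB hC hD
    exact T.noCyc3 (by omega) (by omega) hA hB hC hD) T hA hB hC hD h1 h3 h4 h4'
  have h5 := le_abs_self (a - x)
  have h6 := neg_abs_le (a - x)
  exact ⟨hD, by omega, by omega⟩

theorem L4' (T : Cfg k H V) {x y a b : ℤ} (hA : V x y) (hB : H a y) (hC : V a b)
    (h1 : a - x = 1 ∨ x - a = 1) (h3 : b ≠ y) (h4 : b - y ≤ k) (h4' : y - b ≤ k) :
    H x b ∧ b - y ≤ 1 ∧ y - b ≤ 1 :=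
  T.tr.L4 hA hB hC h1 h3 h4 h4'

theorem F2 (T : Cfg k H V) {x y b : ℤ} (hA : H x y) (hB : V x b) (h1 : b ≠ y) (h2 : b - y ≤ k)
    (h3 : y - b ≤ k) : b = y + 1 ∨ b = y - 1 ∨ b = y + k ∨ b = y - k := by
  have hk := T.hk
  by_cases h : 2 ≤ b - y ∨ 2 ≤ y - b
  · obtain ⟨a, ha, a1⟩ := T.N1 hA hB h h2 h3
    obtain ⟨d, hd, d1, d2, d3⟩ := T.cH ha
    obtain ⟨h6, b1, b2⟩ := T.L4' hB ha hd (by omega) (by omega) (by omega) (by omega)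
    have e1 := T.hv hA hd
    have e2 := T.hh hA h6
    omega
  · omega

theorem F2' (T : Cfg k H V) {x y a : ℤ} (hA : V x y) (hB : H a y) (h1 : a ≠ x) (h2 : a - x ≤ k)
    (h3 : x - a ≤ k) : a = x + 1 ∨ a = x - 1 ∨ a = x + k ∨ a = x - k :=
  T.tr.F2 hA hB h1 h2 h3

theorem X_a (T : Cfg k H V) (hA : H 0 0) (hB : V 0 1) (hC : H 1 1) (hD : V 1 0) :
    ¬ V 2 (k + 2) := by
  intro hX
  have hk := T.hk
  have hM : V 1 (2 * k + 1) := by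
    rcases T.cov 1 (k + 1) with ⟨s, h, s1, s2, s3⟩ | ⟨s, h, s1, s2, s3⟩
    · have e1 := T.hv h hX
      have e2 := T.hv h hB
      omega
    · have e1 := T.vv h hD
      exact cg h rfl (by omega)
  obtain ⟨r, hr, r1, r2, r3⟩ := T.cV hM
  have e1 := T.hv hr hX
  have hr' : r = 2 ∨ r = 1 - k := by omega
  rcases hr' with rfl | rfl
  · have := T.F2 hr hX (by omega) (by omega) (by omega)
    omega
  obtain ⟨e, hQ, he⟩ := T.N1' hM hr (by omega) (by omega) (by omega)
  rcases T.cov 0 (k + 2) with ⟨s, h, s1, s2, s3⟩ | ⟨s, h, s1, s2, s3⟩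
  · have e1 := T.hv h hM
    have e2 := T.hv h hQ
    have : s = 1 := by omega
    subst this
    have := T.F2 h hM (by omega) (by omega) (by omega)
    omega
  · have e1 := T.vv h hB
    have e2 := T.hv hr h
    omega

theorem X_b (T : Cfg k H V) (hA : H 0 0) (hB : V 0 1) (hC : H 1 1) (hD : V 1 0) :
    H (k + 2) 2 := by
  have hk := T.hk
  have hX := T.X_a hA hB hC hD
  rcases T.cov 2 2 with ⟨s, h, s1, s2, s3⟩ | ⟨s, h, s1, s2, s3⟩
  · have e1 := T.hv h hD
    have e2 := T.hv h hB
    exact cg h (by omega) rfl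
  · have e1 := T.hv hC h
    have e2 := T.hv hA h
    exact (hX (cg h rfl (by omega))).elim

theorem X_b' (T : Cfg k H V) (hA : H 0 0) (hB : V 0 1) (hC : H 1 1) (hD : V 1 0) :
    V (-1) (k + 2) := by
  have h := (T.tr.shift 0 1).flipY.X_b (cg (H := V) hD (by omega) (by omega))
    (cg (H := H) hA (by omega) (by omega)) (cg (H := V) hB (by omega) (by omega))
    (cg (H := H) hC (by omega) (by omega))
  exact cg (H := V) h (by omega) (by omega)

theorem noCyc1 (T : Cfg k H V) (hA : H 0 0) (hB : V 0 1) (hC : H 1 1) (hD : V 1 0) : False := by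
  have hk := T.hk
  have h2 := T.X_b hA hB hC hD
  have hL := T.X_b' hA hB hC hD
  have h3 : H (k + 2) 3 := by
    rcases T.cov 2 3 with ⟨s, h, s1, s2, s3⟩ | ⟨s, h, s1, s2, s3⟩
    · have e1 := T.hv h hD
      have e2 := T.hv h hB
      exact cg h (by omega) rfl
    · exfalso
      have e1 := T.hv h2 h
      have e2 := T.hv hC h
      have hs : s = k + 3 := by omega
      subst hs
      have hM : V 1 (2 * k + 1) := by
        rcases T.cov 1 (k + 1) with ⟨s, h', s1, s2, s3⟩ | ⟨s, h', s1, s2, s3⟩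
        · have e1 := T.hv h' h
          have e2 := T.hv h' hB
          omega
        · have e1 := T.vv h' hD
          exact cg h' rfl (by omega)
      obtain ⟨r, hr, r1, r2, r3⟩ := T.cV hM
      have e3 := T.hv hr h
      have e4 := T.hv hr hL
      have hr' : r = 2 := by omega
      subst hr'
      have := T.F2 hr h (by omega) (by omega) (by omega)
      omega
  obtain ⟨t1, hT1, a1, a2, a3⟩ := T.cH h2
  obtain ⟨t2, hT2, b1, b2, b3⟩ := T.cH h3
  have e1 := T.F2 h2 hT1 (by omega) (by omega) (by omega)
  have e2 := T.F2 h3 hT2 (by omega) (by omega) (by omega)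
  have e3 := T.hv h2 hT2
  have e4 := T.hv h3 hT1
  have e5 := T.vv hT1 hT2
  have ht : t1 = 2 - k := by omega
  subst ht
  obtain ⟨a, ha, a1⟩ := T.N1 h2 hT1 (by omega) (by omega) (by omega)
  have e6 := T.hv ha hD
  have ha' : a = k + 3 := by omega
  subst ha'
  rcases T.cov (k + 1) 0 with ⟨s, h, s1, s2, s3⟩ | ⟨s, h, s1, s2, s3⟩
  · have e1 := T.hh h hA
    have e2 := T.hv h hT1
    omega
  · have e1 := T.hv hC h
    have e2 := T.hv h2 h
    have e3 := T.hv ha h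
    omega

theorem noOne (T : Cfg k H V) {x y b : ℤ} (hA : H x y) (hB : V x b)
    (h1 : b - y = 1 ∨ y - b = 1) : False := by
  obtain ⟨a, hC, a1, a2, a3⟩ := T.cV hB
  have hD := T.L2 hA hB hC h1 a1 (by omega) (by omega)
  exact cycNorm (P := fun _ => False) (fun T c h1 h2 hA hB hC hD => by
    by_cases h1 : c = 1
    · subst h1; exact T.noCyc1 hA hB hC hD
    by_cases h2 : c = 2
    · subst h2; exact T.noCyc2 hA hB hC hD
    exact T.noCyc3 (by omega) (by omega) hA hB hC hD) T hA hB hC hD h1 a1 (by omega) (by omega)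

theorem noH (T : Cfg k H V) {x y : ℤ} (hA : H x y) : False := by
  obtain ⟨b, hB, b1, b2, b3⟩ := T.cH hA
  by_cases h : 2 ≤ b - y ∨ 2 ≤ y - b
  · obtain ⟨a, ha, a1⟩ := T.N1 hA hB h (by omega) (by omega)
    exact T.tr.noOne (x := b) (y := x) (b := a) hB ha (by omega)
  · exact T.noOne hA hB (by omega)

theorem contra (T : Cfg k H V) : False := by
  rcases T.cov 0 0 with ⟨s, h, -⟩ | ⟨s, h, -⟩
  · exact T.noH h
  · exact T.tr.noH (x := s) (y := 0) h

end Cfg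

/-- The horizontal tile with hole at `(x, y)`. -/
def hset (k x y : ℤ) : Set (Fin 2 → ℤ) := {p | p 1 = y ∧ p 0 ≠ x ∧ x - k ≤ p 0 ∧ p 0 ≤ x + k}

/-- The vertical tile with hole at `(x, y)`. -/
def vset (k x y : ℤ) : Set (Fin 2 → ℤ) := {p | p 0 = x ∧ p 1 ≠ y ∧ y - k ≤ p 1 ∧ p 1 ≤ y + k}

theorem mem_hset {k x y a b : ℤ} :
    ![a, b] ∈ hset k x y ↔ b = y ∧ a ≠ x ∧ x - k ≤ a ∧ a ≤ x + k := by
  simp [hset]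

theorem mem_vset {k x y a b : ℤ} :
    ![a, b] ∈ vset k x y ↔ a = x ∧ b ≠ y ∧ y - k ≤ b ∧ b ≤ y + k := by
  simp [vset]

theorem copy_cases (k : ℕ) (P : Set (Fin 2 → ℤ)) (h : IsCopy 2 (punctTile k 1 k) P) :
    ∃ x y : ℤ, P = hset k x y ∨ P = vset k x y := by
  obtain ⟨v, i, ε, hε, rfl⟩ := h
  have hi : i = 0 ∨ i = 1 := by fin_cases i <;> simp
  rcases hi with rfl | rfl
  · refine ⟨v 0 + ε * k, v 1, Or.inl ?_⟩
    ext p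
    constructor
    · rintro ⟨x, hx, rfl⟩
      simp only [punctTile, Set.mem_setOf_eq] at hx
      rcases hε with rfl | rfl <;> simp [hset] <;> omega
    · rintro ⟨h1, h2, h3, h4⟩
      refine ⟨ε * (p 0 - v 0), ?_, ?_⟩
      · simp only [punctTile, Set.mem_setOf_eq]
        rcases hε with rfl | rfl <;> push_cast <;> omega
      · funext j
        fin_cases j
        · rcases hε with rfl | rfl <;> simp
        · simp [h1]
  · refine ⟨v 0, v 1 + ε * k, Or.inr ?_⟩
    ext p
    constructor
    · rintro ⟨x, hx, rfl⟩
      simp only [punctTile, Set.mem_setOf_eq] at hx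
      rcases hε with rfl | rfl <;> simp [vset] <;> omega
    · rintro ⟨h1, h2, h3, h4⟩
      refine ⟨ε * (p 1 - v 1), ?_, ?_⟩
      · simp only [punctTile, Set.mem_setOf_eq]
        rcases hε with rfl | rfl <;> push_cast <;> omega
      · funext j
        fin_cases j
        · simp [h1]
        · rcases hε with rfl | rfl <;> simp

theorem exists_cfg (k : ℕ) (hk : 3 ≤ k) (h : TilesZd 2 (punctTile k 1 k)) :
    ∃ H V, Cfg (k : ℤ) H V := by
  obtain ⟨F, hF, hd, hU⟩ := h
  have uniq : ∀ {P Q : Set (Fin 2 → ℤ)} (p : Fin 2 → ℤ), P ∈ F → Q ∈ F → p ∈ P → p ∈ Q →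
      P = Q := by
    intro P Q p hP hQ h1 h2
    by_contra hne
    exact Set.disjoint_left.mp (hd hP hQ hne) h1 h2
  have hh : ∀ {x y x' y' : ℤ}, hset k x y ∈ F → hset k x' y' ∈ F →
      y ≠ y' ∨ x = x' ∨ x + 2 * k < x' ∨ x' + 2 * k < x := by
    have key : ∀ {x y x' : ℤ}, hset k x y ∈ F → hset k x' y ∈ F → x < x' → x' ≤ x + 2 * k →
        False := by
      intro x y x' h1 h2 h3 h4
      have hz : ∃ z, z ≠ x ∧ x - k ≤ z ∧ z ≤ x + k ∧ z ≠ x' ∧ x' - k ≤ z ∧ z ≤ x' + k := by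
        by_cases c1 : x' = x + 1
        · exact ⟨x + 2, by omega⟩
        by_cases c2 : x' ≤ x + k
        · exact ⟨x + 1, by omega⟩
        · exact ⟨x + k, by omega⟩
      obtain ⟨z, z1, z2, z3, z4, z5, z6⟩ := hz
      have e := uniq ![z, y] h1 h2 (mem_hset.2 ⟨rfl, z1, z2, z3⟩) (mem_hset.2 ⟨rfl, z4, z5, z6⟩)
      have m : ![x - k, y] ∈ hset k x y := mem_hset.2 ⟨rfl, by omega, by omega, by omega⟩
      rw [e, mem_hset] at m
      omega
    intro x y x' y' h1 h2
    by_contra hcon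
    push Not at hcon
    obtain ⟨rfl, c1, c2, c3⟩ := hcon
    rcases lt_or_gt_of_ne c1 with c | c
    · exact key h1 h2 c (by omega)
    · exact key h2 h1 c (by omega)
  have vv : ∀ {x y x' y' : ℤ}, vset k x y ∈ F → vset k x' y' ∈ F →
      x ≠ x' ∨ y = y' ∨ y + 2 * k < y' ∨ y' + 2 * k < y := by
    have key : ∀ {x y y' : ℤ}, vset k x y ∈ F → vset k x y' ∈ F → y < y' → y' ≤ y + 2 * k →
        False := by
      intro x y y' h1 h2 h3 h4
      have hz : ∃ z, z ≠ y ∧ y - k ≤ z ∧ z ≤ y + k ∧ z ≠ y' ∧ y' - k ≤ z ∧ z ≤ y' + k := by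
        by_cases c1 : y' = y + 1
        · exact ⟨y + 2, by omega⟩
        by_cases c2 : y' ≤ y + k
        · exact ⟨y + 1, by omega⟩
        · exact ⟨y + k, by omega⟩
      obtain ⟨z, z1, z2, z3, z4, z5, z6⟩ := hz
      have e := uniq ![x, z] h1 h2 (mem_vset.2 ⟨rfl, z1, z2, z3⟩) (mem_vset.2 ⟨rfl, z4, z5, z6⟩)
      have m : ![x, y - k] ∈ vset k x y := mem_vset.2 ⟨rfl, by omega, by omega, by omega⟩
      rw [e, mem_vset] at m
      omega
    intro x y x' y' h1 h2
    by_contra hcon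
    push Not at hcon
    obtain ⟨rfl, c1, c2, c3⟩ := hcon
    rcases lt_or_gt_of_ne c1 with c | c
    · exact key h1 h2 c (by omega)
    · exact key h2 h1 c (by omega)
  have cov : ∀ x y : ℤ, (∃ s, hset k s y ∈ F ∧ s ≠ x ∧ x - k ≤ s ∧ s ≤ x + k) ∨
      (∃ s, vset k x s ∈ F ∧ s ≠ y ∧ y - k ≤ s ∧ s ≤ y + k) := by
    intro x y
    have hm : ![x, y] ∈ ⋃₀ F := by rw [hU]; trivial
    obtain ⟨P, hP, hp⟩ := hm
    obtain ⟨a, b, rfl | rfl⟩ := copy_cases k P (hF P hP)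
    · obtain ⟨rfl, h1, h2, h3⟩ := mem_hset.1 hp
      exact Or.inl ⟨a, hP, by omega, by omega, by omega⟩
    · obtain ⟨rfl, h1, h2, h3⟩ := mem_vset.1 hp
      exact Or.inr ⟨b, hP, by omega, by omega, by omega⟩
  refine ⟨fun x y => hset k x y ∈ F, fun x y => vset k x y ∈ F, by omega, hh, vv, ?_, cov⟩
  intro x y a b h1 h2
  by_contra hcon
  by_cases c1 : x = a
  · by_cases c2 : y = b
    · subst c1 c2
      rcases cov x y with ⟨s, h, s1, s2, s3⟩ | ⟨s, h, s1, s2, s3⟩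
      · have := hh h h1
        omega
      · have := vv h h2
        omega
    · omega
  · by_cases c2 : y = b
    · omega
    have e := uniq ![a, y] h1 h2 (mem_hset.2 ⟨rfl, by omega, by omega, by omega⟩)
      (mem_vset.2 ⟨rfl, by omega, by omega, by omega⟩)
    have m1 : ![x - k, y] ∈ hset k x y := mem_hset.2 ⟨rfl, by omega, by omega, by omega⟩
    have m2 : ![x + k, y] ∈ hset k x y := mem_hset.2 ⟨rfl, by omega, by omega, by omega⟩
    rw [e, mem_vset] at m1 m2
    omega

/-- For `k ≥ 3`, the tile `k(1)k` does not tile `ℤ^2`. -/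
theorem symmetric_punctured_interval_not_tiles_Z2 (k : ℕ) (hk : 3 ≤ k) :
    ¬ TilesZd 2 (punctTile k 1 k) := by
  intro h
  obtain ⟨H, V, T⟩ := exists_cfg k hk h
  exact T.contra
end

section
/- Let T be the one-dimensional tile k(m)ℓ, where k, ℓ, m are positive integers. Suppose there are three pairwise disjoint subsets A, B, C of ℤ^d of the same cardinality (i.e., there exist bijections A → B and A → C) such that T tiles ℤ^d ∖ (A ∪ B), T tiles ℤ^d ∖ (A ∪ C), and T tiles ℤ^d ∖ (B ∪ C). Then T tiles ℤ^{d+1}. -/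
theorem floor_add_self (u : ℤ) {n : ℤ} (h : n ≠ 0) : (u + n) / n = u / n + 1 := by
  have := Int.add_mul_ediv_right u 1 h
  rwa [one_mul] at this

/-- Colour difference one or two (so different modulo three). -/
def ColD (a b : ℤ) : Prop := b - a = 1 ∨ b - a = 2

theorem ColD.ne {a b : ℤ} (h : ColD a b) : (a : ZMod 3) ≠ (b : ZMod 3) := by
  intro h'
  rw [ZMod.intCast_eq_intCast_iff_dvd_sub] at h'
  unfold ColD at h
  push_cast at h'
  omega

theorem floor_step1 (n u : ℤ) (hn : 1 ≤ n) : ColD (u / n) ((u + n) / n) := by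
  left
  rw [floor_add_self _ (by omega)]
  ring

theorem floor_succ (n u : ℤ) (hn : 1 ≤ n) :
    (u + 1) / n - u / n = 0 ∨ (u + 1) / n - u / n = 1 := by
  have h1 : u / n ≤ (u + 1) / n := Int.ediv_le_ediv (by omega) (by omega)
  have h2 : (u + 1) / n ≤ (u + n) / n := Int.ediv_le_ediv (by omega) (by omega)
  rw [floor_add_self _ (by omega)] at h2
  omega

theorem floor_step2 (n u : ℤ) (hn : 1 ≤ n) : ColD (u / n) ((u + n + 1) / n) := by
  have h : (u + n + 1) / n = (u + 1) / n + 1 := by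
    rw [show u + n + 1 = (u + 1) + n by ring, floor_add_self _ (by omega)]
  have := floor_succ n u hn
  unfold ColD
  omega

theorem exists_colour (k l r Q : ℤ) (hQ : 1 ≤ Q) : ∃ f g : ℤ → ℤ,
    (∀ i, ColD (f i) (f (i + Q))) ∧ (∀ i, ColD (g i) (g (i + Q))) ∧
    (r < l → ∀ i, ColD (f i) (g (i + Q - 1))) ∧ (k < r → ∀ i, ColD (f i) (g (i + Q))) ∧
    (r < k → ∀ i, ColD (g i) (f (i + Q))) ∧ (l < r → ∀ i, ColD (g i) (f (i + Q + 1))) := by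
  by_cases h1 : r < k
  · by_cases h2 : r < l
    · refine ⟨fun i => (2 * i) / (2 * Q - 1), fun i => (2 * i + 1) / (2 * Q - 1),
        ?_, ?_, ?_, ?_, ?_, ?_⟩
      · intro i
        convert floor_step2 (2 * Q - 1) (2 * i) (by omega) using 2; ring
      · intro i
        convert floor_step2 (2 * Q - 1) (2 * i + 1) (by omega) using 2; ring
      · intro _ i
        convert floor_step1 (2 * Q - 1) (2 * i) (by omega) using 2; ring
      · intro; omega
      · intro _ i
        convert floor_step1 (2 * Q - 1) (2 * i + 1) (by omega) using 2; ring
      · intro; omega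
    · refine ⟨fun i => (i - 1) / Q + 1, fun i => i / Q, ?_, ?_, ?_, ?_, ?_, ?_⟩
      · intro i
        have := floor_step1 Q (i - 1) hQ
        rw [show i - 1 + Q = i + Q - 1 by ring] at this
        unfold ColD at *
        dsimp only at *
        omega
      · intro i
        exact floor_step1 Q i hQ
      · intro; omega
      · intro; omega
      · intro _ i
        have h3 := floor_succ Q (i - 1) hQ
        have h4 : (i + Q - 1) / Q = (i - 1) / Q + 1 := by
          rw [show i + Q - 1 = i - 1 + Q by ring, floor_add_self _ (by omega)]
        rw [show i - 1 + 1 = i by ring] at h3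
        unfold ColD
        dsimp only
        omega
      · intro _ i
        have h4 : (i + Q + 1 - 1) / Q = i / Q + 1 := by
          rw [show i + Q + 1 - 1 = i + Q by ring, floor_add_self _ (by omega)]
        unfold ColD
        dsimp only
        omega
  · by_cases h2 : l < r
    · refine ⟨fun i => (2 * i) / (2 * Q), fun i => (2 * i + 1) / (2 * Q),
        ?_, ?_, ?_, ?_, ?_, ?_⟩
      · intro i
        convert floor_step1 (2 * Q) (2 * i) (by omega) using 2; ring
      · intro i
        convert floor_step1 (2 * Q) (2 * i + 1) (by omega) using 2; ring
      · intro; omega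
      · intro _ i
        convert floor_step2 (2 * Q) (2 * i) (by omega) using 2; ring
      · intro; omega
      · intro _ i
        convert floor_step2 (2 * Q) (2 * i + 1) (by omega) using 2; ring
    · refine ⟨fun i => i / Q, fun i => i / Q + 1, ?_, ?_, ?_, ?_, ?_, ?_⟩
      · intro i
        exact floor_step1 Q i hQ
      · intro i
        have := floor_step1 Q i hQ
        unfold ColD at *
        dsimp only at *
        omega
      · intro _ i
        have h3 := floor_succ Q (i - 1) hQ
        have h4 : (i + Q - 1) / Q = (i - 1) / Q + 1 := by
          rw [show i + Q - 1 = i - 1 + Q by ring, floor_add_self _ (by omega)]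
        rw [show i - 1 + 1 = i by ring] at h3
        unfold ColD
        dsimp only
        omega
      · intro _ i
        have h4 : (i + Q) / Q = i / Q + 1 := by
          rw [floor_add_self _ (by omega)]
        unfold ColD
        dsimp only
        omega
      · intro; omega
      · intro; omega

/-- first-layer block of the tile indexed by `(i, b)` -/
def Blk1 (k s : ℤ) (u : ℤ × Bool) (x : ℤ) : Prop :=
  if u.2 then k ≤ x - s * u.1 ∧ x - s * u.1 < s else 0 ≤ x - s * u.1 ∧ x - s * u.1 < k

/-- second-layer block of the tile indexed by `(i, b)` -/
def Blk2 (k m s : ℤ) (u : ℤ × Bool) (x : ℤ) : Prop :=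
  if u.2 then s + m ≤ x - s * u.1 ∧ x - s * u.1 < s + m + k
  else k + m ≤ x - s * u.1 ∧ x - s * u.1 < s + m

theorem mul_small_s3 {s t a : ℤ} (h : s * t = a) (h1 : -s < a) (h2 : a < s) : t = 0 := by
  have hs : 0 < s := by omega
  have h3 : -1 < t := by nlinarith
  have h4 : t < 1 := by nlinarith
  omega

theorem blk1_unique (k l : ℤ) (hk : 0 < k) (hl : 0 < l) (x : ℤ) :
    ∃ u, ∀ w, Blk1 k (k + l) w x ↔ w = u := by
  have hs : 0 < k + l := by omega
  have e := Int.emod_add_mul_ediv x (k + l)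
  have b1 := Int.emod_nonneg x hs.ne'
  have b2 := Int.emod_lt_of_pos x hs
  generalize x % (k + l) = ρ at *
  generalize x / (k + l) = t at *
  refine ⟨(t, decide (k ≤ ρ)), ?_⟩
  rintro ⟨i, b⟩
  have key : -(k + l) < x - (k + l) * i - ρ → x - (k + l) * i - ρ < k + l → i = t := by
    intro h1 h2
    have := mul_small_s3 (s := k + l) (t := t - i) (a := x - (k + l) * i - ρ)
      (by rw [← e]; ring) h1 h2
    omega
  constructor
  · intro h
    have hi : i = t := by
      apply key <;> cases b <;> simp [Blk1] at h <;> omega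
    subst hi
    cases b <;> simp [Blk1] at h ⊢ <;> omega
  · intro h
    simp only [Prod.mk.injEq] at h
    obtain ⟨rfl, rfl⟩ := h
    by_cases h : k ≤ ρ <;> simp [Blk1, h] <;> omega

theorem blk2_unique (k m l : ℤ) (hk : 0 < k) (hl : 0 < l) (x : ℤ) :
    ∃ u, ∀ w, Blk2 k m (k + l) w x ↔ w = u := by
  obtain ⟨⟨i, b⟩, h⟩ := blk1_unique l k hl hk (x - k - m)
  refine ⟨(i, b), fun w => ?_⟩
  rw [← h w]
  obtain ⟨j, c⟩ := w
  rw [add_comm l k]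
  cases c <;> simp [Blk1, Blk2] <;> omega

/-- conflicts between layers are properly coloured -/
theorem conflict_colour (k m l : ℤ) (hk : 0 < k) (hm : 0 ≤ m) (hl : 0 < l) :
    ∃ c : ℤ × Bool → ZMod 3, ∀ u w x, Blk2 k m (k + l) u x → Blk1 k (k + l) w x → c u ≠ c w := by
  have hs : 0 < k + l := by omega
  have e := Int.emod_add_mul_ediv m (k + l)
  have b1 := Int.emod_nonneg m hs.ne'
  have b2 := Int.emod_lt_of_pos m hs
  have b3 : 0 ≤ m / (k + l) := Int.ediv_nonneg hm hs.le
  generalize m % (k + l) = r at *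
  generalize m / (k + l) = q at *
  obtain ⟨f, g, h1, h2, h3, h4, h5, h6⟩ := exists_colour k l r (q + 1) (by omega)
  refine ⟨fun u => if u.2 then (g u.1 : ZMod 3) else (f u.1 : ZMod 3), ?_⟩
  rintro ⟨i, b⟩ ⟨j, c⟩ x hu hw
  -- write j = i + q + δ
  obtain ⟨δ, rfl⟩ : ∃ δ, j = i + q + δ := ⟨j - i - q, by ring⟩
  obtain ⟨y, rfl⟩ : ∃ y, x = y + (k + l) * (i + q + δ) := ⟨x - (k + l) * (i + q + δ), by ring⟩
  have e1 : y + (k + l) * (i + q + δ) - (k + l) * (i + q + δ) = y := by ring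
  have e2 : y + (k + l) * (i + q + δ) - (k + l) * i = y + m - r + (k + l) * δ := by
    rw [← e]; ring
  simp only [Blk1, Blk2, e1, e2] at hu hw
  have hy : 0 ≤ y ∧ y < k + l := by
    cases c <;> simp at hw <;> omega
  have hd : k + r ≤ y + (k + l) * δ ∧ y + (k + l) * δ < k + l + r + k := by
    cases b <;> simp at hu <;> omega
  have hδ : δ = 0 ∨ δ = 1 ∨ δ = 2 := by
    have : -1 < δ := by
      by_contra hh
      nlinarith
    have : δ < 3 := by
      by_contra hh
      nlinarith
    omega
  rcases hδ with rfl | rfl | rfl <;> cases b <;> cases c <;> simp at hu hw ⊢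
  all_goals first
    | (exfalso; omega)
    | exact (h1 i).ne
    | exact (h2 i).ne
    | exact (h4 (by omega) i).ne
    | exact (h5 (by omega) i).ne
    | (have := (h3 (by omega) i).ne
       rwa [show i + (q + 1) - 1 = i + q + 0 by ring, add_zero] at this)
    | (have := (h6 (by omega) i).ne
       rwa [show i + (q + 1) + 1 = i + q + 2 by ring] at this)
    | (have := (h1 i).ne
       rwa [show i + (q + 1) = i + q + 1 by ring] at this)
    | (have := (h2 i).ne
       rwa [show i + (q + 1) = i + q + 1 by ring] at this)
    | (have := (h4 (by omega) i).ne
       rwa [show i + (q + 1) = i + q + 1 by ring] at this)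
    | (have := (h5 (by omega) i).ne
       rwa [show i + (q + 1) = i + q + 1 by ring] at this)

/-- One-dimensional two-fold cover with three colours. -/
theorem two_cover (k m l : ℕ) (hk : 0 < k) (hl : 0 < l) :
    ∃ (G : ZMod 3 → Set (ℤ × ℤ)) (c0 : ℤ → ZMod 3),
      (∀ c, ∀ p ∈ G c, p.2 = 1 ∨ p.2 = -1) ∧
      (∀ c, ∀ p ∈ G c, ∀ q ∈ G c, ∀ x, p.2 * (x - p.1) ∈ punctTile k m l →
        q.2 * (x - q.1) ∈ punctTile k m l → p = q) ∧
      (∀ x c, c ≠ c0 x ↔ ∃ p ∈ G c, p.2 * (x - p.1) ∈ punctTile k m l) := by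
  obtain ⟨c, hc⟩ := conflict_colour k m l (by omega) (by omega) (by omega)
  choose u1 hu1 using blk1_unique k l (by omega) (by omega)
  choose u2 hu2 using blk2_unique k m l (by omega) (by omega)
  have hne : ∀ x, c (u2 x) ≠ c (u1 x) := fun x =>
    hc _ _ x ((hu2 x _).2 rfl) ((hu1 x _).2 rfl)
  let P : ℤ × Bool → ℤ × ℤ := fun u =>
    if u.2 then ((k + l : ℤ) * u.1 + (k + l) + m + k - 1, -1) else ((k + l : ℤ) * u.1, 1)
  have hP : ∀ u x, (P u).2 * (x - (P u).1) ∈ punctTile k m l ↔ u = u1 x ∨ u = u2 x := by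
    rintro ⟨i, b⟩ x
    rw [← hu1, ← hu2]
    cases b <;> simp [P, Blk1, Blk2, punctTile] <;> omega
  refine ⟨fun a => P '' {u | c u = a}, fun x => -(c (u1 x) + c (u2 x)), ?_, ?_, ?_⟩
  · rintro a _ ⟨⟨i, b⟩, -, rfl⟩
    cases b <;> simp [P]
  · rintro a _ ⟨u, hu, rfl⟩ _ ⟨w, hw, rfl⟩ x h1 h2
    rw [hP] at h1 h2
    have := hne x
    simp only [Set.mem_setOf_eq] at hu hw
    congr 1
    rcases h1 with rfl | rfl <;> rcases h2 with rfl | rfl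
    · rfl
    · exact absurd (hw.trans hu.symm) this
    · exact absurd (hu.trans hw.symm) this
    · rfl
  · intro x a
    have h3 : ∀ a b d : ZMod 3, b ≠ d → (a ≠ -(d + b) ↔ d = a ∨ b = a) := by decide
    rw [h3 _ _ _ (hne x)]
    constructor
    · rintro (h | h)
      · exact ⟨_, ⟨u1 x, h, rfl⟩, (hP _ _).2 (Or.inl rfl)⟩
      · exact ⟨_, ⟨u2 x, h, rfl⟩, (hP _ _).2 (Or.inr rfl)⟩
    · rintro ⟨_, ⟨u, hu, rfl⟩, h⟩
      rcases (hP _ _).1 h with rfl | rfl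
      · exact Or.inl hu
      · exact Or.inr hu

theorem isCopy_cons {d : ℕ} {T : Set ℤ} {P : Set (Fin d → ℤ)} (h : IsCopy d T P) (x : ℤ) :
    IsCopy (d + 1) T {p | p 0 = x ∧ Fin.tail p ∈ P} := by
  obtain ⟨v, i, ε, hε, rfl⟩ := h
  refine ⟨Fin.cons x v, i.succ, ε, hε, ?_⟩
  ext p
  constructor
  · rintro ⟨rfl, t, ht, h⟩
    refine ⟨t, ht, ?_⟩
    funext j
    refine Fin.cases ?_ (fun j => ?_) j
    · simp [(Fin.succ_ne_zero i).symm]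
    · have := congrFun h j
      simpa [Fin.tail] using this
  · rintro ⟨t, ht, rfl⟩
    refine ⟨by simp [(Fin.succ_ne_zero i).symm], t, ht, ?_⟩
    funext j
    simp [Fin.tail]

theorem isCopy_vert {d : ℕ} {T : Set ℤ} (b : Fin d → ℤ) (u : ℤ × ℤ) (hu : u.2 = 1 ∨ u.2 = -1) :
    IsCopy (d + 1) T {p | Fin.tail p = b ∧ u.2 * (p 0 - u.1) ∈ T} := by
  have hsq : u.2 * u.2 = 1 := by rcases hu with h | h <;> rw [h] <;> norm_num
  refine ⟨Fin.cons u.1 b, 0, u.2, hu, ?_⟩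
  ext p
  constructor
  · rintro ⟨rfl, h⟩
    refine ⟨_, h, ?_⟩
    funext j
    refine Fin.cases ?_ (fun j => ?_) j
    · simp only [Fin.cons_zero, if_true]
      rw [← mul_assoc, hsq]; ring
    · simp [Fin.tail]
  · rintro ⟨t, ht, rfl⟩
    refine ⟨?_, ?_⟩
    · funext j
      simp [Fin.tail]
    · simp only [Fin.cons_zero, if_true]
      rw [show u.2 * (u.1 + u.2 * t - u.1) = (u.2 * u.2) * t by ring, hsq, one_mul]
      exact ht

theorem assemble (d : ℕ) (T : Set ℤ) (S : ZMod 3 → Set (Fin d → ℤ))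
    (hS : ∀ c c' p, p ∈ S c → p ∈ S c' → c = c')
    (hT : ∀ c0, Tiles d T {p | ∀ c, c ≠ c0 → p ∉ S c})
    (G : ZMod 3 → Set (ℤ × ℤ)) (c0 : ℤ → ZMod 3)
    (hG1 : ∀ c, ∀ p ∈ G c, p.2 = 1 ∨ p.2 = -1)
    (hG2 : ∀ c, ∀ p ∈ G c, ∀ q ∈ G c, ∀ x, p.2 * (x - p.1) ∈ T →
        q.2 * (x - q.1) ∈ T → p = q)
    (hG3 : ∀ x c, c ≠ c0 x ↔ ∃ p ∈ G c, p.2 * (x - p.1) ∈ T) :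
    TilesZd (d + 1) T := by
  choose H hH1 hH2 hH3 using hT
  refine ⟨{P | (∃ x, ∃ Q ∈ H (c0 x), P = {p : Fin (d + 1) → ℤ | p 0 = x ∧ (Fin.tail p : Fin d → ℤ) ∈ Q}) ∨
    ∃ c, ∃ b ∈ S c, ∃ u ∈ G c, P = {p : Fin (d + 1) → ℤ | (Fin.tail p : Fin d → ℤ) = b ∧ u.2 * (p 0 - u.1) ∈ T}}, ?_, ?_, ?_⟩
  · rintro P (⟨x, Q, hQ, rfl⟩ | ⟨c, b, hb, u, hu, rfl⟩)
    · exact isCopy_cons (hH1 _ _ hQ) x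
    · exact isCopy_vert b u (hG1 _ _ hu)
  · have hcross : ∀ (p : Fin (d + 1) → ℤ), ∀ Q ∈ H (c0 (p 0)), (Fin.tail p : Fin d → ℤ) ∈ Q →
        ∀ c, (Fin.tail p : Fin d → ℤ) ∈ S c → ∀ u ∈ G c, u.2 * (p 0 - u.1) ∈ T → False := by
      intro p Q hQ hp c hc u hu h
      have h1 : (Fin.tail p : Fin d → ℤ) ∈ ⋃₀ H (c0 (p 0)) := ⟨Q, hQ, hp⟩
      rw [hH3] at h1
      exact h1 c ((hG3 _ _).2 ⟨u, hu, h⟩) hc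
    intro P hP P' hP' hne
    rw [Set.disjoint_left]
    intro p hp hp'
    apply hne
    rcases hP with ⟨x, Q, hQ, rfl⟩ | ⟨c, b, hb, u, hu, rfl⟩ <;>
      rcases hP' with ⟨x', Q', hQ', rfl⟩ | ⟨c', b', hb', u', hu', rfl⟩
    · obtain ⟨rfl, hp⟩ := hp
      obtain ⟨rfl, hp'⟩ := hp'
      have : Q = Q' := by
        by_contra hn
        exact Set.disjoint_left.1 (hH2 _ hQ hQ' hn) hp hp'
      rw [this]
    · obtain ⟨rfl, hp⟩ := hp
      obtain ⟨rfl, hp'⟩ := hp'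
      exact (hcross p Q hQ hp c' hb' u' hu' hp').elim
    · obtain ⟨rfl, hp⟩ := hp
      obtain ⟨rfl, hp'⟩ := hp'
      exact (hcross p Q' hQ' hp' c hb u hu hp).elim
    · obtain ⟨rfl, hp⟩ := hp
      obtain ⟨rfl, hp'⟩ := hp'
      obtain rfl := hS _ _ _ hb hb'
      rw [hG2 c u hu u' hu' _ hp hp']
  · rw [Set.eq_univ_iff_forall]
    intro p
    by_cases h : ∃ c, c ≠ c0 (p 0) ∧ (Fin.tail p : Fin d → ℤ) ∈ S c
    · obtain ⟨c, hc, hp⟩ := h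
      obtain ⟨u, hu, h⟩ := (hG3 _ _).1 hc
      exact ⟨_, Or.inr ⟨c, _, hp, u, hu, rfl⟩, rfl, h⟩
    · have h1 : (Fin.tail p : Fin d → ℤ) ∈ ⋃₀ H (c0 (p 0)) := by
        rw [hH3]
        intro c hc hp
        exact h ⟨c, hc, hp⟩
      obtain ⟨Q, hQ, hp⟩ := h1
      exact ⟨_, Or.inl ⟨p 0, Q, hQ, rfl⟩, rfl, hp⟩

/-- If there are three pairwise disjoint, equinumerous sets `A, B, C ⊆ ℤ^d` such that
`T = k(m)ℓ` tiles the complements of `A ∪ B`, `A ∪ C` and `B ∪ C`,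
then `T` tiles `ℤ^(d+1)`. -/
theorem partial_to_complete_tilings (k m l d : ℕ) (hk : 0 < k) (hm : 0 < m) (hl : 0 < l)
    (A B C : Set (Fin d → ℤ))
    (hAB : Disjoint A B) (hAC : Disjoint A C) (hBC : Disjoint B C)
    (eAB : Nonempty (A ≃ B)) (eAC : Nonempty (A ≃ C))
    (h1 : Tiles d (punctTile k m l) (Set.univ \ (A ∪ B)))
    (h2 : Tiles d (punctTile k m l) (Set.univ \ (A ∪ C)))
    (h3 : Tiles d (punctTile k m l) (Set.univ \ (B ∪ C))) :
    TilesZd (d + 1) (punctTile k m l) := by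
  obtain ⟨G, c0, hG1, hG2, hG3⟩ := two_cover k m l hk hl
  rw [Set.disjoint_left] at hAB hAC hBC
  let S : ZMod 3 → Set (Fin d → ℤ) := fun c => if c = 0 then A else if c = 1 then B else C
  have e0 : S 0 = A := rfl
  have e1 : S 1 = B := rfl
  have e2 : S 2 = C := rfl
  have hall : ∀ Q : ZMod 3 → Prop, Q 0 → Q 1 → Q 2 → ∀ c, Q c := by
    intro Q q0 q1 q2 c
    have : ∀ c : ZMod 3, c = 0 ∨ c = 1 ∨ c = 2 := by decide
    rcases this c with rfl | rfl | rfl <;> assumption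
  have d01 : (0 : ZMod 3) ≠ 1 := by decide
  have d02 : (0 : ZMod 3) ≠ 2 := by decide
  have d12 : (1 : ZMod 3) ≠ 2 := by decide
  refine assemble d _ S ?_ ?_ G c0 hG1 hG2 hG3
  · intro c c' p
    revert c c'
    refine hall _ (hall _ ?_ ?_ ?_) (hall _ ?_ ?_ ?_) (hall _ ?_ ?_ ?_) <;>
      rw [‹S _ = _›] <;> (try rw [‹S _ = _›]) <;> intro h h' <;> first
      | rfl
      | exact (hAB h h').elim
      | exact (hAB h' h).elim
      | exact (hAC h h').elim
      | exact (hAC h' h).elim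
      | exact (hBC h h').elim
      | exact (hBC h' h).elim
  · refine hall _ ?_ ?_ ?_
    · convert h3 using 1
      ext p
      simp only [Set.mem_setOf_eq, Set.mem_diff, Set.mem_univ, true_and, Set.mem_union, not_or]
      exact ⟨fun h => ⟨h 1 d01.symm, h 2 d02.symm⟩,
        fun h => hall _ (fun h => (h rfl).elim) (fun _ => h.1) (fun _ => h.2)⟩
    · convert h2 using 1
      ext p
      simp only [Set.mem_setOf_eq, Set.mem_diff, Set.mem_univ, true_and, Set.mem_union, not_or]
      exact ⟨fun h => ⟨h 0 d01, h 2 d12.symm⟩,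
        fun h => hall _ (fun _ => h.1) (fun h => (h rfl).elim) (fun _ => h.2)⟩
    · convert h1 using 1
      ext p
      simp only [Set.mem_setOf_eq, Set.mem_diff, Set.mem_univ, true_and, Set.mem_union, not_or]
      exact ⟨fun h => ⟨h 0 d02, h 1 d12⟩,
        fun h => hall _ (fun _ => h.1) (fun _ => h.2) (fun h => (h rfl).elim)⟩
end

section
/- If k is a positive integer with k ≡ 2 (mod 4), then the tile k(1)k tiles ℤ^3. -/
/-- Gluing lemma: a family of starting points for each of the three directions such that every
point is covered exactly once gives a tiling. -/
lemma tilesZ3_of_starts (T : Set ℤ) (gx gy gz : ℤ → ℤ → ℤ → Prop)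
    (hcov : ∀ x y z, (∃ τ ∈ T, gx (x - τ) y z) ∨ (∃ τ ∈ T, gy x (y - τ) z) ∨
      (∃ τ ∈ T, gz x y (z - τ)))
    (hxx : ∀ x y z, ∀ τ ∈ T, ∀ σ ∈ T, gx (x - τ) y z → gx (x - σ) y z → τ = σ)
    (hyy : ∀ x y z, ∀ τ ∈ T, ∀ σ ∈ T, gy x (y - τ) z → gy x (y - σ) z → τ = σ)
    (hzz : ∀ x y z, ∀ τ ∈ T, ∀ σ ∈ T, gz x y (z - τ) → gz x y (z - σ) → τ = σ)
    (hxy : ∀ x y z, ∀ τ ∈ T, ∀ σ ∈ T, gx (x - τ) y z → gy x (y - σ) z → False)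
    (hxz : ∀ x y z, ∀ τ ∈ T, ∀ σ ∈ T, gx (x - τ) y z → gz x y (z - σ) → False)
    (hyz : ∀ x y z, ∀ τ ∈ T, ∀ σ ∈ T, gy x (y - τ) z → gz x y (z - σ) → False) :
    TilesZd 3 T := by
  let g : Fin 3 → ℤ → ℤ → ℤ → Prop := ![gx, gy, gz]
  let f : (Fin 3 → ℤ) → Fin 3 → ℤ → (Fin 3 → ℤ) :=
    fun v i x j => v j + if j = i then 1 * x else 0
  refine ⟨{P | ∃ v i, g i (v 0) (v 1) (v 2) ∧ P = f v i '' T}, ?_, ?_, ?_⟩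
  · rintro P ⟨v, i, -, rfl⟩
    exact ⟨v, i, 1, Or.inl rfl, rfl⟩
  · rintro P ⟨v, i, hg, rfl⟩ Q ⟨w, j, hg', rfl⟩ hne
    rw [Set.disjoint_left]
    rintro p ⟨τ, hτ, rfl⟩ ⟨σ, hσ, hp⟩
    apply hne
    have h0 := congrFun hp 0
    have h1 := congrFun hp 1
    have h2 := congrFun hp 2
    have key : i = j ∧ τ = σ := by
      fin_cases i <;> fin_cases j <;> simp [f, g] at h0 h1 h2 hg hg' ⊢
      · exact hxx (v 0 + τ) (v 1) (v 2) τ hτ σ hσ (by simpa using hg)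
          (by rw [← h0, ← h1, ← h2]; simpa using hg')
      · exact hxy (v 0 + τ) (v 1) (v 2) τ hτ σ hσ (by simpa using hg)
          (by rw [← h0, ← h1, ← h2]; simpa using hg')
      · exact hxz (v 0 + τ) (v 1) (v 2) τ hτ σ hσ (by simpa using hg)
          (by rw [← h0, ← h1, ← h2]; simpa using hg')
      · exact hxy (v 0) (v 1 + τ) (v 2) σ hσ τ hτ
          (by rw [← h0, ← h1, ← h2]; simpa using hg') (by simpa using hg)
      · exact hyy (v 0) (v 1 + τ) (v 2) τ hτ σ hσ (by simpa using hg)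
          (by rw [← h0, ← h1, ← h2]; simpa using hg')
      · exact hyz (v 0) (v 1 + τ) (v 2) τ hτ σ hσ (by simpa using hg)
          (by rw [← h0, ← h1, ← h2]; simpa using hg')
      · exact hxz (v 0) (v 1) (v 2 + τ) σ hσ τ hτ
          (by rw [← h0, ← h1, ← h2]; simpa using hg') (by simpa using hg)
      · exact hyz (v 0) (v 1) (v 2 + τ) σ hσ τ hτ
          (by rw [← h0, ← h1, ← h2]; simpa using hg') (by simpa using hg)
      · exact hzz (v 0) (v 1) (v 2 + τ) τ hτ σ hσ (by simpa using hg)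
          (by rw [← h0, ← h1, ← h2]; simpa using hg')
    obtain ⟨rfl, rfl⟩ := key
    have : v = w := by
      funext l
      have := congrFun hp l
      simp only [f] at this
      linarith
    rw [this]
  · rw [Set.eq_univ_iff_forall]
    intro p
    rcases hcov (p 0) (p 1) (p 2) with ⟨τ, hτ, hg⟩ | ⟨τ, hτ, hg⟩ | ⟨τ, hτ, hg⟩
    · refine ⟨_, ⟨![p 0 - τ, p 1, p 2], 0, hg, rfl⟩, τ, hτ, ?_⟩
      funext l; fin_cases l <;> simp [f]
    · refine ⟨_, ⟨![p 0, p 1 - τ, p 2], 1, hg, rfl⟩, τ, hτ, ?_⟩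
      funext l; fin_cases l <;> simp [f]
    · refine ⟨_, ⟨![p 0, p 1, p 2 - τ], 2, hg, rfl⟩, τ, hτ, ?_⟩
      funext l; fin_cases l <;> simp [f]

lemma dvd_sub_iff_eq_emod {N a τ : ℤ} (h0 : 0 ≤ τ) (h1 : τ < N) : N ∣ a - τ ↔ τ = a % N := by
  constructor
  · intro h
    have := (Int.emod_emod_of_dvd a (dvd_refl N))
    rw [Int.emod_eq_emod_iff_emod_sub_eq_zero.mpr (Int.emod_eq_zero_of_dvd h),
      Int.emod_eq_of_lt h0 h1]
  · rintro rfl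
    exact Int.dvd_self_sub_emod

/-- Residue of a shifted number. -/
lemma emod_shift {N a s : ℤ} (hs : 0 ≤ s) (hsN : s < N) :
    (a - s) % N = a % N - s ∧ s ≤ a % N ∨ (a - s) % N = a % N - s + N ∧ a % N < s := by
  have hN : 0 < N := by omega
  have h1 := Int.emod_nonneg a hN.ne'
  have h2 := Int.emod_lt_of_pos a hN
  rcases le_or_gt s (a % N) with h | h
  · left
    refine ⟨?_, h⟩
    symm
    rw [← dvd_sub_iff_eq_emod (by omega) (by omega)]
    have : a - s - (a % N - s) = a - a % N := by ring
    rw [this]; exact Int.dvd_self_sub_emod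
  · right
    refine ⟨?_, h⟩
    symm
    rw [← dvd_sub_iff_eq_emod (by omega) (by omega)]
    have : a - s - (a % N - s + N) = (a - a % N) - N := by ring
    rw [this]; exact dvd_sub Int.dvd_self_sub_emod (dvd_refl N)

/-- Divisibility by `n` in terms of the residue mod `2 n`. -/
lemma dvd_iff_of_two_mul {n a : ℤ} (hn : 1 < n) :
    n ∣ a ↔ (a - 1) % (2 * n) = n - 1 ∨ (a - 1) % (2 * n) = 2 * n - 1 := by
  rw [eq_comm, ← dvd_sub_iff_eq_emod (by omega) (by omega), eq_comm,
    ← dvd_sub_iff_eq_emod (by omega) (by omega)]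
  constructor
  · rintro ⟨c, rfl⟩
    rcases Int.even_or_odd' c with ⟨d, rfl | rfl⟩
    · right; exact ⟨d - 1, by ring⟩
    · left; exact ⟨d, by ring⟩
  · rintro (⟨c, hc⟩ | ⟨c, hc⟩)
    · exact ⟨2 * c + 1, by linarith⟩
    · exact ⟨2 * c + 2, by linarith⟩

/-- Residues mod `4 n` of numbers of the form `y - 4 x`. -/
lemma emod_four_iff {n x y c : ℤ} (hc0 : 0 ≤ c) (hc : c < 4 * n) (hyc : y % 4 = c % 4) :
    (y - 4 * x) % (4 * n) = c ↔ n ∣ x - (y / 4 - c / 4) := by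
  rw [eq_comm, ← dvd_sub_iff_eq_emod hc0 hc]
  have : y - 4 * x - c = 4 * -(x - (y / 4 - c / 4)) := by omega
  rw [this, Int.mul_dvd_mul_iff_left (by norm_num), Int.dvd_neg]

lemma emod_four_eq {n x y : ℤ} : ((y - 4 * x) % (4 * n)) % 4 = y % 4 := by
  rw [Int.emod_emod_of_dvd _ (Dvd.intro _ rfl)]
  omega

set_option maxHeartbeats 2000000 in
theorem k_two_mod_four_tiles_Z3 (k : ℕ) (hk : 0 < k) (h : k % 4 = 2) :
    TilesZd 3 (punctTile k 1 k) := by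
  obtain ⟨K, hK⟩ : ∃ K : ℤ, K = (k : ℤ) := ⟨_, rfl⟩
  have hK4 : K % 4 = 2 := by omega
  have hK2 : 2 ≤ K := by omega
  have hT : ∀ τ, τ ∈ punctTile k 1 k ↔ (0 ≤ τ ∧ τ < K) ∨ (K + 1 ≤ τ ∧ τ < 2 * K + 1) := by
    intro τ
    simp only [punctTile, Set.mem_ofPred_eq]
    omega
  -- residue of `y - 4x` modulo `4 (K+1)`
  let R : ℤ → ℤ → ℤ := fun x y => (y - 4 * x) % (4 * (K + 1))
  -- the three classes of points of the plane
  let A : ℤ → ℤ → Prop := fun x y => R x y = K ∨ R x y = 3 * K + 1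
  let B : ℤ → ℤ → Prop := fun x y => y % 4 < 2 ∧ (K + 1) ∣ x
  let C : ℤ → ℤ → Prop := fun x y => R x y = 4 * K + 2 ∨ R x y = 4 * K + 3
  -- row hole positions
  let HA : ℤ → ℤ := fun y => if y % 4 < 2 then 0 else if y % 4 = 2 then y / 4 - K / 4
    else y / 4 - (3 * K + 1) / 4
  let HC : ℤ → ℤ := fun y => if y % 4 < 2 then 0 else y / 4 - K
  -- the class which is missing in a given layer
  let m2 : ℤ → Prop := fun z => z % (3 * K) = 0 ∨ (K < z % (3 * K) ∧ z % (3 * K) < 2 * K)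
  let m1 : ℤ → Prop := fun z => (0 < z % (3 * K) ∧ z % (3 * K) < K) ∨ z % (3 * K) = 2 * K
  let m0 : ℤ → Prop := fun z => z % (3 * K) = K ∨ 2 * K < z % (3 * K)
  let gx : ℤ → ℤ → ℤ → Prop := fun x y z =>
    (m2 z ∧ 2 * (K + 1) ∣ x - HA y - 1) ∨ (m0 z ∧ 2 * (K + 1) ∣ x - HC y - 1)
  let gy : ℤ → ℤ → ℤ → Prop := fun x y z =>
    m1 z ∧ (4 * (K + 1) ∣ y - 4 * x ∨ 4 * (K + 1) ∣ y - 4 * x - (2 * K + 1))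
  let gz : ℤ → ℤ → ℤ → Prop := fun x y z =>
    (A x y ∧ 3 * K ∣ z) ∨ (B x y ∧ 3 * K ∣ z - K) ∨ (C x y ∧ 3 * K ∣ z - 2 * K)
  -- characterisations through residues
  have cx : ∀ x y z τ, τ ∈ punctTile k 1 k → (gx (x - τ) y z ↔
      (m2 z ∧ τ = (x - HA y - 1) % (2 * (K + 1))) ∨
      (m0 z ∧ τ = (x - HC y - 1) % (2 * (K + 1)))) := by
    intro x y z τ hτ
    rw [hT] at hτ
    have e1 : x - τ - HA y - 1 = (x - HA y - 1) - τ := by ring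
    have e2 : x - τ - HC y - 1 = (x - HC y - 1) - τ := by ring
    simp only [gx]
    rw [e1, e2, dvd_sub_iff_eq_emod (by omega) (by omega),
      dvd_sub_iff_eq_emod (by omega) (by omega)]
  have cy : ∀ x y z τ, τ ∈ punctTile k 1 k → (gy x (y - τ) z ↔
      m1 z ∧ (τ = R x y ∨ τ = (y - 4 * x - (2 * K + 1)) % (4 * (K + 1)))) := by
    intro x y z τ hτ
    rw [hT] at hτ
    have e1 : y - τ - 4 * x = (y - 4 * x) - τ := by ring
    have e2 : y - 4 * x - τ - (2 * K + 1) = (y - 4 * x - (2 * K + 1)) - τ := by ring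
    simp only [gy, R]
    rw [e1, e2, dvd_sub_iff_eq_emod (by omega) (by omega),
      dvd_sub_iff_eq_emod (by omega) (by omega)]
  have cz : ∀ x y z τ, τ ∈ punctTile k 1 k → (gz x y (z - τ) ↔
      (A x y ∧ τ = z % (3 * K)) ∨ (B x y ∧ τ = (z - K) % (3 * K)) ∨
      (C x y ∧ τ = (z - 2 * K) % (3 * K))) := by
    intro x y z τ hτ
    rw [hT] at hτ
    have e1 : z - τ - K = (z - K) - τ := by ring
    have e2 : z - τ - 2 * K = (z - 2 * K) - τ := by ring
    simp only [gz]
    rw [e1, e2, dvd_sub_iff_eq_emod (by omega) (by omega),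
      dvd_sub_iff_eq_emod (by omega) (by omega), dvd_sub_iff_eq_emod (by omega) (by omega)]
  -- the pointwise facts
  have fR : ∀ x y, 0 ≤ R x y ∧ R x y < 4 * (K + 1) ∧ R x y % 4 = y % 4 := fun x y =>
    ⟨Int.emod_nonneg _ (by omega), Int.emod_lt_of_pos _ (by omega), emod_four_eq⟩
  have fA : ∀ x y, (A x y ∨ B x y) ↔ (x - HA y - 1) % (2 * (K + 1)) = K ∨
      (x - HA y - 1) % (2 * (K + 1)) = 2 * K + 1 := by
    intro x y
    have e := dvd_iff_of_two_mul (n := K + 1) (a := x - HA y) (by omega)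
    have e1 : K + 1 - 1 = K := by ring
    have e2 : 2 * (K + 1) - 1 = 2 * K + 1 := by ring
    rw [e1, e2] at e
    rw [← e]
    obtain ⟨r0, r1, r2⟩ := fR x y
    by_cases hy : y % 4 < 2
    · have : HA y = 0 := by simp only [HA, hy, if_true]
      rw [this, sub_zero]
      simp only [A, B]
      constructor
      · rintro (h | h)
        · omega
        · exact h.2
      · intro h; exact Or.inr ⟨hy, h⟩
    · by_cases hy2 : y % 4 = 2
      · have : HA y = y / 4 - K / 4 := by simp [HA, hy2]
        rw [this, ← emod_four_iff (c := K) (by omega) (by omega) (by omega)]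
        change (A x y ∨ B x y) ↔ R x y = K
        simp only [A, B]
        omega
      · have : HA y = y / 4 - (3 * K + 1) / 4 := by simp only [HA, hy, hy2, if_false]
        rw [this, ← emod_four_iff (c := 3 * K + 1) (by omega) (by omega) (by omega)]
        change (A x y ∨ B x y) ↔ R x y = 3 * K + 1
        simp only [A, B]
        omega
  have fC : ∀ x y, (C x y ∨ B x y) ↔ (x - HC y - 1) % (2 * (K + 1)) = K ∨
      (x - HC y - 1) % (2 * (K + 1)) = 2 * K + 1 := by
    intro x y
    have e := dvd_iff_of_two_mul (n := K + 1) (a := x - HC y) (by omega)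
    have e1 : K + 1 - 1 = K := by ring
    have e2 : 2 * (K + 1) - 1 = 2 * K + 1 := by ring
    rw [e1, e2] at e
    rw [← e]
    obtain ⟨r0, r1, r2⟩ := fR x y
    by_cases hy : y % 4 < 2
    · have : HC y = 0 := by simp only [HC, hy, if_true]
      rw [this, sub_zero]
      simp only [C, B]
      constructor
      · rintro (h | h)
        · omega
        · exact h.2
      · intro h; exact Or.inr ⟨hy, h⟩
    · by_cases hy2 : y % 4 = 2
      · have : HC y = y / 4 - (4 * K + 2) / 4 := by simp only [HC, hy, if_false]; omega
        rw [this, ← emod_four_iff (c := 4 * K + 2) (by omega) (by omega) (by omega)]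
        change (C x y ∨ B x y) ↔ R x y = 4 * K + 2
        simp only [C, B]
        omega
      · have : HC y = y / 4 - (4 * K + 3) / 4 := by simp only [HC, hy, if_false]; omega
        rw [this, ← emod_four_iff (c := 4 * K + 3) (by omega) (by omega) (by omega)]
        change (C x y ∨ B x y) ↔ R x y = 4 * K + 3
        simp only [C, B]
        omega
  have fB : ∀ x y, B x y → y % 4 < 2 := fun x y h => h.1
  have main : ∀ x y z : ℤ, ∃ a b r r' u u1 u2 : ℤ,
      (∀ τ, τ ∈ punctTile k 1 k → (gx (x - τ) y z ↔ (m2 z ∧ τ = a) ∨ (m0 z ∧ τ = b))) ∧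
      (∀ τ, τ ∈ punctTile k 1 k → (gy x (y - τ) z ↔ m1 z ∧ (τ = r ∨ τ = r'))) ∧
      (∀ τ, τ ∈ punctTile k 1 k → (gz x y (z - τ) ↔
        (A x y ∧ τ = u) ∨ (B x y ∧ τ = u1) ∨ (C x y ∧ τ = u2))) ∧
      (0 ≤ a ∧ a < 2 * (K + 1)) ∧ (0 ≤ b ∧ b < 2 * (K + 1)) ∧ (0 ≤ r ∧ r < 4 * (K + 1)) ∧
      (0 ≤ u ∧ u < 3 * K) ∧
      (r' = r - (2 * K + 1) ∧ (2 * K + 1) ≤ r ∨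
        r' = r - (2 * K + 1) + 4 * (K + 1) ∧ r < 2 * K + 1) ∧
      (u1 = u - K ∧ K ≤ u ∨ u1 = u - K + 3 * K ∧ u < K) ∧
      (u2 = u - 2 * K ∧ 2 * K ≤ u ∨ u2 = u - 2 * K + 3 * K ∧ u < 2 * K) ∧
      (m2 z ↔ u = 0 ∨ (K < u ∧ u < 2 * K)) ∧ (m1 z ↔ (0 < u ∧ u < K) ∨ u = 2 * K) ∧
      (m0 z ↔ u = K ∨ 2 * K < u) ∧
      (A x y ↔ r = K ∨ r = 3 * K + 1) ∧ (C x y ↔ r = 4 * K + 2 ∨ r = 4 * K + 3) ∧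
      (B x y → r % 4 < 2) ∧
      ((A x y ∨ B x y) ↔ a = K ∨ a = 2 * K + 1) ∧ ((C x y ∨ B x y) ↔ b = K ∨ b = 2 * K + 1) := by
    intro x y z
    refine ⟨(x - HA y - 1) % (2 * (K + 1)), (x - HC y - 1) % (2 * (K + 1)), R x y,
      (y - 4 * x - (2 * K + 1)) % (4 * (K + 1)), z % (3 * K), (z - K) % (3 * K),
      (z - 2 * K) % (3 * K), cx x y z, cy x y z, cz x y z,
      ⟨Int.emod_nonneg _ (by omega), Int.emod_lt_of_pos _ (by omega)⟩,
      ⟨Int.emod_nonneg _ (by omega), Int.emod_lt_of_pos _ (by omega)⟩,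
      ⟨(fR x y).1, (fR x y).2.1⟩,
      ⟨Int.emod_nonneg _ (by omega), Int.emod_lt_of_pos _ (by omega)⟩,
      emod_shift (by omega) (by omega), emod_shift (by omega) (by omega),
      emod_shift (by omega) (by omega), Iff.rfl, Iff.rfl, Iff.rfl, Iff.rfl, Iff.rfl,
      ?_, fA x y, fC x y⟩
    intro hB
    rw [(fR x y).2.2]
    exact fB x y hB
  clear_value gx gy gz m0 m1 m2 A B C R HA HC
  clear cx cy cz fR fA fC fB
  apply tilesZ3_of_starts _ gx gy gz
  · intro x y z
    obtain ⟨a, b, r, r', u, u1, u2, hx, hy, hz, ha, hb, hr, hu, hr', hu1, hu2, h2, h1, h0,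
      hA, hC, hB, hAB, hCB⟩ := main x y z
    have hm : m2 z ∨ m0 z ∨ m1 z := by rw [h2, h1, h0]; omega
    rcases hm with hm | hm | hm
    · by_cases haT : a ∈ punctTile k 1 k
      · exact Or.inl ⟨a, haT, (hx a haT).2 (Or.inl ⟨hm, rfl⟩)⟩
      · rw [hT] at haT
        rw [h2] at hm
        right; right
        rcases hAB.2 (by clear hr' hr hu1 hu2 hm; omega) with p | p
        · have huT : u ∈ punctTile k 1 k := by
            rw [hT]; clear hr' hr hA hB hC hAB hCB h0 h1 h2; omega
          exact ⟨u, huT, (hz u huT).2 (Or.inl ⟨p, rfl⟩)⟩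
        · have huT : u1 ∈ punctTile k 1 k := by
            rw [hT]; clear hr' hr hA hB hC hAB hCB h0 h1 h2; omega
          exact ⟨u1, huT, (hz u1 huT).2 (Or.inr (Or.inl ⟨p, rfl⟩))⟩
    · by_cases hbT : b ∈ punctTile k 1 k
      · exact Or.inl ⟨b, hbT, (hx b hbT).2 (Or.inr ⟨hm, rfl⟩)⟩
      · rw [hT] at hbT
        rw [h0] at hm
        right; right
        rcases hCB.2 (by clear hr' hr hu1 hu2 hm; omega) with p | p
        · have huT : u2 ∈ punctTile k 1 k := by
            rw [hT]; clear hr' hr hA hB hC hAB hCB h0 h1 h2; omega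
          exact ⟨u2, huT, (hz u2 huT).2 (Or.inr (Or.inr ⟨p, rfl⟩))⟩
        · have huT : u1 ∈ punctTile k 1 k := by
            rw [hT]; clear hr' hr hA hB hC hAB hCB h0 h1 h2; omega
          exact ⟨u1, huT, (hz u1 huT).2 (Or.inr (Or.inl ⟨p, rfl⟩))⟩
    · right
      by_cases hrT : r ∈ punctTile k 1 k
      · exact Or.inl ⟨r, hrT, (hy r hrT).2 ⟨hm, Or.inl rfl⟩⟩
      · by_cases hrT' : r' ∈ punctTile k 1 k
        · exact Or.inl ⟨r', hrT', (hy r' hrT').2 ⟨hm, Or.inr rfl⟩⟩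
        · rw [hT] at hrT hrT'
          rw [h1] at hm
          right
          have hAC : A x y ∨ C x y := by
            rw [hA, hC]
            clear hm hu1 hu2 hAB hCB hB hA hC h0 h1 h2 ha hb hu
            rcases hr' with hr' | hr' <;> omega
          rcases hAC with p | p
          · have huT : u ∈ punctTile k 1 k := by
              rw [hT]; clear hrT hrT' hr' hr hA hB hC hAB hCB h0 h1 h2; omega
            exact ⟨u, huT, (hz u huT).2 (Or.inl ⟨p, rfl⟩)⟩
          · have huT : u2 ∈ punctTile k 1 k := by
              rw [hT]; clear hrT hrT' hr' hr hA hB hC hAB hCB h0 h1 h2; omega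
            exact ⟨u2, huT, (hz u2 huT).2 (Or.inr (Or.inr ⟨p, rfl⟩))⟩
  · intro x y z τ hτ σ hσ p1 p2
    obtain ⟨a, b, r, r', u, u1, u2, hx, hy, hz, ha, hb, hr, hu, hr', hu1, hu2, h2, h1, h0,
      hA, hC, hB, hAB, hCB⟩ := main x y z
    rw [hx τ hτ] at p1
    rw [hx σ hσ] at p2
    rw [hT] at hτ hσ
    rw [h2, h0] at p1 p2
    clear hAB hCB hA hB hC h0 h1 h2
    rcases p1 with p1 | p1 <;> rcases p2 with p2 | p2 <;> omega
  · intro x y z τ hτ σ hσ p1 p2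
    obtain ⟨a, b, r, r', u, u1, u2, hx, hy, hz, ha, hb, hr, hu, hr', hu1, hu2, h2, h1, h0,
      hA, hC, hB, hAB, hCB⟩ := main x y z
    rw [hy τ hτ] at p1
    rw [hy σ hσ] at p2
    rw [hT] at hτ hσ
    clear hAB hCB hA hB hC h0 h1 h2
    rcases p1 with ⟨-, p1 | p1⟩ <;> rcases p2 with ⟨-, p2 | p2⟩ <;> omega
  · intro x y z τ hτ σ hσ p1 p2
    obtain ⟨a, b, r, r', u, u1, u2, hx, hy, hz, ha, hb, hr, hu, hr', hu1, hu2, h2, h1, h0,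
      hA, hC, hB, hAB, hCB⟩ := main x y z
    rw [hz τ hτ] at p1
    rw [hz σ hσ] at p2
    rw [hT] at hτ hσ
    have nAC : A x y → ¬ C x y := by rw [hA, hC]; omega
    have nAB : A x y → ¬ B x y := by
      intro q q'
      have := hB q'
      rw [hA] at q
      omega
    have nCB : C x y → ¬ B x y := by
      intro q q'
      have := hB q'
      rw [hC] at q
      omega
    rcases p1 with ⟨q1, p1⟩ | ⟨q1, p1⟩ | ⟨q1, p1⟩ <;>
      rcases p2 with ⟨q2, p2⟩ | ⟨q2, p2⟩ | ⟨q2, p2⟩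
    · exact p1.trans p2.symm
    · exact absurd q2 (nAB q1)
    · exact absurd q2 (nAC q1)
    · exact absurd q1 (nAB q2)
    · exact p1.trans p2.symm
    · exact absurd q1 (nCB q2)
    · exact absurd q1 (nAC q2)
    · exact absurd q2 (nCB q1)
    · exact p1.trans p2.symm
  · intro x y z τ hτ σ hσ p1 p2
    obtain ⟨a, b, r, r', u, u1, u2, hx, hy, hz, ha, hb, hr, hu, hr', hu1, hu2, h2, h1, h0,
      hA, hC, hB, hAB, hCB⟩ := main x y z
    rw [hx τ hτ] at p1
    rw [hy σ hσ] at p2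
    rw [hT] at hτ hσ
    rw [h2, h0] at p1
    rw [h1] at p2
    clear hAB hCB hA hB hC h0 h1 h2
    obtain ⟨p2, -⟩ := p2
    rcases p1 with ⟨p1, -⟩ | ⟨p1, -⟩ <;> omega
  · intro x y z τ hτ σ hσ p1 p2
    obtain ⟨a, b, r, r', u, u1, u2, hx, hy, hz, ha, hb, hr, hu, hr', hu1, hu2, h2, h1, h0,
      hA, hC, hB, hAB, hCB⟩ := main x y z
    rw [hx τ hτ] at p1
    rw [hz σ hσ] at p2
    rw [hT] at hτ hσ
    rw [h2, h0] at p1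
    rcases p1 with ⟨p1, e1⟩ | ⟨p1, e1⟩
    · have nAB : ¬ (A x y ∨ B x y) := by rw [hAB]; omega
      rcases p2 with ⟨q2, e2⟩ | ⟨q2, e2⟩ | ⟨q2, e2⟩
      · exact nAB (Or.inl q2)
      · exact nAB (Or.inr q2)
      · clear hAB hCB hA hB hC h0 h1 h2
        omega
    · have nCB : ¬ (C x y ∨ B x y) := by rw [hCB]; omega
      rcases p2 with ⟨q2, e2⟩ | ⟨q2, e2⟩ | ⟨q2, e2⟩
      · clear hAB hCB hA hB hC h0 h1 h2
        omega
      · exact nCB (Or.inr q2)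
      · exact nCB (Or.inl q2)
  · intro x y z τ hτ σ hσ p1 p2
    obtain ⟨a, b, r, r', u, u1, u2, hx, hy, hz, ha, hb, hr, hu, hr', hu1, hu2, h2, h1, h0,
      hA, hC, hB, hAB, hCB⟩ := main x y z
    rw [hy τ hτ] at p1
    rw [hz σ hσ] at p2
    rw [hT] at hτ hσ
    rw [h1] at p1
    obtain ⟨p1, e1⟩ := p1
    rcases p2 with ⟨q2, e2⟩ | ⟨q2, e2⟩ | ⟨q2, e2⟩
    · rw [hA] at q2
      clear hAB hCB hA hB hC h0 h1 h2
      rcases e1 with e1 | e1 <;> omega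
    · clear hAB hCB hA hB hC h0 h1 h2
      omega
    · rw [hC] at q2
      clear hAB hCB hA hB hC h0 h1 h2
      rcases e1 with e1 | e1 <;> omega
end

section
/- If k and ℓ are positive integers such that k + ℓ is odd, then the punctured interval tile k(1)ℓ tiles ℤ^3. -/
namespace OddSumTiling

/-- Membership in the tile, over the integers. -/
def InT (k l x : ℤ) : Prop := (0 ≤ x ∧ x < k) ∨ (k + 1 ≤ x ∧ x < k + 1 + l)

/-- Location of the hole of parity `e` in the residue class `r` modulo `k + l`. -/
def H (k n r e : ℤ) : ℤ :=
  if r = 0 then e else if r = k then n - e else if e = 0 then 0 else n - 1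

/-- Step of the direction `i` under the projection to `ℤ`. -/
def stp (t : ℤ) (i : Fin 3) : ℤ := if i = 0 then 1 else if i = 1 then t else 2 * t

/-- Admissible starting points (projected to `ℤ`), for direction `i` and sign `ε`. -/
def Start (k t : ℤ) (i : Fin 3) (ε w : ℤ) : Prop :=
  (i = 0 ∧ ε = 1 ∧ ∃ Q, w = t * (2 * (t + 1) * Q)) ∨
  (i = 0 ∧ ε = -1 ∧ ∃ Q, w = k + t * ((t + 1) + 2 * (t + 1) * Q)) ∨
  (i = 1 ∧ ε = 1 ∧ ∃ r m, 1 ≤ r ∧ r < k ∧ w = r + t * ((t + 1) * m - k)) ∨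
  (i = 2 ∧ ε = 1 ∧ ∃ r e m, (r = 0 ∨ (k ≤ r ∧ r < t)) ∧ (e = 0 ∨ e = 1) ∧
    w = r + t * (H k (t + 1) r e - 2 * k + 2 * (t + 1) * m))

/-- The tile through the point `w`: direction, sign, and offset inside the tile. -/
def own (k t w : ℤ) : Fin 3 × ℤ × ℤ :=
  let r := w % t
  let c := (w / t) % (2 * (t + 1))
  if (c = 0 ∧ r ≠ k) ∨ (c = 1 ∧ r = 0) then (0, 1, r + t * c)
  else if (c = t + 1 ∧ 1 ≤ r ∧ r ≤ k) ∨ (c = t ∧ k ≤ r) then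
    (0, -1, k + t * (t + 1) - r - t * c)
  else if 1 ≤ r ∧ r < k then (1, 1, (w / t + k) % (t + 1))
  else (2, 1, ((w / t - H k (t + 1) r (c % 2)) / 2 + k) % (t + 1))

lemma divmod {t r P : ℤ} (h0 : 0 ≤ r) (h1 : r < t) :
    (r + t * P) / t = P ∧ (r + t * P) % t = r := by
  have ht : t ≠ 0 := by omega
  constructor
  · rw [Int.add_mul_ediv_left _ _ ht, Int.ediv_eq_zero_of_lt h0 h1, zero_add]
  · rw [Int.add_mul_emod_self_left, Int.emod_eq_of_lt h0 h1]

lemma own_eq {k t r P c M : ℤ} (h0 : 0 ≤ r) (h1 : r < t) (hP : P = c + 2 * (t + 1) * M)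
    (hc0 : 0 ≤ c) (hc1 : c < 2 * (t + 1)) :
    own k t (r + t * P) =
      if (c = 0 ∧ r ≠ k) ∨ (c = 1 ∧ r = 0) then (0, 1, r + t * c)
      else if (c = t + 1 ∧ 1 ≤ r ∧ r ≤ k) ∨ (c = t ∧ k ≤ r) then
        (0, -1, k + t * (t + 1) - r - t * c)
      else if 1 ≤ r ∧ r < k then (1, 1, (P + k) % (t + 1))
      else (2, 1, ((P - H k (t + 1) r (c % 2)) / 2 + k) % (t + 1)) := by
  have h2 : P % (2 * (t + 1)) = c := by rw [hP]; exact (divmod hc0 hc1).2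
  unfold own
  simp only [(divmod (P := P) h0 h1).1, (divmod (P := P) h0 h1).2, h2]

lemma small {n a j : ℤ} (h : a = n * j) (h1 : -n < a) (h2 : a < n) : a = 0 := by
  apply Int.eq_zero_of_abs_lt_dvd (m := n) ⟨j, h⟩
  rw [abs_lt]; exact ⟨h1, h2⟩

lemma uniq {k l : ℤ} (hk : 0 < k) (hl : 0 < l) (hodd : (k + l) % 2 = 1)
    {i : Fin 3} {ε x w : ℤ} (hx : InT k l x)
    (hs : Start k (k + l) i ε w) : own k (k + l) (w + ε * x * stp (k + l) i) = (i, ε, x) := by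
  obtain ⟨t, ht⟩ : ∃ t, t = k + l := ⟨_, rfl⟩
  rw [← ht] at hs hodd ⊢
  have hx0 : 0 ≤ x := by rcases hx with h | h <;> omega
  have hxt : x ≤ t := by rcases hx with h | h <;> omega
  have hxk : x ≠ k := by rcases hx with h | h <;> omega
  rcases hs with ⟨rfl, rfl, Q, hQ⟩ | ⟨rfl, rfl, Q, hQ⟩ | ⟨rfl, rfl, r, m, hr1, hrk, hw⟩ |
    ⟨rfl, rfl, r, e, m, hr, he, hw⟩
  · by_cases hlt : x < t
    · have e1 : w + 1 * x * stp t 0 = x + t * (0 + 2 * (t + 1) * Q) := by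
        rw [hQ]; simp [stp]; ring
      rw [e1, own_eq hx0 hlt rfl le_rfl (by omega)]
      simp [hxk]
    · have hxe : x = t := by omega
      have e1 : w + 1 * x * stp t 0 = 0 + t * (1 + 2 * (t + 1) * Q) := by
        rw [hQ, hxe]; simp [stp]; ring
      rw [e1, own_eq le_rfl (by omega) rfl (by omega) (by omega)]
      simp [hxe]
  · by_cases hlt : x < k
    · have e1 : w + -1 * x * stp t 0 = (k - x) + t * ((t + 1) + 2 * (t + 1) * Q) := by
        rw [hQ]; simp [stp]; ring
      rw [e1, own_eq (by omega) (by omega) rfl (by omega) (by omega), if_neg (by omega),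
        if_pos (by omega)]
      congr 2; ring
    · have e1 : w + -1 * x * stp t 0 = (k - x + t) + t * (t + 2 * (t + 1) * Q) := by
        rw [hQ]; simp [stp]; ring
      rw [e1, own_eq (by omega) (by omega) rfl (by omega) (by omega), if_neg (by omega),
        if_pos (by omega)]
      congr 2; ring
  · obtain ⟨P, hP⟩ : ∃ P, P = (t + 1) * m - k + x := ⟨_, rfl⟩
    have e1 : w + 1 * x * stp t 1 = r + t * P := by
      rw [hw, hP]; simp [stp]; ring
    have hPc : P = P % (2 * (t + 1)) + 2 * (t + 1) * (P / (2 * (t + 1))) :=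
      (Int.emod_add_mul_ediv _ _).symm
    have hc0 := Int.emod_nonneg P (show 2 * (t + 1) ≠ 0 by omega)
    have hc1 := Int.emod_lt_of_pos P (show 0 < 2 * (t + 1) by omega)
    generalize P % (2 * (t + 1)) = c at *
    generalize P / (2 * (t + 1)) = M at *
    rw [e1, own_eq (by omega) (by omega) hPc hc0 hc1]
    have n1 : c ≠ 0 := by
      intro h
      have : x - k = (t + 1) * (2 * M - m) := by linear_combination hP.symm.trans hPc + h
      have := small this (by omega) (by omega)
      omega
    have n2 : c ≠ t + 1 := by
      intro h
      have : x - k = (t + 1) * (1 + 2 * M - m) := by linear_combination hP.symm.trans hPc + h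
      have := small this (by omega) (by omega)
      omega
    rw [if_neg (by omega), if_neg (by omega), if_pos (by omega)]
    have : P + k = x + (t + 1) * m := by rw [hP]; ring
    rw [this, (divmod hx0 (by omega)).2]
  · obtain ⟨h, hh⟩ : ∃ h, h = H k (t + 1) r e := ⟨_, rfl⟩
    obtain ⟨P, hP⟩ : ∃ P, P = h + 2 * (x - k + (t + 1) * m) := ⟨_, rfl⟩
    have e1 : w + 1 * x * stp t 2 = r + t * P := by
      rw [hw, hP, ← hh]; simp [stp]; ring
    have hPc : P = P % (2 * (t + 1)) + 2 * (t + 1) * (P / (2 * (t + 1))) :=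
      (Int.emod_add_mul_ediv _ _).symm
    have hc0 := Int.emod_nonneg P (show 2 * (t + 1) ≠ 0 by omega)
    have hc1 := Int.emod_lt_of_pos P (show 0 < 2 * (t + 1) by omega)
    generalize P % (2 * (t + 1)) = c at *
    generalize P / (2 * (t + 1)) = M at *
    rw [e1, own_eq (by omega) (by omega) hPc hc0 hc1]
    have hpar : h % 2 = e := by
      rw [hh]; unfold H; split_ifs <;> omega
    have hcpar : c % 2 = e := by
      have : c = h + 2 * (x - k + (t + 1) * m - (t + 1) * M) := by
        linear_combination hP - hPc
      omega
    have hne : c ≠ h := by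
      intro h'
      have : x - k = (t + 1) * (M - m) := by
        have : 2 * (x - k) = 2 * ((t + 1) * (M - m)) := by linear_combination hPc - hP + h'
        omega
      have := small this (by omega) (by omega)
      omega
    have hh' := hh
    unfold H at hh'
    rw [if_neg (by split_ifs at hh' <;> omega), if_neg (by split_ifs at hh' <;> omega),
      if_neg (by omega), hcpar, ← hh]
    have : (P - h) / 2 + k = x + (t + 1) * m := by
      have : P - h = 2 * (x - k + (t + 1) * m) := by rw [hP]; ring
      rw [this]; omega
    rw [this, (divmod hx0 (by omega)).2]

lemma exist {k l : ℤ} (hk : 0 < k) (hl : 0 < l) (hodd : (k + l) % 2 = 1) (w : ℤ) :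
    ∃ (i : Fin 3) (ε x : ℤ), (ε = 1 ∨ ε = -1) ∧ InT k l x ∧
      Start k (k + l) i ε (w - ε * x * stp (k + l) i) := by
  obtain ⟨t, ht⟩ : ∃ t, t = k + l := ⟨_, rfl⟩
  rw [← ht] at hodd ⊢
  obtain ⟨r, P, h0, h1, rfl⟩ : ∃ r P, 0 ≤ r ∧ r < t ∧ w = r + t * P :=
    ⟨w % t, w / t, Int.emod_nonneg _ (by omega), Int.emod_lt_of_pos _ (by omega),
      (Int.emod_add_mul_ediv _ _).symm⟩
  obtain ⟨c, M, hc0, hc1, hP⟩ : ∃ c M, 0 ≤ c ∧ c < 2 * (t + 1) ∧ P = c + 2 * (t + 1) * M :=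
    ⟨P % (2 * (t + 1)), P / (2 * (t + 1)), Int.emod_nonneg _ (by omega),
      Int.emod_lt_of_pos _ (by omega), (Int.emod_add_mul_ediv _ _).symm⟩
  by_cases a1 : c = 0 ∧ r ≠ k
  · refine ⟨0, 1, r, Or.inl rfl, by unfold InT; omega, Or.inl ⟨rfl, rfl, M, ?_⟩⟩
    rw [hP, a1.1]; simp [stp]
  by_cases a2 : c = 1 ∧ r = 0
  · refine ⟨0, 1, t, Or.inl rfl, by unfold InT; omega, Or.inl ⟨rfl, rfl, M, ?_⟩⟩
    rw [hP, a2.1, a2.2]; simp [stp]; ring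
  by_cases b1 : c = t + 1 ∧ 1 ≤ r ∧ r ≤ k
  · refine ⟨0, -1, k - r, Or.inr rfl, by unfold InT; omega, Or.inr (Or.inl ⟨rfl, rfl, M, ?_⟩)⟩
    rw [hP, b1.1]; simp [stp]; ring
  by_cases b2 : c = t ∧ k ≤ r
  · refine ⟨0, -1, k - r + t, Or.inr rfl, by unfold InT; omega,
      Or.inr (Or.inl ⟨rfl, rfl, M, ?_⟩)⟩
    rw [hP, b2.1]; simp [stp]; ring
  by_cases hr : 1 ≤ r ∧ r < k
  · obtain ⟨x, m, hx0, hx1, hx⟩ : ∃ x m, 0 ≤ x ∧ x < t + 1 ∧ P + k = x + (t + 1) * m :=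
      ⟨(P + k) % (t + 1), (P + k) / (t + 1), Int.emod_nonneg _ (by omega),
        Int.emod_lt_of_pos _ (by omega), (Int.emod_add_mul_ediv _ _).symm⟩
    have hxk : x ≠ k := by
      rintro rfl
      have hd : c = (t + 1) * (m - 2 * M) := by linear_combination hx - hP
      by_cases hc : c < t + 1
      · have := small hd (by omega) hc
        omega
      · have hd' : c - (t + 1) = (t + 1) * (m - 2 * M - 1) := by linear_combination hd
        have := small hd' (by omega) (by omega)
        omega
    refine ⟨1, 1, x, Or.inl rfl, by unfold InT; omega,
      Or.inr (Or.inr (Or.inl ⟨rfl, rfl, r, m, hr.1, hr.2, ?_⟩))⟩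
    simp [stp]; linear_combination t * hx
  · obtain ⟨h, hh⟩ : ∃ h, h = H k (t + 1) r (c % 2) := ⟨_, rfl⟩
    have hpar : h % 2 = c % 2 := by
      rw [hh]; unfold H; split_ifs <;> omega
    have hne : c ≠ h := by
      unfold H at hh
      split_ifs at hh <;> omega
    have hb : 0 ≤ h ∧ h ≤ t + 1 := by
      unfold H at hh
      split_ifs at hh <;> omega
    obtain ⟨d, hd⟩ : ∃ d, c = h + 2 * d := ⟨(c - h) / 2, by omega⟩
    obtain ⟨x, m, hx0, hx1, hx⟩ : ∃ x m, 0 ≤ x ∧ x < t + 1 ∧ d + k = x + (t + 1) * m :=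
      ⟨(d + k) % (t + 1), (d + k) / (t + 1), Int.emod_nonneg _ (by omega),
        Int.emod_lt_of_pos _ (by omega), (Int.emod_add_mul_ediv _ _).symm⟩
    have hxk : x ≠ k := by
      rintro rfl
      have hd' : d = (t + 1) * m := by linear_combination hx
      have := small hd' (by omega) (by omega)
      omega
    refine ⟨2, 1, x, Or.inl rfl, by unfold InT; omega,
      Or.inr (Or.inr (Or.inr ⟨rfl, rfl, r, c % 2, m + M, by omega, by omega, ?_⟩))⟩
    rw [← hh, hP, hd]
    simp [stp]; linear_combination 2 * t * hx

/-- Projection of `ℤ^3` to `ℤ`. -/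
def prj (t : ℤ) (p : Fin 3 → ℤ) : ℤ := p 0 + t * p 1 + 2 * t * p 2

lemma prj_move (t : ℤ) (v : Fin 3 → ℤ) (i : Fin 3) (a : ℤ) :
    prj t (fun j => v j + if j = i then a else 0) = prj t v + a * stp t i := by
  fin_cases i <;> simp [prj, stp] <;> ring

lemma inT_iff (k l : ℕ) (x : ℤ) : x ∈ punctTile k 1 l ↔ InT k l x := by
  simp [punctTile, InT]

end OddSumTiling

open OddSumTiling in
/-- If `k + ℓ` is odd, then `k(1)ℓ` tiles `ℤ^3`. -/
theorem odd_sum_tiles_Z3 (k l : ℕ) (hk : 0 < k) (hl : 0 < l) (h : Odd (k + l)) :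
    TilesZd 3 (punctTile k 1 l) := by
  have hk' : (0 : ℤ) < k := by exact_mod_cast hk
  have hl' : (0 : ℤ) < l := by exact_mod_cast hl
  have ho : ((k : ℤ) + l) % 2 = 1 := by
    obtain ⟨m, hm⟩ := h
    omega
  refine ⟨{P | ∃ (v : Fin 3 → ℤ) (i : Fin 3) (ε : ℤ), (ε = 1 ∨ ε = -1) ∧
    Start k (k + l) i ε (prj (k + l) v) ∧
    P = (fun x : ℤ => fun j : Fin 3 => v j + if j = i then ε * x else 0) ''
      punctTile k 1 l}, ?_, ?_, ?_⟩
  · rintro P ⟨v, i, ε, hε, -, rfl⟩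
    exact ⟨v, i, ε, hε, rfl⟩
  · rintro P ⟨v, i, ε, hε, hs, rfl⟩ P' ⟨v', i', ε', hε', hs', rfl⟩ hne
    rw [Set.disjoint_left]
    rintro p ⟨x, hx, rfl⟩ ⟨x', hx', hp⟩
    apply hne
    have u := uniq hk' hl' ho ((inT_iff k l x).1 hx) hs
    have u' := uniq hk' hl' ho ((inT_iff k l x').1 hx') hs'
    rw [← prj_move] at u u'
    dsimp only at hp
    rw [hp, u] at u'
    simp only [Prod.mk.injEq] at u'
    obtain ⟨rfl, rfl, rfl⟩ := u'
    have : v = v' := by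
      funext j
      have := congrFun hp j
      linarith
    rw [this]
  · rw [Set.eq_univ_iff_forall]
    intro p
    obtain ⟨i, ε, x, hε, hx, hs⟩ := exist hk' hl' ho (prj (k + l) p)
    refine ⟨_, ⟨fun j => p j + if j = i then -(ε * x) else 0, i, ε, hε, ?_, rfl⟩,
      x, (inT_iff k l x).2 hx, ?_⟩
    · rw [prj_move]
      convert hs using 1
      ring
    · funext j
      dsimp only
      split_ifs <;> ring
end

section
/- If k and ℓ are both odd positive integers, then the punctured interval tile k(1)ℓ tiles ℤ^3. -/
/-- A one-dimensional set is partitioned into copies of `T`, recorded by the start and orientation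
of the copy through each of its points. -/
def Tl (T E : Set ℤ) : Prop :=
  ∃ s ε : ℤ → ℤ, (∀ t, ε t = 1 ∨ ε t = -1) ∧ ∀ t ∈ E, (∃ u ∈ T, t = s t + ε t * u) ∧
    ∀ u ∈ T, s t + ε t * u ∈ E ∧ s (s t + ε t * u) = s t ∧ ε (s t + ε t * u) = ε t

theorem Tl_empty (T E : Set ℤ) (h : ∀ t, t ∉ E) : Tl T E :=
  ⟨fun _ => 0, fun _ => 1, fun _ => Or.inl rfl, fun t ht => absurd ht (h t)⟩

theorem tiles_of_dir (T : Set ℤ) (dir : (Fin 3 → ℤ) → Fin 3)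
    (h : ∀ i p, Tl T {t | dir (Function.update p i t) = i}) : TilesZd 3 T := by
  choose s ε hε hs using h
  let b : (Fin 3 → ℤ) → (Fin 3 → ℤ) := fun p => Function.update p (dir p) 0
  let S : (Fin 3 → ℤ) → ℤ := fun p => s (dir p) (b p) (p (dir p))
  let e : (Fin 3 → ℤ) → ℤ := fun p => ε (dir p) (b p) (p (dir p))
  let pt : (Fin 3 → ℤ) → ℤ → (Fin 3 → ℤ) :=
    fun p u => Function.update p (dir p) (S p + e p * u)
  have key : ∀ p, (∃ u ∈ T, p = pt p u) ∧
      ∀ u ∈ T, dir (pt p u) = dir p ∧ S (pt p u) = S p ∧ e (pt p u) = e p := by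
    intro p
    have hm : p (dir p) ∈ {t | dir (Function.update (b p) (dir p) t) = dir p} := by
      simp [b]
    obtain ⟨⟨u, hu, hu2⟩, h2⟩ := hs (dir p) (b p) _ hm
    refine ⟨⟨u, hu, ?_⟩, ?_⟩
    · change p = Function.update p (dir p) (s (dir p) (b p) (p (dir p)) + ε (dir p) (b p) (p (dir p)) * u)
      rw [← hu2]; simp
    · intro u hu
      obtain ⟨h3, h4, h5⟩ := h2 u hu
      have hd : dir (pt p u) = dir p := by
        simpa [b, pt, S, e] using h3
      have hb : b (pt p u) = b p := by
        simp only [b, hd]; simp [pt]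
      have hc : (pt p u) (dir p) = S p + e p * u := by simp [pt]
      refine ⟨hd, ?_, ?_⟩
      · change s (dir (pt p u)) (b (pt p u)) (pt p u (dir (pt p u))) = _
        rw [hb, hd, hc]; exact h4
      · change ε (dir (pt p u)) (b (pt p u)) (pt p u (dir (pt p u))) = _
        rw [hb, hd, hc]; exact h5
  have same : ∀ p, ∀ u ∈ T, pt (pt p u) = pt p := by
    intro p u hu
    obtain ⟨h1, h2, h3⟩ := (key p).2 u hu
    funext w
    change Function.update (pt p u) (dir (pt p u)) (S (pt p u) + e (pt p u) * w) = _
    rw [h1, h2, h3]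
    simp [pt]
  refine ⟨Set.range fun p => pt p '' T, ?_, ?_, ?_⟩
  · rintro _ ⟨p, rfl⟩
    refine ⟨Function.update p (dir p) (S p), dir p, e p, hε _ _ _, ?_⟩
    refine Set.image_congr fun u _ => ?_
    funext j
    by_cases hj : j = dir p
    · subst hj; simp [pt]
    · simp [pt, hj]
  · rintro _ ⟨p, rfl⟩ _ ⟨q, rfl⟩ hne
    rw [Set.disjoint_left]
    rintro _ ⟨u, hu, rfl⟩ ⟨w, hw, hw2⟩
    apply hne
    have h1 := same p u hu
    have h2 := same q w hw
    change pt p '' T = pt q '' T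
    rw [← h1, ← h2, hw2]
  · rw [Set.eq_univ_iff_forall]
    intro p
    obtain ⟨u, hu, h1⟩ := (key p).1
    exact ⟨_, ⟨p, rfl⟩, u, hu, h1.symm⟩

theorem emod_of (n z r q : ℤ) (h0 : 0 ≤ r) (h1 : r < n) (h : z = r + n * q) : z % n = r := by
  subst h
  rw [Int.add_mul_emod_self_left, Int.emod_eq_of_lt h0 h1]

theorem emod_form (n z : ℤ) (hn : 0 < n) : ∃ r q, 0 ≤ r ∧ r < n ∧ z = r + n * q :=
  ⟨z % n, z / n, Int.emod_nonneg _ hn.ne', Int.emod_lt_of_pos _ hn, (Int.emod_add_mul_ediv z n).symm⟩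

/-- Hole positions of a string. -/
def Dh (k l : ℕ) (t : ℤ) : Prop :=
  t % ((k : ℤ) + l + 2) = 0 ∨ t % ((k : ℤ) + l + 2) = k + 1

theorem Tl_string (k l : ℕ) (a : ℤ) : Tl (punctTile k 1 l) {t | ¬ Dh k l (t + a)} := by
  refine ⟨fun t => t - (t + a) % ((k : ℤ) + l + 2) + 1, fun _ => 1, fun _ => Or.inl rfl, ?_⟩
  intro t ht
  obtain ⟨r, q, h0, h1, h⟩ := emod_form ((k : ℤ) + l + 2) (t + a) (by omega)
  simp only [Set.mem_ofPred_eq, Dh, punctTile, one_mul] at ht ⊢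
  have hr := emod_of _ _ _ _ h0 h1 h
  rw [hr] at ht ⊢
  refine ⟨⟨r - 1, by push_cast; omega, by ring⟩, ?_⟩
  intro u hu
  have hr2 : (t - r + 1 + u + a) % ((k : ℤ) + l + 2) = u + 1 :=
    emod_of _ _ _ q (by push_cast at hu; omega) (by push_cast at hu; omega) (by linarith)
  rw [hr2]
  push_cast at hu
  refine ⟨by omega, by omega, trivial⟩

/-- Active levels. -/
def Act (k l : ℕ) (r : ℤ) : Prop :=
  ((0 ≤ r ∧ r < k) ∨ ((k : ℤ) + 1 ≤ r ∧ r < k + l + 1)) ∨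
  ((2 * (k : ℤ) + l ≤ r ∧ r < 2 * k + 2 * l) ∨ (2 * (k : ℤ) + 2 * l + 1 ≤ r ∧ r < 3 * k + 2 * l + 1))

theorem Tl_act (k l : ℕ) (hk : 0 < k) (hl : 0 < l) (a : ℤ) :
    Tl (punctTile k 1 l) {t | Act k l ((t + a) % (3 * ((k : ℤ) + l)))} := by
  refine ⟨fun t => if (t + a) % (3 * ((k : ℤ) + l)) < k + l + 1
      then t - (t + a) % (3 * ((k : ℤ) + l))
      else t - (t + a) % (3 * ((k : ℤ) + l)) + (3 * k + 2 * l),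
    fun t => if (t + a) % (3 * ((k : ℤ) + l)) < k + l + 1 then 1 else -1,
    fun t => by dsimp only; split_ifs <;> simp, ?_⟩
  intro t ht
  obtain ⟨r, q, h0, h1, h⟩ := emod_form (3 * ((k : ℤ) + l)) (t + a) (by omega)
  have hr := emod_of _ _ _ _ h0 h1 h
  simp only [Set.mem_ofPred_eq, Act, punctTile] at ht ⊢
  simp only [hr] at ht ⊢
  by_cases hc : r < k + l + 1
  · simp only [hc, if_true, one_mul]
    refine ⟨⟨r, by push_cast; omega, by ring⟩, ?_⟩
    intro u hu
    push_cast at hu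
    have hr2 : (t - r + u + a) % (3 * ((k : ℤ) + l)) = u :=
      emod_of _ _ _ q (by omega) (by omega) (by linarith)
    simp only [hr2]
    have : u < k + l + 1 := by omega
    simp only [if_pos this]
    refine ⟨by omega, by omega, trivial⟩
  · simp only [hc, if_false]
    refine ⟨⟨3 * k + 2 * l - r, by push_cast; omega, by ring⟩, ?_⟩
    intro u hu
    push_cast at hu
    have hr2 : (t - r + (3 * k + 2 * l) + -1 * u + a) % (3 * ((k : ℤ) + l)) = 3 * k + 2 * l - u :=
      emod_of _ _ _ q (by omega) (by omega) (by linarith)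
    simp only [hr2]
    have : ¬ (3 * (k : ℤ) + 2 * l - u < k + l + 1) := by omega
    simp only [if_neg this]
    refine ⟨by omega, by omega, trivial⟩

/-- At every level exactly two of the three classes are active. -/
theorem act_two (k l : ℕ) (hk : 0 < k) (hl : 0 < l) (z : ℤ) (A : ℤ → Prop)
    (hA : A = fun a => Act k l ((z + a) % (3 * ((k : ℤ) + l)))) :
    (A 0 ∧ A (k + l) ∧ ¬ A (2 * (k + l))) ∨ (A 0 ∧ ¬ A (k + l) ∧ A (2 * (k + l))) ∨
      (¬ A 0 ∧ A (k + l) ∧ A (2 * (k + l))) := by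
  obtain ⟨r, q, h0, h1, h⟩ := emod_form (3 * ((k : ℤ) + l)) z (by omega)
  have e0 : (z + 0) % (3 * ((k : ℤ) + l)) = r := emod_of _ _ _ q h0 h1 (by linarith)
  have e1 : (r < 2 * (k + l) ∧ (z + (k + l)) % (3 * ((k : ℤ) + l)) = r + (k + l)) ∨
      (2 * (k + l) ≤ r ∧ (z + (k + l)) % (3 * ((k : ℤ) + l)) = r - 2 * (k + l)) := by
    by_cases hc : r < 2 * (k + l)
    · exact Or.inl ⟨hc, emod_of _ _ _ q (by omega) (by omega) (by linarith)⟩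
    · exact Or.inr ⟨by omega, emod_of _ _ _ (q + 1) (by omega) (by omega) (by linarith)⟩
  have e2 : (r < (k + l) ∧ (z + 2 * (k + l)) % (3 * ((k : ℤ) + l)) = r + 2 * (k + l)) ∨
      ((k + l) ≤ r ∧ (z + 2 * (k + l)) % (3 * ((k : ℤ) + l)) = r - (k + l)) := by
    by_cases hc : r < (k + l)
    · exact Or.inl ⟨hc, emod_of _ _ _ q (by omega) (by omega) (by linarith)⟩
    · exact Or.inr ⟨by omega, emod_of _ _ _ (q + 1) (by omega) (by omega) (by linarith)⟩
  subst hA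
  simp only [e0]
  rcases e1 with ⟨g1, e1⟩ | ⟨g1, e1⟩ <;> rcases e2 with ⟨g2, e2⟩ | ⟨g2, e2⟩ <;>
    rw [e1, e2] <;> simp only [Act] <;> omega

theorem Dh_even (k l : ℕ) (hok : Odd k) (hol : Odd l) (t : ℤ) (h : Dh k l t) : t % 2 = 0 := by
  obtain ⟨a, rfl⟩ := hok
  obtain ⟨b, rfl⟩ := hol
  obtain ⟨r, q, h0, h1, h2⟩ := emod_form (((2 * a + 1 : ℕ) : ℤ) + (2 * b + 1 : ℕ) + 2) t (by omega)
  have hr := emod_of _ _ _ _ h0 h1 h2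
  rw [Dh, hr] at h
  have h3 : t = r + 2 * ((a + b + 2) * q) := by rw [h2]; push_cast; ring
  push_cast at h
  omega

/-- The three classes of columns. -/
def Pc (k l : ℕ) (j : ℕ) (x y : ℤ) : Prop :=
  if j = 0 then y % 2 = 0 ∧ Dh k l (x + y)
  else if j = 1 then y % 2 = 0 ∧ Dh k l (x + y + -1)
  else y % 2 = 1 ∧ Dh k l (x + y + -1)

/-- If `k` and `ℓ` are both odd, then `k(1)ℓ` tiles `ℤ^3`. -/
theorem both_odd_tiles_Z3 (k l : ℕ) (hk : 0 < k) (hl : 0 < l)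
    (hok : Odd k) (hol : Odd l) :
    TilesZd 3 (punctTile k 1 l) := by
  classical
  let A : ℤ → ℤ → Prop := fun z a => Act k l ((z + a) % (3 * ((k : ℤ) + l)))
  let B0 : ℤ → Prop := fun z => A z 0
  let B1 : ℤ → Prop := fun z => A z (k + l)
  let B2 : ℤ → Prop := fun z => A z (2 * (k + l))
  have hB : ∀ z, (B0 z ∧ B1 z ∧ ¬ B2 z) ∨ (B0 z ∧ ¬ B1 z ∧ B2 z) ∨ (¬ B0 z ∧ B1 z ∧ B2 z) :=
    fun z => act_two k l hk hl z (A z) rfl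
  have hT0 : Tl (punctTile k 1 l) {t | B0 t} := Tl_act k l hk hl _
  have hT1 : Tl (punctTile k 1 l) {t | B1 t} := Tl_act k l hk hl _
  have hT2 : Tl (punctTile k 1 l) {t | B2 t} := Tl_act k l hk hl _
  clear_value B0 B1 B2
  let H : ℤ → ℤ → ℤ → Prop := fun x y z =>
    (Pc k l 0 x y ∧ B0 z) ∨ (Pc k l 1 x y ∧ B1 z) ∨ (Pc k l 2 x y ∧ B2 z)
  let dir : (Fin 3 → ℤ) → Fin 3 := fun p =>
    if H (p 0) (p 1) (p 2) then 2 else if B2 (p 2) then 0 else 1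
  have hE := Dh_even k l hok hol
  apply tiles_of_dir _ dir
  intro i p
  generalize hx : p 0 = x
  generalize hy : p 1 = y
  generalize hz : p 2 = z
  fin_cases i
  · -- rows
    have e : {t | dir (Function.update p 0 t) = 0} = {t | ¬ H t y z ∧ B2 z} := by
      ext t
      simp only [dir, Set.mem_ofPred_eq, Function.update_self, Function.update_of_ne, ne_eq,
        Fin.reduceEq, not_false_eq_true, hy, hz, one_ne_zero]
      split_ifs <;> simp_all
    change Tl _ {t | dir (Function.update p 0 t) = 0}
    rw [e]
    by_cases hb : B2 z
    · by_cases hy2 : y % 2 = 0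
      · rcases hB z with h | h | h
        · tauto
        · convert Tl_string k l y using 3 with t
          simp only [H, Pc]; simp [h, hy2]
        · convert Tl_string k l (y + -1) using 3 with t
          simp only [H, Pc]; simp [h, hy2, add_assoc]
      · have hy3 : y % 2 = 1 := by omega
        convert Tl_string k l (y + -1) using 3 with t
        simp only [H, Pc]; simp [hb, hy3, add_assoc]
    · exact Tl_empty _ _ fun t ht => hb ht.2
  · -- columns
    have e : {t | dir (Function.update p 1 t) = 1} = {t | ¬ H x t z ∧ ¬ B2 z} := by
      ext t
      simp only [dir, Set.mem_ofPred_eq, Function.update_self, Function.update_of_ne, ne_eq,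
        Fin.reduceEq, not_false_eq_true, hx, hz, zero_ne_one]
      split_ifs <;> simp_all
    change Tl _ {t | dir (Function.update p 1 t) = 1}
    rw [e]
    by_cases hb : B2 z
    · exact Tl_empty _ _ fun t ht => ht.2 hb
    · have h0 : B0 z ∧ B1 z := by have := hB z; tauto
      by_cases hx2 : x % 2 = 0
      · have e2 : {t | ¬ H x t z ∧ ¬ B2 z} = {t | ¬ Dh k l (t + x)} := by
          ext t
          have h1 := hE (x + t)
          have h2 := hE (x + t + -1)
          simp only [H, Pc, Set.mem_ofPred_eq, add_comm t x]
          simp only [h0, hb, if_true, and_true, and_false, or_false, not_false_eq_true,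
            one_ne_zero, if_false]
          by_cases ht : t % 2 = 0
          · have : ¬ Dh k l (x + t + -1) := fun h => by have := h2 h; omega
            simp [ht, this]
          · have : ¬ Dh k l (x + t) := fun h => by have := h1 h; omega
            simp [ht, this]
        rw [e2]; exact Tl_string k l x
      · have e2 : {t | ¬ H x t z ∧ ¬ B2 z} = {t | ¬ Dh k l (t + (x + -1))} := by
          ext t
          have h1 := hE (x + t)
          have h2 := hE (x + t + -1)
          have h3 : t + (x + -1) = x + t + -1 := by ring
          simp only [H, Pc, Set.mem_ofPred_eq, h3]
          simp only [h0, hb, if_true, and_true, and_false, or_false, not_false_eq_true,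
            one_ne_zero, if_false]
          by_cases ht : t % 2 = 0
          · have : ¬ Dh k l (x + t) := fun h => by have := h1 h; omega
            simp [ht, this]
          · have : ¬ Dh k l (x + t + -1) := fun h => by have := h2 h; omega
            simp [ht, this]
        rw [e2]; exact Tl_string k l _
  · -- vertical lines
    have e : {t | dir (Function.update p 2 t) = 2} = {t | H x y t} := by
      ext t
      simp only [dir, Set.mem_ofPred_eq, Function.update_self, Function.update_of_ne, ne_eq,
        Fin.reduceEq, not_false_eq_true, hx, hy]
      split_ifs <;> simp_all
    change Tl _ {t | dir (Function.update p 2 t) = 2}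
    rw [e]
    have h1 := hE (x + y)
    have h2 := hE (x + y + -1)
    by_cases d0 : Dh k l (x + y)
    · have d1 : ¬ Dh k l (x + y + -1) := fun h => by have := h1 d0; have := h2 h; omega
      by_cases hy2 : y % 2 = 0
      · convert hT0 using 3 with t
        simp only [H, Pc]; simp [d0, d1, hy2]
      · apply Tl_empty
        intro t
        simp only [H, Pc, Set.mem_ofPred_eq]; simp [d1, hy2]
    · by_cases d1 : Dh k l (x + y + -1)
      · by_cases hy2 : y % 2 = 0
        · convert hT1 using 3 with t
          simp only [H, Pc]; simp [d0, d1, hy2]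
        · have hy3 : y % 2 = 1 := by omega
          convert hT2 using 3 with t
          simp only [H, Pc]; simp [d0, d1, hy3]
      · apply Tl_empty
        intro t
        simp only [H, Pc, Set.mem_ofPred_eq]; simp [d0, d1]
end

section
/- If k and ℓ are positive integers with k ≡ 2 (mod 4) and 4 ∣ ℓ (or with the roles of k and ℓ exchanged), then the punctured interval tile k(1)ℓ tiles ℤ^3. -/
/-- `T` tiles the subset `S` of the line; `f x` records the tile that covers `x`. -/
def LineTiles (T S : Set ℤ) : Prop :=
  ∃ f : ℤ → ℤ × ℤ, ∀ x ∈ S, ((f x).2 = 1 ∨ (f x).2 = -1) ∧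
    (∃ t ∈ T, x = (f x).1 + (f x).2 * t) ∧
    ∀ t ∈ T, (f x).1 + (f x).2 * t ∈ S ∧ f ((f x).1 + (f x).2 * t) = f x

theorem LineTiles.empty (T : Set ℤ) : LineTiles T ∅ :=
  ⟨fun _ => (0, 1), fun x hx => absurd hx (Set.notMem_empty x)⟩

/-- Reflecting the tile does not matter. -/
theorem LineTiles.reflect {k l : ℕ} {S : Set ℤ} (h : LineTiles (punctTile k 1 l) S) :
    LineTiles (punctTile l 1 k) S := by
  obtain ⟨f, hf⟩ := h
  refine ⟨fun x => ((f x).1 + (f x).2 * ((k : ℤ) + l), -(f x).2), fun x hx => ?_⟩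
  obtain ⟨h1, ⟨t, ht, hxt⟩, h3⟩ := hf x hx
  refine ⟨?_, ⟨(k : ℤ) + l - t, ?_, ?_⟩, fun s hs => ?_⟩
  · rcases h1 with h1 | h1 <;> simp [h1]
  · simp only [punctTile, Set.mem_ofPred_eq] at ht ⊢
    push_cast at ht ⊢
    omega
  · simp only
    linear_combination hxt
  · have hs' : (k : ℤ) + l - s ∈ punctTile k 1 l := by
      simp only [punctTile, Set.mem_ofPred_eq] at hs ⊢
      push_cast at hs ⊢
      omega
    have e : (f x).1 + (f x).2 * ((k : ℤ) + l) + -(f x).2 * s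
        = (f x).1 + (f x).2 * ((k : ℤ) + l - s) := by ring
    obtain ⟨h4, h5⟩ := h3 _ hs'
    simp only [e]
    exact ⟨h4, by rw [h5]⟩

/-- Gluing line tilings together. -/
theorem tiles_of_lines (T : Set ℤ) (dir : (Fin 3 → ℤ) → Fin 3)
    (H : ∀ (i : Fin 3) (p : Fin 3 → ℤ), LineTiles T {x | dir (Function.update p i x) = i}) :
    TilesZd 3 T := by
  choose f hf using H
  let base : (Fin 3 → ℤ) → ℤ × ℤ := fun p =>
    f (dir p) (Function.update p (dir p) 0) (p (dir p))
  let tile : (Fin 3 → ℤ) → Set (Fin 3 → ℤ) := fun p =>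
    (fun t : ℤ => Function.update p (dir p) ((base p).1 + (base p).2 * t)) '' T
  have key : ∀ p, ((base p).2 = 1 ∨ (base p).2 = -1) ∧ p ∈ tile p ∧
      ∀ y ∈ tile p, tile y = tile p := by
    intro p
    have hb : base p = f (dir p) (Function.update p (dir p) 0) (p (dir p)) := rfl
    obtain ⟨h1, ⟨t, ht, hxt⟩, h3⟩ := hf (dir p) (Function.update p (dir p) 0) (p (dir p))
      (by simp)
    rw [← hb] at h1 hxt h3
    refine ⟨h1, ⟨t, ht, ?_⟩, ?_⟩
    · simp only
      rw [← hxt]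
      simp
    · rintro y ⟨s, hs, rfl⟩
      obtain ⟨h4, h5⟩ := h3 s hs
      simp only [Set.mem_ofPred_eq, Function.update_idem] at h4
      have h6 : base (Function.update p (dir p) ((base p).1 + (base p).2 * s)) = base p := by
        simp only [base]
        simp only [base] at h4 h5
        rw [h4]
        simp only [Function.update_idem, Function.update_self]
        exact h5
      simp only [tile]
      rw [h6, h4]
      simp only [Function.update_idem]
  refine ⟨Set.range tile, ?_, ?_, ?_⟩
  · rintro _ ⟨p, rfl⟩
    refine ⟨Function.update p (dir p) (base p).1, dir p, (base p).2, (key p).1, ?_⟩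
    simp only [tile]
    congr 1
    funext t j
    by_cases hj : j = dir p
    · subst hj
      simp
    · simp [hj]
  · rintro _ ⟨p, rfl⟩ _ ⟨q, rfl⟩ hne
    rw [Set.disjoint_left]
    intro y hy hy'
    exact hne (((key p).2.2 y hy).symm.trans ((key q).2.2 y hy'))
  · ext p
    simp only [Set.mem_sUnion, Set.mem_univ, iff_true]
    exact ⟨tile p, ⟨p, rfl⟩, (key p).2.1⟩

theorem divmod_unique {M q r x : ℤ} (h : x = M * q + r) (h0 : 0 ≤ r) (h1 : r < M) :
    x / M = q ∧ x % M = r := by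
  subst h
  constructor
  · rw [Int.add_comm, Int.add_mul_ediv_left _ _ (by omega), Int.ediv_eq_zero_of_lt h0 h1]
    simp
  · rw [Int.mul_add_emod_self_left, Int.emod_eq_of_lt h0 h1]

/-- Periodic line tilings: the tile covering a point of residue `r` modulo `M` (offset `c`)
has base `(g r).1` and orientation `(g r).2`. -/
theorem LineTiles.periodic (T : Set ℤ) (M c : ℤ) (hM : 0 < M) (P : ℤ → Prop) (g : ℤ → ℤ × ℤ)
    (hg : ∀ r, 0 ≤ r → r < M → P r → ((g r).2 = 1 ∨ (g r).2 = -1) ∧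
      (∃ t ∈ T, r = (g r).1 + (g r).2 * t) ∧
      ∀ t ∈ T, ∃ a r', (g r).1 + (g r).2 * t = M * a + r' ∧ 0 ≤ r' ∧ r' < M ∧ P r' ∧
        (g r').1 + M * a = (g r).1 ∧ (g r').2 = (g r).2) :
    LineTiles T {x | P ((x - c) % M)} := by
  refine ⟨fun x => (c + M * ((x - c) / M) + (g ((x - c) % M)).1, (g ((x - c) % M)).2), ?_⟩
  intro x hx
  have hr0 := Int.emod_nonneg (x - c) hM.ne'
  have hr1 := Int.emod_lt_of_pos (x - c) hM
  have hdm := Int.mul_ediv_add_emod (x - c) M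
  obtain ⟨h1, ⟨t, ht, h2⟩, h3⟩ := hg _ hr0 hr1 hx
  refine ⟨h1, ⟨t, ht, ?_⟩, fun s hs => ?_⟩
  · simp only
    linear_combination h2 - hdm
  · obtain ⟨a, r', e, h4, h5, h6, h7, h8⟩ := h3 s hs
    have := divmod_unique (M := M) (q := (x - c) / M + a) (r := r')
      (x := c + M * ((x - c) / M) + (g ((x - c) % M)).1 + (g ((x - c) % M)).2 * s - c)
      (by linear_combination e) h4 h5
    simp only [Set.mem_ofPred_eq]
    rw [this.1, this.2]
    refine ⟨h6, Prod.ext ?_ h8⟩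
    simp only
    linear_combination h7

/-- The line minus the two residue classes `c`, `c + k + 1` modulo `k + l + 2`. -/
theorem line_holes (k l : ℕ) (c : ℤ) :
    LineTiles (punctTile k 1 l) {x | ¬ ((k : ℤ) + l + 2 ∣ x - c) ∧
      ¬ ((k : ℤ) + l + 2 ∣ x - c - (k + 1))} := by
  have h := LineTiles.periodic (punctTile k 1 l) ((k : ℤ) + l + 2) c (by omega)
    (fun r => r ≠ 0 ∧ r ≠ k + 1) (fun _ => (1, 1)) (by
      intro r h0 h1 ⟨h2, h3⟩
      refine ⟨Or.inl rfl, ⟨r - 1, ?_, by ring⟩, fun t ht => ⟨0, 1 + t, ?_⟩⟩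
      · simp only [punctTile, Set.mem_ofPred_eq]
        push_cast
        omega
      · simp only [punctTile, Set.mem_ofPred_eq] at ht
        push_cast at ht
        simp only
        refine ⟨by ring, ?_, ?_, ⟨?_, ?_⟩, by ring, trivial⟩ <;> omega)
  convert h using 1
  ext x
  simp only [Set.mem_ofPred_eq]
  rw [Int.dvd_iff_emod_eq_zero, ne_eq]
  have e : ((k : ℤ) + l + 2 ∣ x - c - (k + 1)) ↔ (x - c) % ((k : ℤ) + l + 2) = k + 1 := by
    constructor
    · rintro ⟨q, hq⟩
      exact (divmod_unique (q := q) (by linear_combination hq) (by omega) (by omega)).2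
    · intro hq
      exact ⟨(x - c) / ((k : ℤ) + l + 2), by
        linear_combination hq - Int.mul_ediv_add_emod (x - c) ((k : ℤ) + l + 2)⟩
  rw [e]

/-- Layers in which the set `A` is covered inside the layer, by residue mod `3(k+l)`. -/
def layA (k l : ℕ) (r : ℤ) : Prop :=
  r = 0 ∨ ((l : ℤ) + 1 ≤ r ∧ r ≤ k + l - 1) ∨ r = k + l + l ∨
    (2 * ((k : ℤ) + l) + 1 ≤ r ∧ r ≤ 2 * ((k : ℤ) + l) + l - 1)

theorem line_layers (k l : ℕ) (hk : 0 < k) (hl : 0 < l) (c : ℤ) :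
    LineTiles (punctTile k 1 l) {x | ¬ layA k l ((x - c) % (3 * ((k : ℤ) + l)))} := by
  apply LineTiles.periodic (punctTile k 1 l) (3 * ((k : ℤ) + l)) c (by omega)
    (fun r => ¬ layA k l r)
    (fun r => if r ≤ l then (-(k : ℤ), 1) else
      if r ≤ 2 * ((k : ℤ) + l) then (2 * ((k : ℤ) + l), -1) else (2 * ((k : ℤ) + l) + l, 1))
  intro r h0 h1 h2
  simp only [layA] at h2
  by_cases c1 : r ≤ l
  · simp only [c1, if_true]
    refine ⟨by simp, ⟨r + k, ?_, by ring⟩, fun t ht => ?_⟩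
    · simp only [punctTile, Set.mem_ofPred_eq]
      push_cast
      omega
    · simp only [punctTile, Set.mem_ofPred_eq] at ht
      push_cast at ht
      by_cases c2 : t < k
      · refine ⟨-1, t - k + 3 * ((k : ℤ) + l), by ring, by omega, by omega, ?_, ?_⟩
        · simp only [layA]; omega
        · rw [if_neg (by omega), if_neg (by omega)]
          exact ⟨by ring, rfl⟩
      · refine ⟨0, t - k, by ring, by omega, by omega, ?_, ?_⟩
        · simp only [layA]; omega
        · rw [if_pos (by omega)]
          exact ⟨by ring, rfl⟩
  · by_cases c2 : r ≤ 2 * ((k : ℤ) + l)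
    · simp only [c1, c2, if_true, if_false]
      refine ⟨by simp, ⟨2 * ((k : ℤ) + l) - r, ?_, by ring⟩, fun t ht => ?_⟩
      · simp only [punctTile, Set.mem_ofPred_eq]
        push_cast
        omega
      · simp only [punctTile, Set.mem_ofPred_eq] at ht
        push_cast at ht
        refine ⟨0, 2 * ((k : ℤ) + l) - t, by ring, by omega, by omega, ?_, ?_⟩
        · simp only [layA]; omega
        · rw [if_neg (by omega), if_pos (by omega)]
          exact ⟨by ring, rfl⟩
    · simp only [c1, c2, if_false]
      refine ⟨by simp, ⟨r - (2 * ((k : ℤ) + l) + l), ?_, by ring⟩, fun t ht => ?_⟩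
      · simp only [punctTile, Set.mem_ofPred_eq]
        push_cast
        omega
      · simp only [punctTile, Set.mem_ofPred_eq] at ht
        push_cast at ht
        by_cases c3 : t < k
        · refine ⟨0, 2 * ((k : ℤ) + l) + l + t, by ring, by omega, by omega, ?_, ?_⟩
          · simp only [layA]; omega
          · rw [if_neg (by omega), if_neg (by omega)]
            exact ⟨by ring, rfl⟩
        · refine ⟨1, t - k, by ring, by omega, by omega, ?_, ?_⟩
          · simp only [layA]; omega
          · rw [if_pos (by omega)]
            exact ⟨by ring, rfl⟩

/-- Layer `z` covers the set number `a` (`a = 0, 1, 2` for `A, B, C`). -/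
def lay (k l : ℕ) (a z : ℤ) : Prop :=
  layA k l ((z - a * ((k : ℤ) + l)) % (3 * ((k : ℤ) + l)))

/-- In each layer exactly one of the three sets is covered. -/
theorem lay_partition (k l : ℕ) (hk : 0 < k) (hl : 0 < l) (z : ℤ) :
    (lay k l 0 z → ¬ lay k l 1 z) ∧ (lay k l 2 z ↔ ¬ lay k l 0 z ∧ ¬ lay k l 1 z) := by
  obtain ⟨n, hn⟩ : ∃ n : ℤ, n = (k : ℤ) + l := ⟨_, rfl⟩
  have hr0 := Int.emod_nonneg z (b := 3 * n) (by omega)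
  have hr1 := Int.emod_lt_of_pos z (b := 3 * n) (by omega)
  have hdm := Int.mul_ediv_add_emod z (3 * n)
  have e1 : (z - 1 * n) % (3 * n) =
      if n ≤ z % (3 * n) then z % (3 * n) - n else z % (3 * n) + 2 * n := by
    split_ifs with hc
    · exact (divmod_unique (q := z / (3 * n)) (by linear_combination -hdm)
        (by omega) (by omega)).2
    · exact (divmod_unique (q := z / (3 * n) - 1) (by linear_combination -hdm)
        (by omega) (by omega)).2
  have e2 : (z - 2 * n) % (3 * n) =
      if 2 * n ≤ z % (3 * n) then z % (3 * n) - 2 * n else z % (3 * n) + n := by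
    split_ifs with hc
    · exact (divmod_unique (q := z / (3 * n)) (by linear_combination -hdm)
        (by omega) (by omega)).2
    · exact (divmod_unique (q := z / (3 * n) - 1) (by linear_combination -hdm)
        (by omega) (by omega)).2
  simp only [lay, ← hn]
  rw [e1, e2, zero_mul, sub_zero]
  generalize z % (3 * n) = r at *
  simp only [layA]
  split_ifs <;> constructor <;> omega

/-- Position of `x` inside its quadruple. -/
def qi (x : ℤ) : ℤ := (-x) % 4

/-- First element of the quadruple of `x`. -/
def qu (k : ℕ) (x : ℤ) : ℤ := x - qi x * (k + 1)

theorem qi_cases (x : ℤ) : qi x = 0 ∨ qi x = 1 ∨ qi x = 2 ∨ qi x = 3 := by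
  simp only [qi]; omega

theorem qu_dvd (k : ℕ) (hk : k % 4 = 2) (x : ℤ) : 4 ∣ qu k x := by
  simp only [qu]
  rcases qi_cases x with h | h | h | h <;> rw [h] <;> simp only [qi] at h <;> omega

theorem quad_iff (k l : ℕ) (hk : k % 4 = 2) (hl : 4 ∣ l) (x c j : ℤ) (hc : 4 ∣ c)
    (hj : j = 0 ∨ j = 1 ∨ j = 2 ∨ j = 3) :
    ((k : ℤ) + l + 2 ∣ qu k x - c ∧ qi x = j) ↔ (k : ℤ) + l + 2 ∣ x - c - j * (k + 1) := by
  have e : qi x = j → qu k x - c = x - c - j * (k + 1) := by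
    intro h
    simp only [qu, h]
    ring
  constructor
  · rintro ⟨h1, h2⟩
    rwa [← e h2]
  · intro h
    have h2 : qi x = j := by
      have h4 : (4 : ℤ) ∣ x - c - j * (k + 1) := Dvd.dvd.trans (by omega) h
      simp only [qi]
      rcases hj with rfl | rfl | rfl | rfl <;> omega
    exact ⟨by rwa [e h2], h2⟩

set_option maxHeartbeats 1000000 in
theorem exists_dir (k l : ℕ) (hk : 0 < k) (hl : 0 < l) (hk4 : k % 4 = 2) (hl4 : 4 ∣ l) :
    ∃ dir : (Fin 3 → ℤ) → Fin 3, ∀ (i : Fin 3) (p : Fin 3 → ℤ),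
      LineTiles (punctTile k 1 l) {x | dir (Function.update p i x) = i} := by
  classical
  let R : ℤ → ℤ → Prop := fun x y => (k : ℤ) + l + 2 ∣ qu k x - qu k y
  let A : ℤ → ℤ → Prop := fun x y => R x y ∧ qi x < 2 ∧ 2 ≤ qi y
  let B : ℤ → ℤ → Prop := fun x y => R x y ∧ qi x < 2 ∧ qi y < 2
  let C : ℤ → ℤ → Prop := fun x y => R x y ∧ 2 ≤ qi x ∧ qi y < 2
  let dir : (Fin 3 → ℤ) → Fin 3 := fun p =>
    if lay k l 0 (p 2) then (if B (p 0) (p 1) ∨ C (p 0) (p 1) then 2 else 1)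
    else if lay k l 1 (p 2) then (if A (p 0) (p 1) ∨ C (p 0) (p 1) then 2 else 0)
    else (if A (p 0) (p 1) ∨ B (p 0) (p 1) then 2 else 0)
  -- the sets left open on a line
  have low : ∀ x c, 4 ∣ c → (((k : ℤ) + l + 2 ∣ qu k x - c ∧ qi x < 2) ↔
      ((k : ℤ) + l + 2 ∣ x - c ∨ (k : ℤ) + l + 2 ∣ x - c - (k + 1))) := by
    intro x c hc
    have h0 := quad_iff k l hk4 hl4 x c 0 hc (by omega)
    have h1 := quad_iff k l hk4 hl4 x c 1 hc (by omega)
    rw [zero_mul, sub_zero] at h0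
    rw [one_mul] at h1
    rw [← h0, ← h1]
    have := qi_cases x
    constructor
    · rintro ⟨h, h'⟩
      have : qi x = 0 ∨ qi x = 1 := by omega
      tauto
    · rintro (⟨h, h'⟩ | ⟨h, h'⟩) <;> exact ⟨h, by omega⟩
  have high : ∀ x c, 4 ∣ c → (((k : ℤ) + l + 2 ∣ qu k x - c ∧ 2 ≤ qi x) ↔
      ((k : ℤ) + l + 2 ∣ x - (c + 2 * (k + 1)) ∨
        (k : ℤ) + l + 2 ∣ x - (c + 2 * (k + 1)) - (k + 1))) := by
    intro x c hc
    have h0 := quad_iff k l hk4 hl4 x c 2 hc (by omega)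
    have h1 := quad_iff k l hk4 hl4 x c 3 hc (by omega)
    rw [show x - (c + 2 * ((k : ℤ) + 1)) = x - c - 2 * (k + 1) by ring,
      show x - c - 2 * ((k : ℤ) + 1) - (k + 1) = x - c - 3 * (k + 1) by ring, ← h0, ← h1]
    have := qi_cases x
    constructor
    · rintro ⟨h, h'⟩
      have : qi x = 2 ∨ qi x = 3 := by omega
      tauto
    · rintro (⟨h, h'⟩ | ⟨h, h'⟩) <;> exact ⟨h, by omega⟩
  have Rsymm : ∀ x y, R x y ↔ R y x := fun x y => dvd_sub_comm
  have sAB : ∀ x y, (A x y ∨ B x y) ↔ (R x y ∧ qi x < 2) := by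
    intro x y
    have : 2 ≤ qi y ∨ qi y < 2 := by omega
    simp only [A, B]
    tauto
  have sBC : ∀ x y, (B x y ∨ C x y) ↔ (R y x ∧ qi y < 2) := by
    intro x y
    have : 2 ≤ qi x ∨ qi x < 2 := by omega
    have := Rsymm x y
    simp only [B, C]
    tauto
  have sAC1 : ∀ x y, qi y < 2 → ((A x y ∨ C x y) ↔ (R x y ∧ 2 ≤ qi x)) := by
    intro x y h
    have : ¬ 2 ≤ qi y := by omega
    simp only [A, C]
    tauto
  have sAC2 : ∀ x y, ¬ qi y < 2 → ((A x y ∨ C x y) ↔ (R x y ∧ qi x < 2)) := by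
    intro x y h
    have : 2 ≤ qi y := by omega
    simp only [A, C]
    tauto
  have nA : ∀ x y, A x y → ¬ (B x y ∨ C x y) := by
    intro x y h h'
    simp only [A, B, C] at h h'
    omega
  have nB : ∀ x y, B x y → ¬ (A x y ∨ C x y) := by
    intro x y h h'
    simp only [A, B, C] at h h'
    omega
  have nC : ∀ x y, C x y → ¬ (A x y ∨ B x y) := by
    intro x y h h'
    simp only [A, B, C] at h h'
    omega
  have hemp : ∀ S : Set ℤ, (∀ x, x ∉ S) → LineTiles (punctTile k 1 l) S := by
    intro S hS
    rw [Set.eq_empty_of_forall_notMem hS]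
    exact LineTiles.empty _
  have hholes : ∀ (S : Set ℤ) (c : ℤ), (∀ x, x ∈ S ↔ ¬ ((k : ℤ) + l + 2 ∣ x - c ∨
      (k : ℤ) + l + 2 ∣ x - c - (k + 1))) → LineTiles (punctTile k 1 l) S := by
    intro S c hS
    convert line_holes k l c using 1
    ext x
    rw [hS, not_or]
    rfl
  have hlay : ∀ (S : Set ℤ) (a : ℤ), (∀ x, x ∈ S ↔ ¬ lay k l a x) →
      LineTiles (punctTile k 1 l) S := by
    intro S a hS
    convert line_layers k l hk hl (a * ((k : ℤ) + l)) using 1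
    ext x
    rw [hS]
    rfl
  refine ⟨dir, fun i p => ?_⟩
  fin_cases i
  · -- first axis
    have hd : ∀ x, dir (Function.update p 0 x) =
        if lay k l 0 (p 2) then (if B x (p 1) ∨ C x (p 1) then 2 else 1)
        else if lay k l 1 (p 2) then (if A x (p 1) ∨ C x (p 1) then 2 else 0)
        else (if A x (p 1) ∨ B x (p 1) then 2 else 0) := fun x => by
      simp [dir]
    by_cases h0 : lay k l 0 (p 2)
    · apply hemp
      intro x
      simp only [Fin.zero_eta, Set.mem_ofPred_eq, hd, h0, if_true]
      split_ifs <;> decide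
    · by_cases h1 : lay k l 1 (p 2)
      · by_cases h2 : qi (p 1) < 2
        · apply hholes _ (qu k (p 1) + 2 * (k + 1))
          intro x
          rw [← high x _ (qu_dvd k hk4 _)]
          simp only [Fin.zero_eta, Set.mem_ofPred_eq, hd, h0, h1, if_true, if_false]
          have e := sAC1 x (p 1) h2
          simp only [R] at e
          rw [← e]
          split_ifs with h <;> simp [h]
        · apply hholes _ (qu k (p 1))
          intro x
          rw [← low x _ (qu_dvd k hk4 _)]
          simp only [Fin.zero_eta, Set.mem_ofPred_eq, hd, h0, h1, if_true, if_false]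
          have e := sAC2 x (p 1) h2
          simp only [R] at e
          rw [← e]
          split_ifs with h <;> simp [h]
      · apply hholes _ (qu k (p 1))
        intro x
        rw [← low x _ (qu_dvd k hk4 _)]
        simp only [Fin.zero_eta, Set.mem_ofPred_eq, hd, h0, h1, if_false]
        have e := sAB x (p 1)
        simp only [R] at e
        rw [← e]
        split_ifs with h <;> simp [h]
  · -- second axis
    have hd : ∀ y, dir (Function.update p 1 y) =
        if lay k l 0 (p 2) then (if B (p 0) y ∨ C (p 0) y then 2 else 1)
        else if lay k l 1 (p 2) then (if A (p 0) y ∨ C (p 0) y then 2 else 0)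
        else (if A (p 0) y ∨ B (p 0) y then 2 else 0) := fun y => by
      simp [dir]
    by_cases h0 : lay k l 0 (p 2)
    · apply hholes _ (qu k (p 0))
      intro y
      rw [← low y _ (qu_dvd k hk4 _)]
      simp only [Fin.mk_one, Set.mem_ofPred_eq, hd, h0, if_true]
      have e := sBC (p 0) y
      simp only [R] at e
      rw [← e]
      split_ifs with h <;> simp [h]
    · apply hemp
      intro y
      simp only [Fin.mk_one, Set.mem_ofPred_eq, hd, h0, if_false]
      split_ifs <;> decide
  · -- third axis
    have hd : ∀ z, dir (Function.update p 2 z) =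
        if lay k l 0 z then (if B (p 0) (p 1) ∨ C (p 0) (p 1) then 2 else 1)
        else if lay k l 1 z then (if A (p 0) (p 1) ∨ C (p 0) (p 1) then 2 else 0)
        else (if A (p 0) (p 1) ∨ B (p 0) (p 1) then 2 else 0) := fun z => by
      simp [dir]
    have hset : {x | dir (Function.update p 2 x) = 2} = {z |
        (if lay k l 0 z then (B (p 0) (p 1) ∨ C (p 0) (p 1))
        else if lay k l 1 z then (A (p 0) (p 1) ∨ C (p 0) (p 1))
        else (A (p 0) (p 1) ∨ B (p 0) (p 1)))} := by
      ext z
      simp only [Set.mem_ofPred_eq, hd]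
      split_ifs <;>
        first | exact iff_of_true rfl ‹_› | exact iff_of_false (by decide) ‹_›
    change LineTiles (punctTile k 1 l) {x | dir (Function.update p 2 x) = 2}
    rw [hset]
    clear hset hd
    have hp := lay_partition k l hk hl
    have nA' := nA (p 0) (p 1)
    have nB' := nB (p 0) (p 1)
    have nC' := nC (p 0) (p 1)
    generalize A (p 0) (p 1) = a at nA' nB' nC' ⊢
    generalize B (p 0) (p 1) = b at nA' nB' nC' ⊢
    generalize C (p 0) (p 1) = c at nA' nB' nC' ⊢
    clear nA nB nC sAB sBC sAC1 sAC2 Rsymm low high hholes dir A B C R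
    by_cases ha : a
    · apply hlay _ 0
      intro z
      have := hp z
      simp only [Set.mem_ofPred_eq]
      split_ifs <;> tauto
    · by_cases hb : b
      · apply hlay _ 1
        intro z
        have := hp z
        simp only [Set.mem_ofPred_eq]
        split_ifs <;> tauto
      · by_cases hc : c
        · apply hlay _ 2
          intro z
          have := hp z
          simp only [Set.mem_ofPred_eq]
          split_ifs <;> tauto
        · apply hemp
          intro z
          simp only [Set.mem_ofPred_eq]
          split_ifs <;> tauto

/-- If `k ≡ 2 (mod 4)` and `4 ∣ ℓ` (or vice versa), then `k(1)ℓ` tiles `ℤ^3`. -/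
theorem two_mod_four_and_div_four_tiles_Z3 (k l : ℕ) (hk : 0 < k) (hl : 0 < l)
    (h : (k % 4 = 2 ∧ 4 ∣ l) ∨ (l % 4 = 2 ∧ 4 ∣ k)) :
    TilesZd 3 (punctTile k 1 l) := by
  rcases h with ⟨h1, h2⟩ | ⟨h1, h2⟩
  · obtain ⟨dir, hd⟩ := exists_dir k l hk hl h1 h2
    exact tiles_of_lines _ dir hd
  · obtain ⟨dir, hd⟩ := exists_dir l k hl hk h1 h2
    exact tiles_of_lines _ dir fun i p => (hd i p).reflect
end

section
/- For a positive integer k, let T_k be the one-dimensional tile consisting of an interval of length k, then k alternating blocks of (gap of length k−1, interval of length 1), then a final gap of length k−1 followed by an interval of length k; in notation, T_k = k(k−1)1(k−1)1⋯(k−1)1(k−1)k with k occurrences of the gap-and-unit pattern inside. Then T_k does not tile ℤ^d whenever d < (k² + 2k − 1)/(3k − 1). -/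
/-- The tile `T_k = k(k−1)1(k−1)1⋯(k−1)1(k−1)k` (with `k` unit intervals):
an interval of length `k`, then units at positions `i·k + k − 1` for `1 ≤ i ≤ k`,
then a final interval `{k²+2k−1, …, k²+3k−2}`. -/
def Tk (k : ℕ) : Set ℤ :=
  {x : ℤ | (0 ≤ x ∧ x < (k : ℤ)) ∨
    (∃ i : ℕ, 1 ≤ i ∧ i ≤ k ∧ x = (i : ℤ) * k + k - 1) ∨
    ((k : ℤ)^2 + 2*k - 1 ≤ x ∧ x < (k : ℤ)^2 + 3*k - 1)}

/-- `T_k` is symmetric about its midpoint. -/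
lemma Tk_symm (k : ℕ) (x : ℤ) (hx : x ∈ Tk k) : (k : ℤ)^2 + 3*k - 2 - x ∈ Tk k := by
  rcases hx with h | ⟨i, h1, h2, rfl⟩ | h
  · right; right; constructor <;> linarith [h.1, h.2]
  · right; left
    refine ⟨k + 1 - i, by omega, by omega, ?_⟩
    rw [Nat.cast_sub (by omega)]; push_cast; ring
  · left; constructor <;> linarith [h.1, h.2]

/-- Normal form of a copy, with the orientation removed. -/
lemma copy_normal (k d : ℕ) (P : Set (Fin d → ℤ)) (h : IsCopy d (Tk k) P) :
    ∃ (v : Fin d → ℤ) (i : Fin d), ∀ z, z ∈ P ↔ (z i - v i ∈ Tk k ∧ ∀ j, j ≠ i → z j = v j) := by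
  obtain ⟨v, i, ε, hε, rfl⟩ := h
  rcases hε with rfl | rfl
  · refine ⟨v, i, fun z => ⟨?_, ?_⟩⟩
    · rintro ⟨x, hx, rfl⟩
      refine ⟨by simpa using hx, fun j hj => by simp [hj]⟩
    · rintro ⟨h1, h2⟩
      refine ⟨_, h1, funext fun j => ?_⟩
      by_cases hj : j = i
      · subst hj; simp
      · simp [hj, h2 j hj]
  · refine ⟨fun j => v j - if j = i then (k : ℤ)^2 + 3*k - 2 else 0, i, fun z => ⟨?_, ?_⟩⟩
    · rintro ⟨x, hx, rfl⟩
      refine ⟨?_, fun j hj => by simp [hj]⟩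
      have := Tk_symm k x hx
      convert this using 1
      simp; ring
    · rintro ⟨h1, h2⟩
      refine ⟨_, Tk_symm k _ h1, funext fun j => ?_⟩
      by_cases hj : j = i
      · subst hj; simp; ring
      · simp [hj, h2 j hj]

/-- Two translates at distance less than the length of the tile meet. -/
lemma Tk_meet (k : ℕ) (hk : 0 < k) (δ : ℤ) (h0 : 0 < δ) (hδ : δ < (k : ℤ)^2 + 3*k - 1) :
    ∃ t, t ∈ Tk k ∧ t - δ ∈ Tk k := by
  have hk' : (0 : ℤ) < k := by exact_mod_cast hk
  by_cases hbig : (k : ℤ)^2 + 2*k ≤ δ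
  · exact ⟨δ, Or.inr (Or.inr ⟨by linarith, hδ⟩), Or.inl ⟨by simp, by simpa using hk'⟩⟩
  · have hm := Int.emod_add_mul_ediv δ k
    have hm0 := Int.emod_nonneg δ hk'.ne'
    have hm1 := Int.emod_lt_of_pos δ hk'
    have hq0 : 0 ≤ δ / k := Int.ediv_nonneg h0.le hk'.le
    have hq1 : δ / k < k + 2 := by
      apply Int.ediv_lt_of_lt_mul hk'
      nlinarith
    obtain ⟨q, hq⟩ := Int.eq_ofNat_of_zero_le hq0
    rw [hq] at hm hq1
    refine ⟨(q : ℤ) * k + k - 1, ?_, Or.inl ⟨by linarith, by linarith⟩⟩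
    rcases Nat.eq_zero_or_pos q with rfl | hqp
    · left; push_cast; constructor <;> linarith
    · by_cases hqk : q ≤ k
      · exact Or.inr (Or.inl ⟨q, hqp, hqk, rfl⟩)
      · have : q = k + 1 := by omega
        subst this
        right; right; push_cast; constructor <;> nlinarith

/-- `T_k` has at most `3k` elements, and lies in an interval. -/
lemma Tk_finset (k : ℕ) (hk : 0 < k) : ∃ S : Finset ℤ, S.card ≤ 3 * k ∧ ∀ x, x ∈ Tk k → x ∈ S := by
  refine ⟨Finset.Ico 0 (k : ℤ) ∪ ((Finset.Icc 1 k).image (fun i : ℕ => (i : ℤ) * k + k - 1) ∪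
    Finset.Ico ((k : ℤ)^2 + 2*k - 1) ((k : ℤ)^2 + 3*k - 1)), ?_, ?_⟩
  · refine (Finset.card_union_le _ _).trans ?_
    have h1 := Finset.card_union_le ((Finset.Icc 1 k).image (fun i : ℕ => (i : ℤ) * k + k - 1))
      (Finset.Ico ((k : ℤ)^2 + 2*k - 1) ((k : ℤ)^2 + 3*k - 1))
    have h2 := Finset.card_image_le (s := Finset.Icc 1 k) (f := fun i : ℕ => (i : ℤ) * k + k - 1)
    have h3 : (Finset.Ico ((k : ℤ)^2 + 2*k - 1) ((k : ℤ)^2 + 3*k - 1)).card = k := by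
      rw [Int.card_Ico]; ring_nf; simp
    have h4 : (Finset.Ico 0 (k : ℤ)).card = k := by simp
    have h5 : (Finset.Icc 1 k).card = k := by simp
    omega
  · rintro x (h | ⟨i, h1, h2, rfl⟩ | h)
    · simp [h.1, h.2]
    · refine Finset.mem_union_right _ (Finset.mem_union_left _ (Finset.mem_image.2 ⟨i, ?_, rfl⟩))
      simp [h1, h2]
    · exact Finset.mem_union_right _ (Finset.mem_union_right _ (Finset.mem_Ico.2 h))

/-- Density bound: a tiling forces `k² + 3k - 1 ≤ 3kd`. -/
lemma density (k d N : ℕ) (hk : 0 < k) (hN : N + 1 = k^2 + 3*k) (h : TilesZd d (Tk k)) :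
    N ≤ d * (3 * k) := by
  obtain ⟨F, hF, hdis, hcov⟩ := h
  have hcover : ∀ x : Fin d → ℤ, ∃ P : F, x ∈ P.1 := by
    intro x
    have : x ∈ ⋃₀ F := by rw [hcov]; trivial
    obtain ⟨P, hP, hx⟩ := this
    exact ⟨⟨P, hP⟩, hx⟩
  choose P hP using hcover
  choose V I hVI using fun P : F => copy_normal k d P.1 (hF P.1 P.2)
  obtain ⟨S, hS, hTS⟩ := Tk_finset k hk
  have hNz : (N : ℤ) = (k : ℤ)^2 + 3*k - 1 := by
    have : ((N + 1 : ℕ) : ℤ) = ((k^2 + 3*k : ℕ) : ℤ) := by rw [hN]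
    push_cast at this; linarith
  -- two tiles in the same direction on the same line at small distance coincide
  have key : ∀ Q R : F, I Q = I R → (∀ j, j ≠ I Q → V Q j = V R j) →
      V Q (I Q) < V R (I Q) → V R (I Q) - V Q (I Q) < N → False := by
    intro Q R hI hV hlt hlen
    obtain ⟨t, ht, ht'⟩ := Tk_meet k hk (V R (I Q) - V Q (I Q)) (by linarith) (by linarith)
    let z := Function.update (V Q) (I Q) (V Q (I Q) + t)
    have hzQ : z ∈ Q.1 := by
      rw [hVI]
      refine ⟨by simpa [z] using ht, fun j hj => by simp [z, hj]⟩
    have hzR : z ∈ R.1 := by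
      rw [hVI, ← hI]
      refine ⟨?_, fun j hj => by simp [z, hj, hV j hj]⟩
      convert ht' using 1
      simp [z]; ring
    have hQR : Q = R := by
      by_contra hne
      have := hdis Q.2 R.2 (fun e => hne (Subtype.ext e))
      exact Set.disjoint_left.1 this hzQ hzR
    subst hQR
    exact lt_irrefl _ hlt
  let box : Finset (Fin d → ℤ) := Fintype.piFinset (fun _ => Finset.Ico (0 : ℤ) N)
  let tgt : Finset (Σ _ : Fin d, Fin d → ℤ) := Finset.univ.sigma
    (fun i : Fin d => Fintype.piFinset (fun j => if j = i then S else Finset.Ico (0 : ℤ) N))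
  have hcard : box.card ≤ tgt.card := by
    refine Finset.card_le_card_of_injOn (fun x => ⟨I (P x), Function.update x (I (P x))
      (x (I (P x)) - V (P x) (I (P x)))⟩) ?_ ?_
    · intro x hx
      have hx' : ∀ j, 0 ≤ x j ∧ x j < N := by
        simpa [box, Fintype.mem_piFinset] using hx
      have hm := (hVI (P x) x).1 (hP x)
      simp only [tgt, Finset.mem_coe, Finset.mem_sigma, Finset.mem_univ, true_and,
        Fintype.mem_piFinset]
      intro j
      by_cases hj : j = I (P x)
      · subst hj; simpa using hTS _ hm.1
      · simpa [hj] using hx' j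
    · intro x hx y hy hxy
      have hx' : ∀ j, 0 ≤ x j ∧ x j < N := by
        simpa [box, Fintype.mem_piFinset] using hx
      have hy' : ∀ j, 0 ≤ y j ∧ y j < N := by
        simpa [box, Fintype.mem_piFinset] using hy
      have hmx := (hVI (P x) x).1 (hP x)
      have hmy := (hVI (P y) y).1 (hP y)
      simp only [Sigma.mk.injEq, heq_eq_eq] at hxy
      obtain ⟨hI, hu⟩ := hxy
      rw [← hI] at hu hmy
      have hoff : ∀ j, j ≠ I (P x) → x j = y j := fun j hj => by
        simpa [hj] using congrFun hu j
      have hon : x (I (P x)) - V (P x) (I (P x)) = y (I (P x)) - V (P y) (I (P x)) := by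
        simpa using congrFun hu (I (P x))
      have hV : ∀ j, j ≠ I (P x) → V (P x) j = V (P y) j := fun j hj => by
        rw [← hmx.2 j hj, ← hmy.2 j hj, hoff j hj]
      have h1 := hx' (I (P x))
      have h2 := hy' (I (P x))
      have heq : V (P x) (I (P x)) = V (P y) (I (P x)) := by
        rcases lt_trichotomy (V (P x) (I (P x))) (V (P y) (I (P x))) with hl | he | hl
        · exact (key _ _ hI hV hl (by linarith)).elim
        · exact he
        · refine (key (P y) (P x) hI.symm ?_ ?_ ?_).elim
          · rw [← hI]; exact fun j hj => (hV j hj).symm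
          · rw [← hI]; exact hl
          · rw [← hI]; linarith
      funext j
      by_cases hj : j = I (P x)
      · subst hj; linarith
      · exact hoff j hj
  have hbox : box.card = N ^ d := by simp [box]
  have htgt : tgt.card = d * (S.card * N ^ (d - 1)) := by
    have hi : ∀ i : Fin d, (Fintype.piFinset
        (fun j => if j = i then S else Finset.Ico (0 : ℤ) N)).card = S.card * N ^ (d - 1) := by
      intro i
      rw [Fintype.card_piFinset, ← Finset.mul_prod_erase _ _ (Finset.mem_univ i)]
      rw [if_pos rfl]
      congr 1
      rw [Finset.prod_congr rfl (g := fun _ => N)]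
      · simp
      · intro j hj
        rw [if_neg (Finset.ne_of_mem_erase hj)]; simp
    simp only [tgt, Finset.card_sigma, hi]
    simp
  rw [hbox, htgt] at hcard
  have hNpos : 0 < N := by nlinarith
  rcases Nat.eq_zero_or_pos d with rfl | hd
  · simp at hcard
  · obtain ⟨e, rfl⟩ : ∃ e, d = e + 1 := ⟨d - 1, by omega⟩
    have hp : 0 < N ^ e := by positivity
    rw [pow_succ, Nat.add_sub_cancel] at hcard
    have : N * N ^ e ≤ ((e + 1) * S.card) * N ^ e := by nlinarith
    exact (Nat.le_of_mul_le_mul_right this hp).trans (Nat.mul_le_mul_left _ hS)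

/-- `T_k` does not tile `ℤ^d` whenever `d < (k² + 2k − 1)/(3k − 1)`. -/
theorem Tk_not_tiles (k d : ℕ) (hk : 0 < k)
    (hd : (d : ℚ) < ((k : ℚ)^2 + 2*k - 1) / (3*k - 1)) :
    ¬ TilesZd d (Tk k) := by
  intro h
  have hk1 : (1 : ℚ) ≤ k := by exact_mod_cast hk
  rw [lt_div_iff₀ (by linarith)] at hd
  have hb := density k d (k^2 + 3*k - 1) hk (Nat.sub_add_cancel (by nlinarith)) h
  have hb' : k^2 + 3*k ≤ d * (3*k) + 1 := by omega
  have hbq : (k : ℚ)^2 + 3*k ≤ d * (3*k) + 1 := by exact_mod_cast hb'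
  have hdk : (d : ℚ) ≤ k := by
    by_contra hc
    push Not at hc
    nlinarith
  nlinarith
end
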